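/- Let ϱ > 2 and let μ ∈ A₁ and ν ∈ A_∞ be Muckenhoupt weights on ℝ^n. Then there is a constant C (depending on n, ϱ and the weights) such that for every bounded compactly supported measurable function f and every λ > 0, λ·(μν)({x ∈ ℝ^n : V_ϱ(e^{tΔ})(fν)(x) > λ·ν(x)}) ≤ C ∫_{ℝ^n} |f(x)|·μ(x)·ν(x) dx, where (μν)(E) = ∫_E μν. -/

import Mathlib

open MeasureTheory ENNReal Set
noncomputable section

/-- `ℝ^n` with the Euclidean norm. -/
abbrev Rn (n : ℕ) := EuclideanSpace ℝ (Fin n)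

/-- The cube of center `c` and side length `r`. -/
def cube {n : ℕ} (c : Rn n) (r : ℝ) : Set (Rn n) := {y | ∀ i, |y i - c i| ≤ r / 2}

/-- `ψ_θ(Q) = (1 + r_Q/ρ(x_Q))^θ` for the cube `Q` of center `c` and side length `r`. -/
def psi {n : ℕ} (ρ : Rn n → ℝ) (θ : ℝ) (c : Rn n) (r : ℝ) : ℝ := (1 + r / ρ c) ^ θ

/-- `ρ` is a critical radius function with constants `C₀, N₀`. -/
def IsCriticalRadiusWith {n : ℕ} (ρ : Rn n → ℝ) (C₀ N₀ : ℝ) : Prop :=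
  0 < C₀ ∧ 0 < N₀ ∧ (∀ x, 0 < ρ x) ∧ ∀ x y : Rn n,
    C₀⁻¹ * ρ x * (1 + ‖x - y‖ / ρ x) ^ (-N₀) ≤ ρ y ∧
    ρ y ≤ C₀ * ρ x * (1 + ‖x - y‖ / ρ x) ^ (N₀ / (N₀ + 1))

/-- `ρ` is a critical radius function. -/
def IsCriticalRadius {n : ℕ} (ρ : Rn n → ℝ) : Prop := ∃ C₀ N₀, IsCriticalRadiusWith ρ C₀ N₀

/-- A weight: locally integrable and a.e. positive. -/
def IsWeight {n : ℕ} (w : Rn n → ℝ) : Prop :=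
  LocallyIntegrable w (volume : Measure (Rn n)) ∧ ∀ᵐ x : Rn n, 0 < w x

/-- `w(S) = ∫_S w`. -/
def wMeas {n : ℕ} (w : Rn n → ℝ) (S : Set (Rn n)) : ℝ≥0∞ :=
  ∫⁻ x in S, ENNReal.ofReal (w x)

/-- Fractional maximal operator `M_α^{ρ,θ}` associated with the critical radius function `ρ`. -/
def fracMax (n : ℕ) (ρ : Rn n → ℝ) (θ α : ℝ) (f : Rn n → ℝ) (x : Rn n) : ℝ≥0∞ :=
  ⨆ (c : Rn n) (r : ℝ) (_ : 0 < r) (_ : x ∈ cube c r),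
    ENNReal.ofReal ((psi ρ θ c r * r ^ n) ^ (α / n - 1)) *
      ∫⁻ y in cube c r, ENNReal.ofReal |f y|

/-- The Lorentz `L^{p,1}(w)` norm. -/
def lorentzP1 {n : ℕ} (p : ℝ) (w : Rn n → ℝ) (f : Rn n → ℝ) : ℝ≥0∞ :=
  ENNReal.ofReal p * ∫⁻ y in Ioi (0 : ℝ), (wMeas w {x | y < |f x|}) ^ (1 / p)

/-- The weak `L^{q,∞}(w)` quasi-norm of an `ℝ≥0∞`-valued function. -/
def weakNormE {n : ℕ} (q : ℝ) (w : Rn n → ℝ) (F : Rn n → ℝ≥0∞) : ℝ≥0∞ :=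
  ⨆ (l : ℝ) (_ : 0 < l), ENNReal.ofReal l * (wMeas w {x | ENNReal.ofReal l < F x}) ^ (1 / q)

/-- The weak `L^{q,∞}(w)` quasi-norm of a real function, with `q = ∞` allowed
(in which case it is the `w`-essential supremum). -/
def weakNormR {n : ℕ} (q : ℝ≥0∞) (w : Rn n → ℝ) (f : Rn n → ℝ) : ℝ≥0∞ :=
  if q = ∞ then
    essSup (fun x => ENNReal.ofReal |f x|)
      ((volume : Measure (Rn n)).withDensity fun x => ENNReal.ofReal (w x))
  else ⨆ (l : ℝ) (_ : 0 < l), ENNReal.ofReal l * (wMeas w {x | l < |f x|}) ^ (1 / q.toReal)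

/-- The conjugate exponent `p' = p/(p-1)` (with `1' = ∞`), as an extended real number. -/
def conjE (p : ℝ) : ℝ≥0∞ := if p = 1 then ∞ else ENNReal.ofReal (p / (p - 1))

/-- The constant `[μ,ν]_{A_{p,q,α}^{ρ,θ,R}}`. -/
def ApqR {n : ℕ} (ρ : Rn n → ℝ) (θ α p q : ℝ) (μ ν : Rn n → ℝ) : ℝ≥0∞ :=
  ⨆ (c : Rn n) (r : ℝ) (_ : 0 < r),
    (wMeas ν (cube c r)) ^ (1 / q) *
      weakNormR (conjE p) μ ((cube c r).indicator fun x => (μ x)⁻¹) *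
      ENNReal.ofReal ((r ^ n * psi ρ θ c r) ^ (α / n - 1))

/-- The constant `‖μ,ν‖_{A_{p,q,α}^{ρ,θ,R}}`. -/
def normApqR {n : ℕ} (ρ : Rn n → ℝ) (θ α p q : ℝ) (μ ν : Rn n → ℝ) : ℝ≥0∞ :=
  ⨆ (c : Rn n) (r : ℝ) (_ : 0 < r),
    (wMeas ν (cube c r)) ^ (1 / q) *
      ⨆ (P : Set (Rn n)) (_ : MeasurableSet P) (_ : 0 < wMeas μ P) (_ : wMeas μ P ≠ ∞),
        volume (P ∩ cube c r) * ENNReal.ofReal ((r ^ n * psi ρ θ c r) ^ (α / n - 1)) *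
          (wMeas μ P) ^ (-(1 / p))

/-- The constant `[w]_{A_p^{ρ,σ}}` (for `1 < p < ∞`). -/
def ApC {n : ℕ} (ρ : Rn n → ℝ) (σ p : ℝ) (w : Rn n → ℝ) : ℝ≥0∞ :=
  ⨆ (c : Rn n) (r : ℝ) (_ : 0 < r),
    (ENNReal.ofReal (psi ρ σ c r))⁻¹ *
      ((ENNReal.ofReal (r ^ n))⁻¹ * wMeas w (cube c r)) *
      ((ENNReal.ofReal (r ^ n))⁻¹ *
        ∫⁻ y in cube c r, ENNReal.ofReal (w y ^ (1 - p / (p - 1)))) ^ (p - 1)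
/-- The heat semigroup `e^{tΔ}` on `ℝ^n`. -/
def heatSg (n : ℕ) (t : ℝ) (g : Rn n → ℝ) (x : Rn n) : ℝ :=
  ∫ y : Rn n, (4 * Real.pi * t) ^ (-(n : ℝ) / 2) * Real.exp (-‖x - y‖ ^ 2 / (4 * t)) * g y

/-- The `ϱ`-variation operator of the classical heat semigroup. -/
def varHeat (n : ℕ) (ϱ : ℝ) (g : Rn n → ℝ) (x : Rn n) : ℝ≥0∞ :=
  ⨆ (t : ℕ → ℝ) (_ : StrictAnti t) (_ : ∀ j, 0 < t j)
      (_ : Filter.Tendsto t Filter.atTop (nhds 0)),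
    (∑' j : ℕ, ENNReal.ofReal (|heatSg n (t j) g x - heatSg n (t (j + 1)) g x| ^ ϱ)) ^ (1 / ϱ)

/-- Muckenhoupt `A₁`. -/
def IsA1 {n : ℕ} (w : Rn n → ℝ) : Prop :=
  ∃ C > (0 : ℝ), ∀ (c : Rn n) (r : ℝ), 0 < r →
    wMeas w (cube c r) ≤ ENNReal.ofReal C * ENNReal.ofReal (r ^ n) *
      essInf (fun x => ENNReal.ofReal (w x)) (volume.restrict (cube c r))

/-- Muckenhoupt `A_p`, `1 < p < ∞`. -/
def IsAp {n : ℕ} (p : ℝ) (w : Rn n → ℝ) : Prop :=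
  ∃ C > (0 : ℝ), ∀ (c : Rn n) (r : ℝ), 0 < r →
    wMeas w (cube c r) *
      (∫⁻ y in cube c r, ENNReal.ofReal (w y ^ (1 - p / (p - 1)))) ^ (p - 1) ≤
      ENNReal.ofReal C * (ENNReal.ofReal (r ^ n)) ^ p

/-- Muckenhoupt `A_∞ = ∪_{p ≥ 1} A_p`. -/
def IsAinfty {n : ℕ} (w : Rn n → ℝ) : Prop := IsA1 w ∨ ∃ p > (1 : ℝ), IsAp p w

/-- The class `A₁^{ρ,loc}`, with the `A₁` condition over balls `B(x,r)`, `r ≤ ρ(x)`. -/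
def IsA1loc {n : ℕ} (ρ : Rn n → ℝ) (w : Rn n → ℝ) : Prop :=
  ∃ C > (0 : ℝ), ∀ (x : Rn n) (r : ℝ), 0 < r → r ≤ ρ x →
    wMeas w (Metric.ball x r) ≤ ENNReal.ofReal C * volume (Metric.ball x r) *
      essInf (fun y => ENNReal.ofReal (w y)) (volume.restrict (Metric.ball x r))

/-- The class `A_p^{ρ,loc}` for `1 < p < ∞`. -/
def IsAploc {n : ℕ} (ρ : Rn n → ℝ) (p : ℝ) (w : Rn n → ℝ) : Prop :=
  ∃ C > (0 : ℝ), ∀ (x : Rn n) (r : ℝ), 0 < r → r ≤ ρ x →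
    wMeas w (Metric.ball x r) *
      (∫⁻ y in Metric.ball x r, ENNReal.ofReal (w y ^ (1 - p / (p - 1)))) ^ (p - 1) ≤
      ENNReal.ofReal C * (volume (Metric.ball x r)) ^ p

/-- `A_∞^{ρ,loc} = ∪_{p ≥ 1} A_p^{ρ,loc}`. -/
def IsAinfLoc {n : ℕ} (ρ : Rn n → ℝ) (w : Rn n → ℝ) : Prop :=
  IsA1loc ρ w ∨ ∃ p > (1 : ℝ), IsAploc ρ p w

/-- The class `A₁^{ρ,θ}`. -/
def IsA1rho {n : ℕ} (ρ : Rn n → ℝ) (θ : ℝ) (w : Rn n → ℝ) : Prop :=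
  ∃ C > (0 : ℝ), ∀ (c : Rn n) (r : ℝ), 0 < r →
    wMeas w (cube c r) ≤ ENNReal.ofReal (C * (psi ρ θ c r * r ^ n)) *
      essInf (fun x => ENNReal.ofReal (w x)) (volume.restrict (cube c r))

/-- The class `A_∞^ρ(μ)`. -/
def IsAinfRhoMu {n : ℕ} (ρ : Rn n → ℝ) (μ w : Rn n → ℝ) : Prop :=
  ∃ θ ≥ (0 : ℝ), ∃ ε > (0 : ℝ), ∃ C > (0 : ℝ), ∀ (c : Rn n) (r : ℝ), 0 < r →
    ∀ E ⊆ cube c r, MeasurableSet E →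
      wMeas (fun x => w x * μ x) E ≤ ENNReal.ofReal (C * psi ρ θ c r) *
        (wMeas μ E / wMeas μ (cube c r)) ^ ε * wMeas (fun x => w x * μ x) (cube c r)

/-- The class `A_∞^ρ`. -/
def IsAinfRho {n : ℕ} (ρ : Rn n → ℝ) (w : Rn n → ℝ) : Prop :=
  ∃ θ ≥ (0 : ℝ), ∃ δ > (0 : ℝ), ∃ C > (0 : ℝ), ∀ (c : Rn n) (r : ℝ), 0 < r →
    ∀ E ⊆ cube c r, MeasurableSet E →
      wMeas w E ≤ ENNReal.ofReal (C * psi ρ θ c r) *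
        (volume E / ENNReal.ofReal (r ^ n)) ^ δ * wMeas w (cube c r)

/-- Membership in `RH_∞^{ρ,θ}` with constant `C`. -/
def IsRHinf {n : ℕ} (ρ : Rn n → ℝ) (θ : ℝ) (w : Rn n → ℝ) (C : ℝ) : Prop :=
  ∀ (c : Rn n) (r : ℝ), 0 < r →
    essSup (fun x => ENNReal.ofReal (w x)) (volume.restrict (cube c r)) ≤
      ENNReal.ofReal (C * psi ρ θ c r) * ((ENNReal.ofReal (r ^ n))⁻¹ * wMeas w (cube c r))

/-- An `η`-sparse family of cubes, encoded by their (center, side length) data. -/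
def IsSparse {n : ℕ} (η : ℝ) (S : Set (Rn n × ℝ)) : Prop :=
  S.Countable ∧ (∀ Q ∈ S, 0 < Q.2) ∧
  ∃ E : Rn n × ℝ → Set (Rn n),
    (∀ Q ∈ S, MeasurableSet (E Q) ∧ E Q ⊆ cube Q.1 Q.2 ∧
      ENNReal.ofReal η * volume (cube Q.1 Q.2) ≤ volume (E Q)) ∧
    S.PairwiseDisjoint E

/-- The sparse operator `A_S^{ρ,N}`. -/
def sparseOp {n : ℕ} (ρ : Rn n → ℝ) (N : ℝ) (S : Set (Rn n × ℝ)) (f : Rn n → ℝ)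
    (x : Rn n) : ℝ≥0∞ :=
  ∑' Q : S, (cube (Q : Rn n × ℝ).1 (Q : Rn n × ℝ).2).indicator
    (fun _ => (ENNReal.ofReal ((3 * (Q : Rn n × ℝ).2) ^ n))⁻¹ *
      (∫⁻ y in cube (Q : Rn n × ℝ).1 (3 * (Q : Rn n × ℝ).2), ENNReal.ofReal |f y|) *
      (ENNReal.ofReal (psi ρ N (Q : Rn n × ℝ).1 (Q : Rn n × ℝ).2))⁻¹) x

namespace MixedWeak

/-- The profile `t ^ (-a) * exp (-b / t)` increases up to `b / a`. -/
lemma profile_mono {a b s t : ℝ} (hs : 0 < s) (hst : s ≤ t) (ha : 0 < a) (htb : t ≤ b / a) :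
    s ^ (-a) * Real.exp (-b / s) ≤ t ^ (-a) * Real.exp (-b / t) := by
  have ht : 0 < t := hs.trans_le hst
  rw [Real.rpow_def_of_pos hs, Real.rpow_def_of_pos ht, ← Real.exp_add, ← Real.exp_add]
  apply Real.exp_le_exp.2
  have h1 : Real.log (t / s) ≤ t / s - 1 := Real.log_le_sub_one_of_pos (by positivity)
  rw [Real.log_div ht.ne' hs.ne'] at h1
  have h2 : a * t ≤ b := by rw [le_div_iff₀ ha] at htb; linarith
  have h3 : a * (t / s - 1) ≤ b / s - b / t := by
    rw [div_sub_div _ _ hs.ne' ht.ne', div_sub_one hs.ne', ← mul_div_assoc,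
      div_le_div_iff₀ hs (by positivity)]
    nlinarith [mul_nonneg (sub_nonneg.2 hst) hs.le,
      mul_nonneg (mul_nonneg (sub_nonneg.2 hst) hs.le) (sub_nonneg.2 h2)]
  have h4 := mul_le_mul_of_nonneg_left h1 ha.le
  have e1 : -b / s = -(b / s) := by ring
  have e2 : -b / t = -(b / t) := by ring
  rw [e1, e2]
  linarith

/-- The profile `t ^ (-a) * exp (-b / t)` decreases after `b / a`. -/
lemma profile_anti {a b s t : ℝ} (hs : 0 < s) (hst : s ≤ t) (ha : 0 < a) (htb : b / a ≤ s) :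
    t ^ (-a) * Real.exp (-b / t) ≤ s ^ (-a) * Real.exp (-b / s) := by
  have ht : 0 < t := hs.trans_le hst
  rw [Real.rpow_def_of_pos hs, Real.rpow_def_of_pos ht, ← Real.exp_add, ← Real.exp_add]
  apply Real.exp_le_exp.2
  have h1 : Real.log (s / t) ≤ s / t - 1 := Real.log_le_sub_one_of_pos (by positivity)
  rw [Real.log_div hs.ne' ht.ne'] at h1
  have h2 : b ≤ a * s := by rw [div_le_iff₀ ha] at htb; linarith
  have h3 : b / s - b / t ≤ a * (1 - s / t) := by
    rw [div_sub_div _ _ hs.ne' ht.ne', one_sub_div ht.ne', ← mul_div_assoc,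
      div_le_div_iff₀ (by positivity) ht]
    nlinarith [mul_nonneg (mul_nonneg (sub_nonneg.2 hst) ht.le) (sub_nonneg.2 h2)]
  have h4 := mul_le_mul_of_nonneg_left h1 ha.le
  have e1 : -b / s = -(b / s) := by ring
  have e2 : -b / t = -(b / t) := by ring
  rw [e1, e2]
  linarith

lemma profile_le_max {a b t : ℝ} (ht : 0 < t) (ha : 0 < a) (hb : 0 < b) :
    t ^ (-a) * Real.exp (-b / t) ≤ (b / a) ^ (-a) * Real.exp (-b / (b / a)) := by
  rcases le_total t (b / a) with h | h
  · exact profile_mono ht h ha le_rfl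
  · exact profile_anti (by positivity) h ha le_rfl

/-- The total variation of the profile along a decreasing sequence. -/
lemma profile_variation {a b : ℝ} (ha : 0 < a) (hb : 0 < b) {t : ℕ → ℝ} (ht : Antitone t)
    (h0 : ∀ j, 0 < t j) (N : ℕ) :
    ∑ j ∈ Finset.range N, |t j ^ (-a) * Real.exp (-b / t j)
      - t (j + 1) ^ (-a) * Real.exp (-b / t (j + 1))| ≤ 2 * (a / b) ^ a := by
  set φ : ℝ → ℝ := fun t => t ^ (-a) * Real.exp (-b / t) with hφ
  set S := φ (b / a) with hS
  have hba : 0 < b / a := by positivity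
  have hφ0 : ∀ t, 0 < t → 0 ≤ φ t := fun t ht => by simp only [hφ]; positivity
  have hφS : ∀ t, 0 < t → φ t ≤ S := fun t ht => profile_le_max ht ha hb
  set ψ : ℝ → ℝ := fun t => if t ≤ b / a then φ t else 2 * S - φ t with hψ
  have key : ∀ s t, 0 < s → s ≤ t → |φ t - φ s| ≤ ψ t - ψ s := by
    intro s t hs hst
    have ht0 := hs.trans_le hst
    simp only [hψ]
    by_cases h1 : t ≤ b / a
    · rw [if_pos h1, if_pos (hst.trans h1)]
      rw [abs_of_nonneg (sub_nonneg.2 (profile_mono hs hst ha h1))]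
    · rw [if_neg h1]
      by_cases h2 : s ≤ b / a
      · rw [if_pos h2]
        have := hφS s hs
        have := hφS t ht0
        rw [abs_le]; constructor <;> linarith
      · rw [if_neg h2]
        have := profile_anti hs hst ha (not_le.1 h2).le
        rw [abs_of_nonpos (sub_nonpos.2 this)]; simp only [hφ]; linarith
  have hψ0 : ∀ t, 0 < t → 0 ≤ ψ t ∧ ψ t ≤ 2 * S := by
    intro t ht
    have := hφ0 t ht
    have := hφS t ht
    have := hφ0 _ hba
    simp only [hψ]; split_ifs <;> constructor <;> linarith
  have hSle : S ≤ (a / b) ^ a := by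
    simp only [hS, hφ]
    have e : (b / a) ^ (-a) = (a / b) ^ a := by
      rw [Real.rpow_neg hba.le, ← Real.inv_rpow hba.le, inv_div]
    rw [e]
    have : Real.exp (-b / (b / a)) ≤ 1 := by
      apply Real.exp_le_one_iff.2
      exact div_nonpos_of_nonpos_of_nonneg (by linarith) hba.le
    exact mul_le_of_le_one_right (by positivity) this
  calc _ ≤ ∑ j ∈ Finset.range N, (ψ (t j) - ψ (t (j + 1))) := by
        refine Finset.sum_le_sum fun j _ => key _ _ (h0 _) (ht (Nat.le_succ j))
    _ = ψ (t 0) - ψ (t N) := Finset.sum_range_sub' _ _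
    _ ≤ 2 * S := by linarith [(hψ0 _ (h0 0)).2, (hψ0 _ (h0 N)).1]
    _ ≤ _ := by linarith

/-- The heat kernel. -/
def hk (n : ℕ) (t : ℝ) (z : Rn n) : ℝ :=
  (4 * Real.pi * t) ^ (-(n : ℝ) / 2) * Real.exp (-‖z‖ ^ 2 / (4 * t))

lemma heatSg_eq (n : ℕ) (t : ℝ) (g : Rn n → ℝ) (x : Rn n) :
    heatSg n t g x = ∫ y, hk n t (x - y) * g y := rfl

lemma continuous_hk (n : ℕ) (t : ℝ) : Continuous (hk n t) := by
  unfold hk; fun_prop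

lemma hk_nonneg {n : ℕ} {t : ℝ} (ht : 0 ≤ t) (z : Rn n) : 0 ≤ hk n t z := by
  unfold hk; positivity

lemma hk_neg {n : ℕ} (t : ℝ) (z : Rn n) : hk n t (-z) = hk n t z := by
  unfold hk; rw [norm_neg]

lemma hk_le {n : ℕ} {t : ℝ} (ht : 0 ≤ t) (z : Rn n) :
    hk n t z ≤ (4 * Real.pi * t) ^ (-(n : ℝ) / 2) := by
  unfold hk
  refine mul_le_of_le_one_right (by positivity) ?_
  apply Real.exp_le_one_iff.2
  exact div_nonpos_of_nonpos_of_nonneg (by nlinarith [sq_nonneg ‖z‖]) (by positivity)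

lemma hasDerivAt_hk_segment {n : ℕ} (t : ℝ) (z h : Rn n) (s : ℝ) :
    HasDerivAt (fun s : ℝ => hk n t (z + s • h))
      (hk n t (z + s • h) * (-(2 * inner ℝ (z + s • h) h) / (4 * t))) s := by
  have h1 : HasDerivAt (fun s : ℝ => z + s • h) h s := by
    simpa using ((hasDerivAt_id s).smul_const h).const_add z
  have h2 := ((h1.norm_sq.neg.div_const (4 * t)).exp).const_mul
    ((4 * Real.pi * t) ^ (-(n : ℝ) / 2))
  unfold hk
  refine h2.congr_deriv ?_
  simp only [Pi.neg_apply]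
  ring

/-- Lipschitz bound for the `ℓ¹`-variation of the heat kernel along a segment that avoids `0`. -/
lemma exists_kernel_variation (n : ℕ) : ∃ C : ℝ, 0 < C ∧ ∀ (t : ℕ → ℝ), Antitone t →
    (∀ j, 0 < t j) → ∀ (N : ℕ) (z h : Rn n) (d : ℝ), 0 < d →
    (∀ s ∈ Icc (0 : ℝ) 1, d ≤ ‖z + s • h‖) →
    ∑ j ∈ Finset.range N, |(hk n (t j) (z + h) - hk n (t (j + 1)) (z + h))
      - (hk n (t j) z - hk n (t (j + 1)) z)| ≤ C * ‖h‖ / d ^ (n + 1) := by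
  set a : ℝ := n / 2 + 1 with ha
  have ha0 : 0 < a := by positivity
  set C : ℝ := (4 * Real.pi) ^ (-(n : ℝ) / 2) * (4 * a) ^ a with hC
  have hC0 : 0 < C := by positivity
  refine ⟨C, hC0, ?_⟩
  intro t ht h0 N z h d hd hseg
  set D : ℕ → Rn n → ℝ := fun j w => hk n (t j) w - hk n (t (j + 1)) w with hD
  set ε : ℕ → ℝ := fun j => SignType.sign (D j (z + h) - D j z) with hε
  have hεle : ∀ j, |ε j| ≤ 1 := by
    intro j; simp only [hε]
    rcases SignType.sign (D j (z + h) - D j z) with _ | _ | _ <;> simp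
  set Φ : ℝ → ℝ := fun s => ∑ j ∈ Finset.range N, ε j * D j (z + s • h) with hΦ
  have hk' : ∀ (τ : ℝ) (_ : 0 < τ) (w : Rn n),
      hk n τ w * (-(2 * inner ℝ w h) / (4 * τ)) =
      -(inner ℝ w h / 2) * (4 * Real.pi) ^ (-(n : ℝ) / 2) *
        (τ ^ (-a) * Real.exp (-(‖w‖ ^ 2 / 4) / τ)) := by
    intro τ hτ w
    have e1 : (4 * Real.pi * τ) ^ (-(n : ℝ) / 2)
        = (4 * Real.pi) ^ (-(n : ℝ) / 2) * τ ^ (-(n : ℝ) / 2) :=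
      Real.mul_rpow (by positivity) hτ.le
    have e2 : τ ^ (-a) = τ ^ (-(n : ℝ) / 2) / τ := by
      rw [← Real.rpow_sub_one hτ.ne']; congr 1; rw [ha]; ring
    have e3 : -(‖w‖ ^ 2 / 4) / τ = -‖w‖ ^ 2 / (4 * τ) := by field_simp
    unfold hk
    rw [e1, e2, e3]
    field_simp
    norm_num
  have hder : ∀ s, HasDerivAt Φ (∑ j ∈ Finset.range N, ε j *
      (-(inner ℝ (z + s • h) h / 2) * (4 * Real.pi) ^ (-(n : ℝ) / 2) *
      (t j ^ (-a) * Real.exp (-(‖z + s • h‖ ^ 2 / 4) / t j)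
      - t (j + 1) ^ (-a) * Real.exp (-(‖z + s • h‖ ^ 2 / 4) / t (j + 1))))) s := by
    intro s
    refine HasDerivAt.fun_sum fun j _ => ?_
    have h1 := (hasDerivAt_hk_segment (t j) z h s).sub (hasDerivAt_hk_segment (t (j + 1)) z h s)
    rw [hk' _ (h0 _), hk' _ (h0 _), ← mul_sub] at h1
    exact h1.const_mul (ε j)
  have hbound : ∀ s ∈ Ico (0 : ℝ) 1, ‖∑ j ∈ Finset.range N, ε j *
      (-(inner ℝ (z + s • h) h / 2) * (4 * Real.pi) ^ (-(n : ℝ) / 2) *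
      (t j ^ (-a) * Real.exp (-(‖z + s • h‖ ^ 2 / 4) / t j)
      - t (j + 1) ^ (-a) * Real.exp (-(‖z + s • h‖ ^ 2 / 4) / t (j + 1))))‖
      ≤ C * ‖h‖ / d ^ (n + 1) := by
    intro s hs
    have hds := hseg s (Ico_subset_Icc_self hs)
    set w := z + s • h with hw
    have hw0 : 0 < ‖w‖ := hd.trans_le hds
    have hb : 0 < ‖w‖ ^ 2 / 4 := by positivity
    have hvar := profile_variation ha0 hb ht h0 N
    have hin : |inner ℝ w h| ≤ ‖w‖ * ‖h‖ := abs_real_inner_le_norm w h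
    calc _ ≤ ∑ j ∈ Finset.range N, (‖w‖ * ‖h‖ / 2) * (4 * Real.pi) ^ (-(n : ℝ) / 2) *
          |t j ^ (-a) * Real.exp (-(‖w‖ ^ 2 / 4) / t j)
          - t (j + 1) ^ (-a) * Real.exp (-(‖w‖ ^ 2 / 4) / t (j + 1))| := by
          refine norm_sum_le_of_le _ fun j _ => ?_
          rw [Real.norm_eq_abs, abs_mul, abs_mul, abs_mul, abs_neg, abs_div, abs_two,
            abs_of_nonneg (by positivity : 0 ≤ (4 * Real.pi) ^ (-(n : ℝ) / 2))]
          refine (mul_le_of_le_one_left (by positivity) (hεle j)).trans ?_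
          gcongr
      _ ≤ (‖w‖ * ‖h‖ / 2) * (4 * Real.pi) ^ (-(n : ℝ) / 2) * (2 * (a / (‖w‖ ^ 2 / 4)) ^ a) := by
          rw [← Finset.mul_sum]; gcongr
      _ = C * ‖h‖ / ‖w‖ ^ (n + 1) := by
          have e1 : a / (‖w‖ ^ 2 / 4) = (4 * a) / ‖w‖ ^ 2 := by field_simp
          have e2 : (‖w‖ ^ 2) ^ a = ‖w‖ ^ (n + 2) := by
            rw [← Real.rpow_natCast, ← Real.rpow_mul hw0.le, ← Real.rpow_natCast]
            congr 1; rw [ha]; push_cast; ring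
          rw [e1, Real.div_rpow (by positivity) (by positivity), e2, hC]
          field_simp
          ring
      _ ≤ _ := by gcongr
  have hmvt := norm_image_sub_le_of_norm_deriv_le_segment'
    (f := Φ) (fun s _ => (hder s).hasDerivWithinAt) hbound 1 (right_mem_Icc.2 zero_le_one)
  have e : Φ 1 - Φ 0 = ∑ j ∈ Finset.range N, |D j (z + h) - D j z| := by
    simp only [hΦ, one_smul, zero_smul, add_zero]
    rw [← Finset.sum_sub_distrib]
    refine Finset.sum_congr rfl fun j _ => ?_
    rw [← mul_sub]
    simp only [hε]
    exact sign_mul_self _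
  rw [e] at hmvt
  simpa using (le_abs_self _).trans hmvt

/-- The `ℓ^ϱ` norm of a real sequence. -/
def seqNorm (ϱ : ℝ) (a : ℕ → ℝ) : ℝ≥0∞ := (∑' j, ENNReal.ofReal (|a j| ^ ϱ)) ^ (1 / ϱ)

lemma seqNorm_eq {ϱ : ℝ} (h : 0 < ϱ) (a : ℕ → ℝ) :
    seqNorm ϱ a = (∑' j, ENNReal.ofReal |a j| ^ ϱ) ^ (1 / ϱ) := by
  unfold seqNorm
  congr 2; ext j
  rw [ENNReal.ofReal_rpow_of_nonneg (abs_nonneg _) h.le]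

lemma seqNorm_add_le {ϱ : ℝ} (h : 1 ≤ ϱ) (a b : ℕ → ℝ) :
    seqNorm ϱ (fun j => a j + b j) ≤ seqNorm ϱ a + seqNorm ϱ b := by
  have h0 : 0 < ϱ := by linarith
  rw [seqNorm_eq h0, seqNorm_eq h0, seqNorm_eq h0]
  have := ENNReal.lintegral_Lp_add_le (μ := (Measure.count : Measure ℕ))
    (f := fun j => ENNReal.ofReal |a j|) (g := fun j => ENNReal.ofReal |b j|)
    (measurable_from_top).aemeasurable (measurable_from_top).aemeasurable h
  simp only [lintegral_count, Pi.add_apply] at this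
  refine le_trans ?_ this
  refine ENNReal.rpow_le_rpow ?_ (by positivity)
  refine ENNReal.tsum_le_tsum fun j => ENNReal.rpow_le_rpow ?_ h0.le
  rw [← ENNReal.ofReal_add (abs_nonneg _) (abs_nonneg _)]
  exact ENNReal.ofReal_le_ofReal (abs_add_le _ _)

lemma seqNorm_le_tsum {ϱ : ℝ} (h : 1 ≤ ϱ) (a : ℕ → ℝ) :
    seqNorm ϱ a ≤ ∑' j, ENNReal.ofReal |a j| := by
  have h0 : 0 < ϱ := by linarith
  rw [seqNorm_eq h0]
  set S := ∑' j, ENNReal.ofReal |a j| with hS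
  have key : ∑' j, ENNReal.ofReal |a j| ^ ϱ ≤ S ^ ϱ := by
    calc _ ≤ ∑' j, ENNReal.ofReal |a j| * S ^ (ϱ - 1) := by
          refine ENNReal.tsum_le_tsum fun j => ?_
          have e : ENNReal.ofReal |a j| ^ ϱ = ENNReal.ofReal |a j| * ENNReal.ofReal |a j| ^ (ϱ - 1) := by
            nth_rewrite 2 [← ENNReal.rpow_one (ENNReal.ofReal |a j|)]
            rw [← ENNReal.rpow_add_of_nonneg _ _ zero_le_one (by linarith)]
            congr 1; ring
          rw [e]
          gcongr
          exact ENNReal.le_tsum j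
      _ = S * S ^ (ϱ - 1) := by rw [ENNReal.tsum_mul_right]
      _ = S ^ ϱ := by
          nth_rewrite 1 [← ENNReal.rpow_one S]
          rw [← ENNReal.rpow_add_of_nonneg _ _ zero_le_one (by linarith)]
          congr 1; ring
  calc _ ≤ (S ^ ϱ) ^ (1 / ϱ) := ENNReal.rpow_le_rpow key (by positivity)
    _ = S := by rw [← ENNReal.rpow_mul, mul_one_div_cancel h0.ne', ENNReal.rpow_one]

/-- The increments of the heat semigroup along a sequence of times. -/
def heatInc (n : ℕ) (t : ℕ → ℝ) (g : Rn n → ℝ) (x : Rn n) (j : ℕ) : ℝ :=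
  heatSg n (t j) g x - heatSg n (t (j + 1)) g x

lemma varHeat_eq (n : ℕ) (ϱ : ℝ) (g : Rn n → ℝ) (x : Rn n) :
    varHeat n ϱ g x = ⨆ (t : ℕ → ℝ) (_ : StrictAnti t) (_ : ∀ j, 0 < t j)
      (_ : Filter.Tendsto t Filter.atTop (nhds 0)), seqNorm ϱ (heatInc n t g x) := rfl

/-- Comparison of two variations when the increments differ by at most `R` in `ℓ¹`. -/
lemma varHeat_le_add {n : ℕ} {ϱ : ℝ} (hϱ : 1 ≤ ϱ) {g h : Rn n → ℝ} {x x' : Rn n} {R : ℝ≥0∞}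
    (H : ∀ t : ℕ → ℝ, StrictAnti t → (∀ j, 0 < t j) → ∀ N,
      ∑ j ∈ Finset.range N, ENNReal.ofReal |heatInc n t g x j - heatInc n t h x' j| ≤ R) :
    varHeat n ϱ g x ≤ varHeat n ϱ h x' + R := by
  rw [varHeat_eq, varHeat_eq]
  refine iSup_le fun t => iSup_le fun ht => iSup_le fun h0 => iSup_le fun hl => ?_
  have e : heatInc n t g x = fun j => heatInc n t h x' j +
    (heatInc n t g x j - heatInc n t h x' j) := by ext j; ring
  rw [e]
  refine (seqNorm_add_le hϱ _ _).trans (add_le_add ?_ ?_)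
  · exact le_iSup_of_le t (le_iSup_of_le ht (le_iSup_of_le h0 (le_iSup_of_le hl le_rfl)))
  · refine (seqNorm_le_tsum hϱ _).trans ?_
    rw [ENNReal.tsum_eq_iSup_nat]
    exact iSup_le fun N => H t ht h0 N

lemma integrable_hk_mul {n : ℕ} {t : ℝ} (ht : 0 < t) {g : Rn n → ℝ} (hg : Integrable g)
    (x : Rn n) : Integrable fun y => hk n t (x - y) * g y := by
  refine hg.bdd_mul (c := (4 * Real.pi * t) ^ (-(n : ℝ) / 2)) ?_ ?_
  · exact ((continuous_hk n t).comp (continuous_const.sub continuous_id)).aestronglyMeasurable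
  · refine Filter.Eventually.of_forall fun y => ?_
    rw [Real.norm_of_nonneg (hk_nonneg ht.le _)]
    exact hk_le ht.le _

lemma heatSg_add {n : ℕ} {t : ℝ} (ht : 0 < t) {g h : Rn n → ℝ} (hg : Integrable g)
    (hh : Integrable h) (x : Rn n) :
    heatSg n t (fun y => g y + h y) x = heatSg n t g x + heatSg n t h x := by
  simp only [heatSg_eq]
  rw [← integral_add (integrable_hk_mul ht hg x) (integrable_hk_mul ht hh x)]
  simp only [mul_add]

lemma varHeat_add_le {n : ℕ} {ϱ : ℝ} (hϱ : 1 ≤ ϱ) {g h : Rn n → ℝ} (hg : Integrable g)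
    (hh : Integrable h) (x : Rn n) :
    varHeat n ϱ (fun y => g y + h y) x ≤ varHeat n ϱ g x + varHeat n ϱ h x := by
  simp only [varHeat_eq]
  refine iSup_le fun t => iSup_le fun ht => iSup_le fun h0 => iSup_le fun hl => ?_
  have e : heatInc n t (fun y => g y + h y) x
      = fun j => heatInc n t g x j + heatInc n t h x j := by
    ext j; simp only [heatInc, heatSg_add (h0 _) hg hh]; ring
  rw [e]
  refine (seqNorm_add_le hϱ _ _).trans (add_le_add ?_ ?_)
  · exact le_iSup_of_le t (le_iSup_of_le ht (le_iSup_of_le h0 (le_iSup_of_le hl le_rfl)))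
  · exact le_iSup_of_le t (le_iSup_of_le ht (le_iSup_of_le h0 (le_iSup_of_le hl le_rfl)))

lemma heatSg_congr_ae {n : ℕ} {g h : Rn n → ℝ} (e : g =ᵐ[volume] h) (t : ℝ) (x : Rn n) :
    heatSg n t g x = heatSg n t h x := by
  refine integral_congr_ae ?_
  filter_upwards [e] with y hy
  simp only [hy]

lemma varHeat_congr_ae {n : ℕ} {g h : Rn n → ℝ} (e : g =ᵐ[volume] h) (ϱ : ℝ) :
    varHeat n ϱ g = varHeat n ϱ h := by
  ext x
  simp only [varHeat_eq]
  have : ∀ t, heatInc n t g x = heatInc n t h x := by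
    intro t; ext j; simp only [heatInc, heatSg_congr_ae e]
  simp only [this]

lemma varHeat_zero {n : ℕ} {ϱ : ℝ} (hϱ : 0 < ϱ) (x : Rn n) :
    varHeat n ϱ (fun _ => 0) x = 0 := by
  simp [varHeat, heatSg, Real.zero_rpow hϱ.ne', hϱ]

lemma heatSg_const_mul {n : ℕ} (t c : ℝ) (g : Rn n → ℝ) (x : Rn n) :
    heatSg n t (fun y => c * g y) x = c * heatSg n t g x := by
  simp only [heatSg_eq]
  rw [← integral_const_mul]
  congr 1; ext y; ring

lemma varHeat_const_mul {n : ℕ} {ϱ : ℝ} (hϱ : 0 < ϱ) {c : ℝ} (hc : 0 < c) (g : Rn n → ℝ)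
    (x : Rn n) : varHeat n ϱ (fun y => c * g y) x = ENNReal.ofReal c * varHeat n ϱ g x := by
  simp only [varHeat_eq, ENNReal.mul_iSup]
  have : ∀ t, seqNorm ϱ (heatInc n t (fun y => c * g y) x)
      = ENNReal.ofReal c * seqNorm ϱ (heatInc n t g x) := by
    intro t
    rw [seqNorm_eq hϱ, seqNorm_eq hϱ]
    have : ∀ j, ENNReal.ofReal |heatInc n t (fun y => c * g y) x j| ^ ϱ
        = ENNReal.ofReal c ^ ϱ * ENNReal.ofReal |heatInc n t g x j| ^ ϱ := by
      intro j
      simp only [heatInc, heatSg_const_mul]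
      rw [← mul_sub, abs_mul, abs_of_pos hc, ENNReal.ofReal_mul hc.le,
        ENNReal.mul_rpow_of_nonneg _ _ hϱ.le]
    simp only [this]
    rw [ENNReal.tsum_mul_left, ENNReal.mul_rpow_of_nonneg _ _ (by positivity), ← ENNReal.rpow_mul,
      mul_one_div_cancel hϱ.ne', ENNReal.rpow_one]
  simp only [this]

lemma continuous_heatSg {n : ℕ} {t : ℝ} (ht : 0 < t) {g : Rn n → ℝ} (hg : Integrable g) :
    Continuous (heatSg n t g) := by
  have : heatSg n t g = fun x => ∫ y, hk n t (x - y) * g y := rfl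
  rw [this]
  refine continuous_of_dominated (bound := fun y => (4 * Real.pi * t) ^ (-(n : ℝ) / 2) * ‖g y‖)
    (fun x => (integrable_hk_mul ht hg x).aestronglyMeasurable) ?_ (hg.norm.const_mul _) ?_
  · refine fun x => Filter.Eventually.of_forall fun y => ?_
    rw [norm_mul, Real.norm_of_nonneg (hk_nonneg ht.le _)]
    gcongr
    exact hk_le ht.le _
  · refine Filter.Eventually.of_forall fun y => ?_
    exact ((continuous_hk n t).comp (continuous_id.sub continuous_const)).mul continuous_const

lemma measurable_varHeat {n : ℕ} {ϱ : ℝ} (hϱ : 0 < ϱ) {g : Rn n → ℝ} (hg : Integrable g) :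
    Measurable (varHeat n ϱ g) := by
  refine LowerSemicontinuous.measurable ?_
  have : varHeat n ϱ g = fun x => ⨆ (t : ℕ → ℝ) (_ : StrictAnti t) (_ : ∀ j, 0 < t j)
      (_ : Filter.Tendsto t Filter.atTop (nhds 0)),
      (∑' j, ENNReal.ofReal (|heatInc n t g x j| ^ ϱ)) ^ (1 / ϱ) := rfl
  rw [this]
  refine lowerSemicontinuous_iSup fun t => lowerSemicontinuous_iSup fun ht =>
    lowerSemicontinuous_iSup fun h0 => lowerSemicontinuous_iSup fun hl => ?_
  have hls : LowerSemicontinuous fun x => ∑' j, ENNReal.ofReal (|heatInc n t g x j| ^ ϱ) := by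
    refine lowerSemicontinuous_tsum fun j => Continuous.lowerSemicontinuous ?_
    refine ENNReal.continuous_ofReal.comp ?_
    refine Continuous.rpow_const ?_ fun _ => Or.inr hϱ.le
    exact ((continuous_heatSg (h0 _) hg).sub (continuous_heatSg (h0 _) hg)).abs
  exact ENNReal.continuous_rpow_const.comp_lowerSemicontinuous hls
    (ENNReal.monotone_rpow_of_nonneg (by positivity))

/-- One step of the greedy `θ`-approximation of a sequence. -/
def gstep (θ β a : ℝ) : ℝ := if θ ≤ |a - β| then a else β

/-- The greedy `θ`-approximation of the sequence `a`, started at `β`. -/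
def greedy (θ β : ℝ) (a : ℕ → ℝ) : ℕ → ℝ
  | 0 => β
  | i + 1 => gstep θ (greedy θ β a i) (a i)

lemma greedy_succ' (θ β : ℝ) (a : ℕ → ℝ) (i : ℕ) :
    greedy θ β a (i + 1) = greedy θ (gstep θ β (a 0)) (fun j => a (j + 1)) i := by
  induction i with
  | zero => rfl
  | succ i ih => rw [greedy, ih]; rfl

/-- The quadratic variation of the greedy approximation. -/
def greedySq (θ β : ℝ) (a : ℕ → ℝ) (K : ℕ) : ℝ :=
  ∑ i ∈ Finset.range (K + 1), (greedy θ β a (i + 1) - greedy θ β a i) ^ 2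

lemma greedySq_nonneg (θ β : ℝ) (a : ℕ → ℝ) (K : ℕ) : 0 ≤ greedySq θ β a K :=
  Finset.sum_nonneg fun _ _ => sq_nonneg _

lemma greedySq_zero (θ β : ℝ) (a : ℕ → ℝ) : greedySq θ β a 0 = (gstep θ β (a 0) - β) ^ 2 := by
  simp [greedySq, greedy]

lemma greedySq_succ (θ β : ℝ) (a : ℕ → ℝ) (K : ℕ) :
    greedySq θ β a (K + 1) = (gstep θ β (a 0) - β) ^ 2 +
      greedySq θ (gstep θ β (a 0)) (fun j => a (j + 1)) K := by
  unfold greedySq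
  rw [Finset.sum_range_succ', add_comm]
  congr 1
  refine Finset.sum_congr rfl fun i _ => ?_
  rw [greedy_succ', greedy_succ' θ β a i]

lemma abs_sub_greedy_lt {θ : ℝ} (hθ : 0 < θ) (β : ℝ) (a : ℕ → ℝ) (i : ℕ) :
    |a i - greedy θ β a (i + 1)| < θ := by
  rw [greedy, gstep]
  split_ifs with h
  · simpa using hθ
  · exact not_le.1 h

lemma greedy_sub_eq_zero_or (θ β : ℝ) (a : ℕ → ℝ) (i : ℕ) :
    greedy θ β a (i + 1) = greedy θ β a i ∨
      θ ≤ |greedy θ β a (i + 1) - greedy θ β a i| := by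
  rw [greedy, gstep]
  split_ifs with h
  · exact Or.inr h
  · exact Or.inl rfl

lemma sq_le_sum_greedy {θ : ℝ} (hθ : 0 < θ) (β : ℝ) (a : ℕ → ℝ) {p q : ℕ} (hpq : p ≤ q)
    (h : 3 * θ ≤ |a p - a q|) :
    θ ^ 2 ≤ ∑ i ∈ Finset.Ico (p + 1) (q + 1), (greedy θ β a (i + 1) - greedy θ β a i) ^ 2 := by
  have h1 := abs_sub_greedy_lt hθ β a p
  have h2 := abs_sub_greedy_lt hθ β a q
  by_contra! hlt
  have hall : ∀ i ∈ Finset.Ico (p + 1) (q + 1), greedy θ β a (i + 1) = greedy θ β a i := by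
    intro i hi
    rcases greedy_sub_eq_zero_or θ β a i with h | h
    · exact h
    · exfalso
      have h3 : θ ^ 2 ≤ (greedy θ β a (i + 1) - greedy θ β a i) ^ 2 := by
        rw [← sq_abs (greedy θ β a (i + 1) - greedy θ β a i)]
        exact pow_le_pow_left₀ hθ.le h 2
      have h4 := Finset.single_le_sum
        (f := fun i => (greedy θ β a (i + 1) - greedy θ β a i) ^ 2)
        (fun i _ => sq_nonneg _) hi
      linarith
  have he : greedy θ β a (q + 1) - greedy θ β a (p + 1) = 0 := by
    rw [← Finset.sum_Ico_sub (greedy θ β a) (by omega : p + 1 ≤ q + 1)]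
    exact Finset.sum_eq_zero fun i hi => sub_eq_zero.2 (hall i hi)
  have : |a p - a q| < 2 * θ := by
    rw [abs_lt] at *
    constructor <;> linarith [h1.1, h1.2, h2.1, h2.2]
  linarith

lemma exists_dyadic_level {lam d : ℝ} (hd : 0 < d) (hdl : d ≤ 2 * lam) :
    ∃ k : ℕ, 3 * (lam * (1 / 2) ^ k) ≤ d ∧ d ≤ 6 * (lam * (1 / 2) ^ k) := by
  have hl : 0 < lam := by linarith
  obtain ⟨k, h1, h2⟩ := exists_nat_pow_near_of_lt_one (x := d / (3 * lam)) (y := 1 / 2)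
    (by positivity) (by rw [div_le_one (by positivity)]; linarith) (by norm_num) (by norm_num)
  refine ⟨k + 1, ?_, ?_⟩
  · rw [lt_div_iff₀ (by positivity)] at h1; linarith
  · rw [div_le_iff₀ (by positivity)] at h2
    rw [pow_succ]; linarith

/-- The weighted sum of the quadratic variations over all dyadic heights. -/
def greedyTotal (ϱ lam : ℝ) (a : ℕ → ℝ) (K : ℕ) : ℝ≥0∞ :=
  ∑' k : ℕ, ENNReal.ofReal (6 ^ ϱ * (lam * (1 / 2) ^ k) ^ (ϱ - 2)) *
    ENNReal.ofReal (greedySq (lam * (1 / 2) ^ k) 0 a K)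

lemma sum_jumps_le {ϱ lam : ℝ} (hϱ : 0 < ϱ) (hl : 0 < lam) {a : ℕ → ℝ} {K : ℕ}
    (ha : ∀ i ≤ K, |a i| ≤ lam) {p : ℕ → ℕ} (hp : Monotone p) {N : ℕ} (hpN : p N ≤ K) :
    ∑ j ∈ Finset.range N, ENNReal.ofReal (|a (p j) - a (p (j + 1))| ^ ϱ)
      ≤ greedyTotal ϱ lam a K := by
  set S : ℕ → ℕ → ℝ := fun k i => (greedy (lam * (1 / 2) ^ k) 0 a (i + 1)
    - greedy (lam * (1 / 2) ^ k) 0 a i) ^ 2 with hS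
  have hS0 : ∀ k i, 0 ≤ S k i := fun _ _ => sq_nonneg _
  have key : ∀ j < N, ENNReal.ofReal (|a (p j) - a (p (j + 1))| ^ ϱ) ≤
      ∑' k : ℕ, ENNReal.ofReal (6 ^ ϱ * (lam * (1 / 2) ^ k) ^ (ϱ - 2)) *
        ENNReal.ofReal (∑ i ∈ Finset.Ico (p j + 1) (p (j + 1) + 1), S k i) := by
    intro j hj
    set d := |a (p j) - a (p (j + 1))| with hd
    rcases (abs_nonneg (a (p j) - a (p (j + 1)))).eq_or_lt with h0 | h0
    · rw [hd, ← h0, Real.zero_rpow hϱ.ne', ENNReal.ofReal_zero]; exact zero_le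
    have hb : d ≤ 2 * lam := by
      have h1 := ha (p j) ((hp hj.le).trans hpN)
      have h2 := ha (p (j + 1)) ((hp hj).trans hpN)
      exact (abs_sub _ _).trans (by linarith)
    obtain ⟨k, hk1, hk2⟩ := exists_dyadic_level h0 hb
    set θ := lam * (1 / 2) ^ k with hθ
    have hθ0 : 0 < θ := by positivity
    refine le_trans ?_ (ENNReal.le_tsum k)
    rw [← ENNReal.ofReal_mul (by positivity)]
    refine ENNReal.ofReal_le_ofReal ?_
    have h3 := sq_le_sum_greedy hθ0 0 a (hp (Nat.le_succ j)) hk1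
    calc d ^ ϱ ≤ (6 * θ) ^ ϱ := Real.rpow_le_rpow h0.le hk2 hϱ.le
      _ = 6 ^ ϱ * θ ^ (ϱ - 2) * θ ^ 2 := by
        rw [Real.mul_rpow (by norm_num) hθ0.le, mul_assoc, ← Real.rpow_natCast θ 2,
          ← Real.rpow_add hθ0]
        norm_num
      _ ≤ _ := by gcongr
  calc _ ≤ ∑ j ∈ Finset.range N, ∑' k : ℕ, ENNReal.ofReal (6 ^ ϱ * (lam * (1 / 2) ^ k) ^ (ϱ - 2)) *
        ENNReal.ofReal (∑ i ∈ Finset.Ico (p j + 1) (p (j + 1) + 1), S k i) :=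
        Finset.sum_le_sum fun j hj => key j (Finset.mem_range.1 hj)
    _ = ∑' k : ℕ, ENNReal.ofReal (6 ^ ϱ * (lam * (1 / 2) ^ k) ^ (ϱ - 2)) *
        ENNReal.ofReal (∑ j ∈ Finset.range N,
          ∑ i ∈ Finset.Ico (p j + 1) (p (j + 1) + 1), S k i) := by
        rw [← Summable.tsum_finsetSum fun _ _ => ENNReal.summable]
        congr 1; ext k
        rw [ENNReal.ofReal_sum_of_nonneg fun j _ => Finset.sum_nonneg fun i _ => hS0 k i,
          Finset.mul_sum]
    _ ≤ _ := by
        unfold greedyTotal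
        gcongr with k
        have e : ∑ j ∈ Finset.range N, ∑ i ∈ Finset.Ico (p j + 1) (p (j + 1) + 1), S k i
            = ∑ i ∈ Finset.Ico (p 0 + 1) (p N + 1), S k i := by
          clear key hpN
          induction N with
          | zero => simp
          | succ N ih =>
            rw [Finset.sum_range_succ, ih, Finset.sum_Ico_consecutive]
            · exact Nat.succ_le_succ (hp (Nat.zero_le _))
            · exact Nat.succ_le_succ (hp (Nat.le_succ _))
        rw [e]
        refine Finset.sum_le_sum_of_subset_of_nonneg ?_ fun i _ _ => hS0 k i
        intro i hi
        simp only [Finset.mem_Ico, Finset.mem_range] at *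
        omega

/-- The law of `√(2t)` times a standard Gaussian vector, i.e. the heat kernel at time `t`. -/
def gm (n : ℕ) (t : ℝ) : Measure (Rn n) :=
  (ProbabilityTheory.stdGaussian (Rn n)).map (fun x => √(2 * t) • x)

instance (n : ℕ) (t : ℝ) : IsProbabilityMeasure (gm n t) :=
  Measure.isProbabilityMeasure_map (by fun_prop)

lemma charFun_gm {n : ℕ} {t : ℝ} (ht : 0 ≤ t) (ξ : Rn n) :
    charFun (gm n t) ξ = Complex.exp (-(t * ‖ξ‖ ^ 2)) := by
  unfold gm
  rw [charFun_map_smul, ProbabilityTheory.charFun_stdGaussian, norm_smul,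
    Real.norm_of_nonneg (Real.sqrt_nonneg _)]
  congr 1
  push_cast
  rw [mul_pow, ← Complex.ofReal_pow, Real.sq_sqrt (by positivity)]
  push_cast
  ring

/-- The law of a signed partial sum of independent Gaussian steps. -/
lemma map_sum_gm {n K : ℕ} {s : ℝ} (hs : 0 ≤ s) (J : Finset (Fin K)) (σ : ℝ) (hσ : σ ^ 2 = 1) :
    (Measure.pi fun _ : Fin K => gm n s).map (fun ω => σ • ∑ j ∈ J, ω j) = gm n (J.card * s) := by
  have : IsProbabilityMeasure ((Measure.pi fun _ : Fin K => gm n s).map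
      (fun ω => σ • ∑ j ∈ J, ω j)) := Measure.isProbabilityMeasure_map (by fun_prop)
  refine Measure.ext_of_charFun ?_
  ext ξ
  rw [charFun_gm (by positivity), charFun_map_smul_comp (by fun_prop), charFun_apply,
    integral_map (by fun_prop) (by fun_prop)]
  have e : ∀ ω : Fin K → Rn n, Complex.exp ((inner ℝ (∑ j ∈ J, ω j) (σ • ξ) : ℝ) * Complex.I)
      = ∏ j : Fin K, (if j ∈ J then Complex.exp ((inner ℝ (ω j) (σ • ξ) : ℝ) * Complex.I) else 1) := by
    intro ω
    rw [Finset.prod_ite_mem, Finset.univ_inter, ← Complex.exp_sum, sum_inner]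
    push_cast
    rw [Finset.sum_mul]
  simp only [e]
  rw [integral_fintype_prod_eq_prod (f := fun (j : Fin K) (z : Rn n) =>
    if j ∈ J then Complex.exp ((inner ℝ z (σ • ξ) : ℝ) * Complex.I) else 1)]
  have e2 : ∀ j : Fin K, (∫ z, (if j ∈ J then Complex.exp ((inner ℝ z (σ • ξ) : ℝ) * Complex.I)
      else 1) ∂(gm n s)) = if j ∈ J then Complex.exp (-(s * ‖ξ‖ ^ 2)) else 1 := by
    intro j
    split_ifs
    · have := charFun_gm hs (σ • ξ)
      rw [charFun_apply] at this
      rw [this, norm_smul, Real.norm_eq_abs]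
      congr 2
      push_cast
      rw [mul_pow, ← Complex.ofReal_pow, sq_abs, hσ]
      simp
    · simp
  simp only [e2]
  rw [Finset.prod_ite_mem, Finset.univ_inter, Finset.prod_const, ← Complex.exp_nat_mul]
  congr 1
  push_cast
  ring

lemma integrable_hk {n : ℕ} {t : ℝ} (ht : 0 < t) : Integrable (hk n t) := by
  unfold hk
  refine Integrable.const_mul ?_ _
  have := (GaussianFourier.integrable_cexp_neg_mul_sq_norm_add (V := Rn n)
    (b := (1 / (4 * t) : ℝ)) (by simp; positivity) 0 0).norm
  refine this.congr (Filter.Eventually.of_forall fun y => ?_)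
  simp only [Complex.norm_exp]
  congr 1
  simp [← Complex.ofReal_pow]
  field_simp

lemma gm_eq_withDensity {n : ℕ} {t : ℝ} (ht : 0 < t) :
    gm n t = (volume : Measure (Rn n)).withDensity fun z => ENNReal.ofReal (hk n t z) := by
  have hfin : IsFiniteMeasure ((volume : Measure (Rn n)).withDensity
      fun z => ENNReal.ofReal (hk n t z)) :=
    isFiniteMeasure_withDensity_ofReal (integrable_hk ht).2
  refine Measure.ext_of_charFun ?_
  ext ξ
  rw [charFun_gm ht.le, charFun_apply,
    integral_withDensity_eq_integral_toReal_smul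
      ((continuous_hk n t).measurable.ennreal_ofReal) (by simp)]
  have e : ∀ z : Rn n, (ENNReal.ofReal (hk n t z)).toReal •
      Complex.exp ((inner ℝ z ξ : ℝ) * Complex.I)
      = (((4 * Real.pi * t) ^ (-(n : ℝ) / 2) : ℝ) : ℂ) *
        Complex.exp (-((1 / (4 * t) : ℝ) : ℂ) * ‖z‖ ^ 2 + Complex.I * (inner ℝ ξ z : ℝ)) := by
    intro z
    rw [ENNReal.toReal_ofReal (hk_nonneg ht.le z), hk, Complex.real_smul, Complex.ofReal_mul,
      Complex.ofReal_exp, mul_assoc, ← Complex.exp_add, real_inner_comm]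
    congr 2
    push_cast
    field_simp
  simp only [e]
  rw [integral_const_mul, GaussianFourier.integral_cexp_neg_mul_sq_norm_add (by simp; positivity)]
  rw [finrank_euclideanSpace, Fintype.card_fin, ← mul_assoc]
  have e2 : (((4 * Real.pi * t) ^ (-(n : ℝ) / 2) : ℝ) : ℂ) *
      ((Real.pi : ℂ) / ((1 / (4 * t) : ℝ) : ℂ)) ^ ((n : ℂ) / 2) = 1 := by
    have : ((Real.pi : ℂ) / ((1 / (4 * t) : ℝ) : ℂ)) = ((4 * Real.pi * t : ℝ) : ℂ) := by
      push_cast; field_simp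
    rw [this]
    have h2 : ((n : ℂ) / 2) = (((n : ℝ) / 2 : ℝ) : ℂ) := by push_cast; rfl
    rw [h2, ← Complex.ofReal_cpow (by positivity), ← Complex.ofReal_mul,
      ← Real.rpow_add (by positivity)]
    simp [neg_div]
  rw [e2, one_mul]
  congr 1
  rw [Complex.I_sq]
  push_cast
  field_simp

/-- The averaging operator with the heat kernel at time `t`. -/
def av (n : ℕ) (t : ℝ) (h : Rn n → ℝ) (y : Rn n) : ℝ := ∫ z, h (y + z) ∂(gm n t)

lemma av_eq_heatSg {n : ℕ} {t : ℝ} (ht : 0 < t) (h : Rn n → ℝ) (y : Rn n) :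
    av n t h y = heatSg n t h y := by
  rw [av, gm_eq_withDensity ht, integral_withDensity_eq_integral_toReal_smul
      ((continuous_hk n t).measurable.ennreal_ofReal) (by simp), heatSg_eq]
  rw [← integral_sub_left_eq_self (fun z => hk n t (y - z) * h z) volume y,
    ← integral_neg_eq_self]
  congr 1; ext z
  rw [ENNReal.toReal_ofReal (hk_nonneg ht.le _), hk_neg, smul_eq_mul]
  congr 2
  abel_nf

lemma av_zero (n : ℕ) (h : Rn n → ℝ) (hm : Measurable h) (y : Rn n) : av n 0 h y = h y := by
  unfold av gm
  rw [integral_map (by fun_prop)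
    (show AEStronglyMeasurable (fun z => h (y + z)) _ from
      (hm.comp (measurable_const_add y)).aestronglyMeasurable)]
  simp

lemma measurable_gstep {α : Type*} [MeasurableSpace α] (θ : ℝ) {β a : α → ℝ} (hβ : Measurable β)
    (ha : Measurable a) : Measurable fun p => gstep θ (β p) (a p) := by
  unfold gstep
  exact Measurable.ite (measurableSet_le measurable_const (by fun_prop)) ha hβ

lemma measurable_greedy {α : Type*} [MeasurableSpace α] (θ β : ℝ) {a : α → ℕ → ℝ}
    (ha : ∀ i, Measurable fun p => a p i) (i : ℕ) : Measurable fun p => greedy θ β (a p) i := by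
  induction i with
  | zero => exact measurable_const
  | succ i ih => exact measurable_gstep θ ih (ha i)

lemma measurable_greedySq {α : Type*} [MeasurableSpace α] (θ β : ℝ) {a : α → ℕ → ℝ}
    (ha : ∀ i, Measurable fun p => a p i) (K : ℕ) : Measurable fun p => greedySq θ β (a p) K := by
  unfold greedySq
  refine Finset.measurable_fun_sum _ fun i _ => ?_
  exact ((measurable_greedy θ β ha _).sub (measurable_greedy θ β ha _)).pow_const 2

lemma measurable_av {n : ℕ} (t : ℝ) {h : Rn n → ℝ} (hm : Measurable h) :
    Measurable (av n t h) := by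
  have : StronglyMeasurable (fun p : Rn n × Rn n => h (p.1 + p.2)) :=
    (hm.comp (measurable_fst.add measurable_snd)).stronglyMeasurable
  exact (this.integral_prod_right' (ν := gm n t)).measurable

lemma abs_av_le {n : ℕ} (t : ℝ) {h : Rn n → ℝ} {M : ℝ} (hM : ∀ x, |h x| ≤ M) (y : Rn n) :
    |av n t h y| ≤ M := by
  have := norm_integral_le_of_norm_le_const (μ := gm n t) (f := fun z => h (y + z)) (C := M)
    (Filter.Eventually.of_forall fun z => hM _)
  simpa [av] using this

/-- The martingale of averages of `h` along a Gaussian random walk started at `y`. -/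
def walk (n : ℕ) (s : ℝ) (h : Rn n → ℝ) (K : ℕ) (y : Rn n) (ω : Fin K → Rn n) (i : ℕ) : ℝ :=
  av n ((K - i : ℕ) * s) h (y + ∑ j : Fin K with j.val < i, ω j)

/-- The law of the steps of the random walk. -/
abbrev stepLaw (n : ℕ) (s : ℝ) (K : ℕ) : Measure (Fin K → Rn n) := Measure.pi fun _ => gm n s

lemma measurable_walk {n : ℕ} (s : ℝ) {h : Rn n → ℝ} (hm : Measurable h) (K i : ℕ) :
    Measurable fun p : Rn n × (Fin K → Rn n) => walk n s h K p.1 p.2 i := by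
  unfold walk
  refine (measurable_av _ hm).comp ?_
  fun_prop

lemma walk_cons {n : ℕ} (s : ℝ) (h : Rn n → ℝ) (K : ℕ) (y w : Rn n) (ω : Fin K → Rn n) (i : ℕ) :
    walk n s h (K + 1) y (Fin.cons w ω) (i + 1) = walk n s h K (y + w) ω i := by
  unfold walk
  rw [Nat.add_sub_add_right, Finset.sum_filter, Finset.sum_filter, Fin.sum_univ_succ]
  simp [add_assoc]

lemma walk_zero {n : ℕ} (s : ℝ) (h : Rn n → ℝ) (K : ℕ) (y : Rn n) (ω : Fin K → Rn n) :
    walk n s h K y ω 0 = av n (K * s) h y := by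
  simp [walk]

lemma lintegral_stepLaw_succ {n : ℕ} (s : ℝ) (K : ℕ) {F : (Fin (K + 1) → Rn n) → ℝ≥0∞}
    (hF : Measurable F) :
    ∫⁻ ω, F ω ∂(stepLaw n s (K + 1)) =
      ∫⁻ w, ∫⁻ ω, F (Fin.cons w ω) ∂(stepLaw n s K) ∂(gm n s) := by
  have hp := (measurePreserving_piFinSuccAbove (fun _ : Fin (K + 1) => gm n s) 0).symm
  rw [← hp.lintegral_comp hF]
  refine (lintegral_prod _ (hF.comp hp.measurable).aemeasurable).trans ?_
  simp [MeasurableEquiv.piFinSuccAbove_symm_apply, Fin.insertNthEquiv]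

lemma av_eq_integral_stepLaw {n : ℕ} {s : ℝ} (hs : 0 ≤ s) {h : Rn n → ℝ} (hm : Measurable h)
    (K : ℕ) (y : Rn n) :
    av n (K * s) h y = ∫ ω, h (y + ∑ j, ω j) ∂(stepLaw n s K) := by
  have := map_sum_gm (n := n) hs (Finset.univ : Finset (Fin K)) 1 (by norm_num)
  rw [Finset.card_univ, Fintype.card_fin] at this
  rw [av, ← this, integral_map (by fun_prop)
    (show AEStronglyMeasurable (fun z => h (y + z)) _ from
      (hm.comp (measurable_const_add y)).aestronglyMeasurable)]
  simp

lemma sq_add_lintegral_sq_le {Ω : Type*} [MeasurableSpace Ω] {P : Measure Ω}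
    [IsProbabilityMeasure P] {X : Ω → ℝ} (hX : Measurable X) {M : ℝ} (hM : ∀ ω, |X ω| ≤ M)
    {β β' : ℝ} (hβ : β' = β ∨ β' = ∫ ω, X ω ∂P) :
    ENNReal.ofReal ((β' - β) ^ 2) + ∫⁻ ω, ENNReal.ofReal ((X ω - β') ^ 2) ∂P
      ≤ ∫⁻ ω, ENNReal.ofReal ((X ω - β) ^ 2) ∂P := by
  rcases hβ with rfl | hβ
  · simp
  have hi : Integrable X P := Integrable.of_bound hX.aestronglyMeasurable M
    (Filter.Eventually.of_forall hM)
  have hi2 : Integrable (fun ω => X ω ^ 2) P := by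
    refine Integrable.of_bound (by fun_prop) (M ^ 2) (Filter.Eventually.of_forall fun ω => ?_)
    rw [norm_pow]
    exact pow_le_pow_left₀ (norm_nonneg _) (hM ω) 2
  have hsq : ∀ c : ℝ, Integrable (fun ω => (X ω - c) ^ 2) P ∧
      ∫ ω, (X ω - c) ^ 2 ∂P = ∫ ω, X ω ^ 2 ∂P - 2 * c * ∫ ω, X ω ∂P + c ^ 2 := by
    intro c
    have e : (fun ω => (X ω - c) ^ 2) = fun ω => X ω ^ 2 - 2 * c * X ω + c ^ 2 := by
      ext ω; ring
    rw [e]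
    have hi3 : Integrable (fun ω => X ω ^ 2 - 2 * c * X ω) P := hi2.sub (hi.const_mul _)
    refine ⟨hi3.add (integrable_const _), ?_⟩
    rw [integral_add hi3 (integrable_const _),
      integral_sub hi2 (hi.const_mul _), integral_const_mul]
    simp
  rw [← ofReal_integral_eq_lintegral_ofReal (hsq β').1
      (Filter.Eventually.of_forall fun ω => sq_nonneg _),
    ← ofReal_integral_eq_lintegral_ofReal (hsq β).1
      (Filter.Eventually.of_forall fun ω => sq_nonneg _),
    ← ENNReal.ofReal_add (sq_nonneg _) (integral_nonneg fun ω => sq_nonneg _),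
    (hsq β').2, (hsq β).2, ← hβ]
  refine ENNReal.ofReal_le_ofReal (le_of_eq ?_)
  ring

lemma lintegral_greedySq_walk_le {n : ℕ} {s : ℝ} (hs : 0 ≤ s) {h : Rn n → ℝ} (hm : Measurable h)
    {M : ℝ} (hM : ∀ x, |h x| ≤ M) (θ : ℝ) (K : ℕ) (β : ℝ) (y : Rn n) :
    ∫⁻ ω, ENNReal.ofReal (greedySq θ β (walk n s h K y ω) K) ∂(stepLaw n s K)
      ≤ ∫⁻ ω, ENNReal.ofReal ((h (y + ∑ j, ω j) - β) ^ 2) ∂(stepLaw n s K) := by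
  induction K generalizing β y with
  | zero =>
    refine lintegral_mono fun ω => ENNReal.ofReal_le_ofReal ?_
    rw [greedySq_zero, walk_zero, Nat.cast_zero, zero_mul, av_zero n h hm, gstep]
    simp only [Finset.univ_eq_empty, Finset.sum_empty, add_zero]
    split_ifs
    · exact le_rfl
    · simpa using sq_nonneg _
  | succ K ih =>
    set β' := gstep θ β (av n ((K + 1 : ℕ) * s) h y) with hβ'
    have hor : β' = β ∨ β' = ∫ ω, h (y + ∑ j, ω j) ∂(stepLaw n s (K + 1)) := by
      rw [← av_eq_integral_stepLaw hs hm, hβ', gstep]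
      split_ifs
      · exact Or.inr rfl
      · exact Or.inl rfl
    have hmw : ∀ i, Measurable fun ω => walk n s h (K + 1) y ω i := fun i =>
      (measurable_walk s hm (K + 1) i).comp (measurable_const.prodMk measurable_id)
    calc _ = ∫⁻ ω, (ENNReal.ofReal ((β' - β) ^ 2) +
          ENNReal.ofReal (greedySq θ β' (fun i => walk n s h (K + 1) y ω (i + 1)) K))
            ∂(stepLaw n s (K + 1)) := by
          refine lintegral_congr fun ω => ?_
          rw [greedySq_succ, walk_zero, ENNReal.ofReal_add (sq_nonneg _) (greedySq_nonneg _ _ _ _)]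
      _ = ENNReal.ofReal ((β' - β) ^ 2) + ∫⁻ ω,
          ENNReal.ofReal (greedySq θ β' (fun i => walk n s h (K + 1) y ω (i + 1)) K)
            ∂(stepLaw n s (K + 1)) := by
          rw [lintegral_add_left measurable_const]; simp
      _ ≤ ENNReal.ofReal ((β' - β) ^ 2) +
          ∫⁻ ω, ENNReal.ofReal ((h (y + ∑ j, ω j) - β') ^ 2) ∂(stepLaw n s (K + 1)) := by
          gcongr ENNReal.ofReal ((β' - β) ^ 2) + ?_
          rw [lintegral_stepLaw_succ, lintegral_stepLaw_succ]
          · refine lintegral_mono fun w => ?_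
            simp only [walk_cons, Fin.sum_univ_succ, Fin.cons_zero, Fin.cons_succ, ← add_assoc]
            exact ih β' (y + w)
          · have : Measurable fun ω : Fin (K + 1) → Rn n => h (y + ∑ j, ω j) :=
              hm.comp (by fun_prop)
            exact ((this.sub_const _).pow_const 2).ennreal_ofReal
          · exact (measurable_greedySq θ β' (fun i => hmw (i + 1)) K).ennreal_ofReal
      _ ≤ _ := sq_add_lintegral_sq_le (hm.comp (by fun_prop)) (fun ω => hM _) hor

/-- The walk seen from its end point `x`. -/
def rwalk (n : ℕ) (s : ℝ) (h : Rn n → ℝ) (K : ℕ) (x : Rn n) (ω : Fin K → Rn n) (i : ℕ) : ℝ :=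
  walk n s h K (x - ∑ j, ω j) ω i

lemma measurable_rwalk {n : ℕ} (s : ℝ) {h : Rn n → ℝ} (hm : Measurable h) (K i : ℕ) :
    Measurable fun p : Rn n × (Fin K → Rn n) => rwalk n s h K p.1 p.2 i := by
  unfold rwalk
  exact (measurable_walk s hm K i).comp
    (f := fun p : Rn n × (Fin K → Rn n) => (p.1 - ∑ j, p.2 j, p.2)) (by fun_prop)

lemma lintegral_greedySq_rwalk_le {n : ℕ} {s : ℝ} (hs : 0 ≤ s) {h : Rn n → ℝ} (hm : Measurable h)
    {M : ℝ} (hM : ∀ x, |h x| ≤ M) (θ : ℝ) (K : ℕ) :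
    ∫⁻ x, ∫⁻ ω, ENNReal.ofReal (greedySq θ 0 (rwalk n s h K x ω) K) ∂(stepLaw n s K)
      ≤ ∫⁻ x, ENNReal.ofReal (h x ^ 2) := by
  have hmw := fun i => measurable_walk s hm K i
  have hmr := fun i => measurable_rwalk s hm K i
  have h1 : Measurable fun p : Rn n × (Fin K → Rn n) =>
      ENNReal.ofReal (greedySq θ 0 (rwalk n s h K p.1 p.2) K) :=
    (measurable_greedySq θ 0 hmr K).ennreal_ofReal
  have h2 : Measurable fun p : Rn n × (Fin K → Rn n) =>
      ENNReal.ofReal (greedySq θ 0 (walk n s h K p.1 p.2) K) :=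
    (measurable_greedySq θ 0 hmw K).ennreal_ofReal
  have h3 : Measurable fun p : Rn n × (Fin K → Rn n) =>
      ENNReal.ofReal ((h (p.1 + ∑ j, p.2 j) - 0) ^ 2) := by
    have : Measurable fun p : Rn n × (Fin K → Rn n) => h (p.1 + ∑ j, p.2 j) :=
      hm.comp (by fun_prop)
    exact ((this.sub_const _).pow_const 2).ennreal_ofReal
  calc _ = ∫⁻ ω, ∫⁻ x, ENNReal.ofReal (greedySq θ 0 (rwalk n s h K x ω) K) ∂volume
          ∂(stepLaw n s K) := lintegral_lintegral_swap h1.aemeasurable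
    _ = ∫⁻ ω, ∫⁻ y, ENNReal.ofReal (greedySq θ 0 (walk n s h K y ω) K) ∂volume
          ∂(stepLaw n s K) := by
        refine lintegral_congr fun ω => ?_
        exact lintegral_sub_right_eq_self (fun y => ENNReal.ofReal
          (greedySq θ 0 (walk n s h K y ω) K)) (∑ j, ω j)
    _ = ∫⁻ y, ∫⁻ ω, ENNReal.ofReal (greedySq θ 0 (walk n s h K y ω) K) ∂(stepLaw n s K) :=
        (lintegral_lintegral_swap h2.aemeasurable).symm
    _ ≤ ∫⁻ y, ∫⁻ ω, ENNReal.ofReal ((h (y + ∑ j, ω j) - 0) ^ 2) ∂(stepLaw n s K) :=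
        lintegral_mono fun y => lintegral_greedySq_walk_le hs hm hM θ K 0 y
    _ = ∫⁻ ω, ∫⁻ y, ENNReal.ofReal ((h (y + ∑ j, ω j) - 0) ^ 2) ∂volume ∂(stepLaw n s K) :=
        lintegral_lintegral_swap h3.aemeasurable
    _ = ∫⁻ _ω, ∫⁻ x, ENNReal.ofReal (h x ^ 2) ∂volume ∂(stepLaw n s K) := by
        refine lintegral_congr fun ω => ?_
        simp only [sub_zero]
        exact lintegral_add_right_eq_self (fun x => ENNReal.ofReal (h x ^ 2)) (∑ j, ω j)
    _ = _ := by simp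

lemma av_av {n : ℕ} {s t : ℝ} (hs : 0 ≤ s) (ht : 0 ≤ t) {h : Rn n → ℝ} (hm : Measurable h)
    {M : ℝ} (hM : ∀ x, |h x| ≤ M) (y : Rn n) : av n s (av n t h) y = av n (s + t) h y := by
  have hc : (gm n s).conv (gm n t) = gm n (s + t) := by
    refine Measure.ext_of_charFun ?_
    ext ξ
    rw [charFun_conv, charFun_gm hs, charFun_gm ht, charFun_gm (by positivity), ← Complex.exp_add]
    congr 1
    push_cast
    ring
  have hm' : Measurable fun z => h (y + z) := hm.comp (measurable_const_add y)
  have hi : Integrable (fun z => h (y + z)) ((gm n s).conv (gm n t)) := by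
    rw [hc]
    exact Integrable.of_bound hm'.aestronglyMeasurable M (Filter.Eventually.of_forall fun _ => hM _)
  conv_rhs => rw [av, ← hc, integral_conv hi]
  simp only [av, add_assoc]

lemma integral_rwalk {n : ℕ} {s : ℝ} (hs : 0 ≤ s) {h : Rn n → ℝ} (hm : Measurable h)
    {M : ℝ} (hM : ∀ x, |h x| ≤ M) (K : ℕ) (x : Rn n) {i : ℕ} (hi : i ≤ K) :
    ∫ ω, rwalk n s h K x ω i ∂(stepLaw n s K) = av n ((K - i : ℕ) * (2 * s)) h x := by
  have hmap := map_sum_gm (n := n) hs (Finset.univ.filter fun j : Fin K => ¬ j.val < i) (-1)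
    (by norm_num)
  have hcard : (Finset.univ.filter fun j : Fin K => ¬ j.val < i).card = K - i := by
    have h1 := Finset.card_filter_add_card_filter_not (s := (Finset.univ : Finset (Fin K)))
      (fun j : Fin K => j.val < i)
    rw [Finset.card_univ, Fintype.card_fin, Fin.card_filter_val_lt] at h1
    omega
  rw [hcard] at hmap
  have e : ∀ ω : Fin K → Rn n, rwalk n s h K x ω i = av n ((K - i : ℕ) * s) h
      (x + (-1 : ℝ) • ∑ j : Fin K with ¬ j.val < i, ω j) := by
    intro ω
    unfold rwalk walk
    congr 1
    rw [← Finset.sum_filter_add_sum_filter_not Finset.univ (fun j : Fin K => j.val < i) ω,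
      neg_one_smul]
    abel
  simp only [e]
  rw [← integral_map (f := fun z => av n ((K - i : ℕ) * s) h (x + z))
    (φ := fun ω : Fin K → Rn n => (-1 : ℝ) • ∑ j : Fin K with ¬ j.val < i, ω j) (by fun_prop)
    (((measurable_av _ hm).comp (measurable_const_add x)).aestronglyMeasurable), hmap]
  have := av_av (n := n) (s := (K - i : ℕ) * s) (t := (K - i : ℕ) * s) (by positivity)
    (by positivity) hm hM x
  rw [av] at this
  rw [this]
  congr 1; ring

lemma ofReal_abs_integral_rpow_le {Ω : Type*} [MeasurableSpace Ω] {P : Measure Ω}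
    [IsProbabilityMeasure P] {X : Ω → ℝ} (hX : Measurable X) {ϱ : ℝ} (hϱ : 1 ≤ ϱ) :
    ENNReal.ofReal (|∫ ω, X ω ∂P| ^ ϱ) ≤ ∫⁻ ω, ENNReal.ofReal (|X ω| ^ ϱ) ∂P := by
  have h0 : 0 < ϱ := by linarith
  have h1 := enorm_integral_le_lintegral_enorm (μ := P) X
  have h2 := eLpNorm'_le_eLpNorm'_of_exponent_le (μ := P) zero_lt_one hϱ
    hX.aestronglyMeasurable
  simp only [eLpNorm', ENNReal.rpow_one, div_one] at h2
  have h3 := ENNReal.rpow_le_rpow (h1.trans h2) h0.le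
  rw [← ENNReal.rpow_mul, one_div, inv_mul_cancel₀ h0.ne', ENNReal.rpow_one] at h3
  rw [← ENNReal.ofReal_rpow_of_nonneg (abs_nonneg _) h0.le]
  simp only [← ENNReal.ofReal_rpow_of_nonneg (abs_nonneg _) h0.le]
  simpa only [Real.enorm_eq_ofReal_abs] using h3

/-- The discretized majorant of the variation, with mesh `2 ^ (-k)`. -/
def varMaj (n : ℕ) (ϱ lam : ℝ) (h : Rn n → ℝ) (k : ℕ) (x : Rn n) : ℝ≥0∞ :=
  ∫⁻ ω, greedyTotal ϱ lam (rwalk n ((1 / 2) ^ k / 2) h (4 ^ k) x ω) (4 ^ k)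
    ∂(stepLaw n ((1 / 2) ^ k / 2) (4 ^ k))

lemma measurable_greedyTotal_rwalk {n : ℕ} (ϱ lam s : ℝ) {h : Rn n → ℝ} (hm : Measurable h)
    (K : ℕ) : Measurable fun p : Rn n × (Fin K → Rn n) =>
      greedyTotal ϱ lam (rwalk n s h K p.1 p.2) K := by
  unfold greedyTotal
  refine Measurable.tsum fun k => Measurable.const_mul ?_ _
  exact (measurable_greedySq _ 0 (fun i => measurable_rwalk s hm K i) K).ennreal_ofReal

lemma measurable_varMaj {n : ℕ} (ϱ lam : ℝ) {h : Rn n → ℝ} (hm : Measurable h) (k : ℕ) :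
    Measurable (varMaj n ϱ lam h k) :=
  (measurable_greedyTotal_rwalk ϱ lam _ hm (4 ^ k)).lintegral_prod_right'

lemma lintegral_varMaj_le {n : ℕ} {ϱ lam : ℝ} (hϱ : 2 < ϱ) (hl : 0 < lam) {h : Rn n → ℝ}
    (hm : Measurable h) (hM : ∀ x, |h x| ≤ lam) (k : ℕ) :
    ∫⁻ x, varMaj n ϱ lam h k x ≤
      ENNReal.ofReal (6 ^ ϱ * (1 - (1 / 2) ^ (ϱ - 2))⁻¹) * ENNReal.ofReal (lam ^ (ϱ - 1)) *
        ∫⁻ x, ENNReal.ofReal |h x| := by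
  set s : ℝ := (1 / 2) ^ k / 2 with hs
  have hs0 : 0 ≤ s := by positivity
  set K := 4 ^ k with hK
  have hgs : ∀ k' : ℕ, Measurable fun p : Rn n × (Fin K → Rn n) =>
      ENNReal.ofReal (6 ^ ϱ * (lam * (1 / 2) ^ k') ^ (ϱ - 2)) *
      ENNReal.ofReal (greedySq (lam * (1 / 2) ^ k') 0 (rwalk n s h K p.1 p.2) K) := fun k' =>
    Measurable.const_mul
      (measurable_greedySq _ 0 (fun i => measurable_rwalk s hm K i) K).ennreal_ofReal _
  have hr0 : (0 : ℝ) ≤ (1 / 2) ^ (ϱ - 2) := by positivity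
  have hr1 : ((1 : ℝ) / 2) ^ (ϱ - 2) < 1 :=
    Real.rpow_lt_one (by norm_num) (by norm_num) (by linarith)
  have hsq : ∫⁻ x, ENNReal.ofReal (h x ^ 2) ≤ ENNReal.ofReal lam * ∫⁻ x, ENNReal.ofReal |h x| := by
    rw [← lintegral_const_mul _ hm.abs.ennreal_ofReal]
    refine lintegral_mono fun x => ?_
    rw [← ENNReal.ofReal_mul hl.le]
    refine ENNReal.ofReal_le_ofReal ?_
    rw [← sq_abs, sq]
    exact mul_le_mul_of_nonneg_right (hM x) (abs_nonneg _)
  calc ∫⁻ x, varMaj n ϱ lam h k x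
      = ∑' k' : ℕ, ∫⁻ x, ∫⁻ ω, ENNReal.ofReal (6 ^ ϱ * (lam * (1 / 2) ^ k') ^ (ϱ - 2)) *
      ENNReal.ofReal (greedySq (lam * (1 / 2) ^ k') 0 (rwalk n s h K x ω) K) ∂(stepLaw n s K) := by
        rw [← lintegral_tsum fun k' => (hgs k').lintegral_prod_right'.aemeasurable]
        refine lintegral_congr fun x => ?_
        unfold varMaj greedyTotal
        rw [lintegral_tsum]
        intro k'
        exact ((hgs k').comp (measurable_const.prodMk measurable_id)).aemeasurable
    _ ≤ ∑' k' : ℕ, ENNReal.ofReal (6 ^ ϱ * (lam * (1 / 2) ^ k') ^ (ϱ - 2)) *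
        ∫⁻ x, ENNReal.ofReal (h x ^ 2) := by
        refine ENNReal.tsum_le_tsum fun k' => ?_
        calc _ = ENNReal.ofReal (6 ^ ϱ * (lam * (1 / 2) ^ k') ^ (ϱ - 2)) * ∫⁻ x, ∫⁻ ω,
              ENNReal.ofReal (greedySq (lam * (1 / 2) ^ k') 0 (rwalk n s h K x ω) K)
                ∂(stepLaw n s K) := by
              simp only [lintegral_const_mul' _ _ ENNReal.ofReal_ne_top]
          _ ≤ _ := by
              exact mul_le_mul' le_rfl (lintegral_greedySq_rwalk_le hs0 hm hM _ K)
    _ = ENNReal.ofReal (6 ^ ϱ * (1 - (1 / 2) ^ (ϱ - 2))⁻¹ * lam ^ (ϱ - 2)) *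
        ∫⁻ x, ENNReal.ofReal (h x ^ 2) := by
        rw [ENNReal.tsum_mul_right]
        congr 1
        rw [← ENNReal.ofReal_tsum_of_nonneg]
        · congr 1
          have e : ∀ k' : ℕ, 6 ^ ϱ * (lam * (1 / 2) ^ k') ^ (ϱ - 2)
              = 6 ^ ϱ * lam ^ (ϱ - 2) * ((1 / 2) ^ (ϱ - 2)) ^ k' := by
            intro k'
            rw [Real.mul_rpow hl.le (by positivity), ← Real.rpow_natCast, ← Real.rpow_natCast,
              ← Real.rpow_mul (by norm_num), ← Real.rpow_mul (by norm_num), mul_comm (k' : ℝ),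
              mul_assoc]
          simp only [e]
          rw [tsum_mul_left, tsum_geometric_of_lt_one hr0 hr1]
          ring
        · intro k'; positivity
        · have e : ∀ k' : ℕ, 6 ^ ϱ * (lam * (1 / 2) ^ k') ^ (ϱ - 2)
              = 6 ^ ϱ * lam ^ (ϱ - 2) * ((1 / 2) ^ (ϱ - 2)) ^ k' := by
            intro k'
            rw [Real.mul_rpow hl.le (by positivity), ← Real.rpow_natCast, ← Real.rpow_natCast,
              ← Real.rpow_mul (by norm_num), ← Real.rpow_mul (by norm_num), mul_comm (k' : ℝ),
              mul_assoc]
          simp only [e]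
          exact (summable_geometric_of_lt_one hr0 hr1).mul_left _
    _ ≤ ENNReal.ofReal (6 ^ ϱ * (1 - (1 / 2) ^ (ϱ - 2))⁻¹ * lam ^ (ϱ - 2)) *
        (ENNReal.ofReal lam * ∫⁻ x, ENNReal.ofReal |h x|) := by gcongr
    _ = _ := by
        have h1 : 0 ≤ 6 ^ ϱ * (1 - ((1 : ℝ) / 2) ^ (ϱ - 2))⁻¹ := by
          have : 0 < 1 - ((1 : ℝ) / 2) ^ (ϱ - 2) := by linarith
          positivity
        rw [ENNReal.ofReal_mul h1, ← mul_assoc, mul_assoc (ENNReal.ofReal _) (ENNReal.ofReal _)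
          (ENNReal.ofReal lam), ← ENNReal.ofReal_mul (by positivity)]
        congr 4
        rw [← Real.rpow_add_one hl.ne']
        congr 1; ring

lemma continuousAt_heatSg_time {n : ℕ} {t : ℝ} (ht : 0 < t) {g : Rn n → ℝ} (hg : Integrable g)
    (x : Rn n) : ContinuousAt (fun τ => heatSg n τ g x) t := by
  have e : (fun τ => heatSg n τ g x) = fun τ => ∫ y, hk n τ (x - y) * g y := rfl
  rw [e]
  refine continuousAt_of_dominated
    (bound := fun y => (4 * Real.pi * (t / 2)) ^ (-(n : ℝ) / 2) * ‖g y‖) ?_ ?_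
    (hg.norm.const_mul _) ?_
  · filter_upwards [lt_mem_nhds ht] with τ hτ
    exact (integrable_hk_mul hτ hg x).aestronglyMeasurable
  · filter_upwards [lt_mem_nhds (show t / 2 < t by linarith)] with τ hτ
    have hτ0 : 0 < τ := by linarith
    refine Filter.Eventually.of_forall fun y => ?_
    rw [norm_mul, Real.norm_of_nonneg (hk_nonneg hτ0.le _)]
    gcongr
    refine (hk_le hτ0.le _).trans ?_
    refine Real.rpow_le_rpow_of_nonpos (by positivity) (by gcongr) ?_
    exact div_nonpos_of_nonpos_of_nonneg (by simp) (by norm_num)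
  · refine Filter.Eventually.of_forall fun y => ?_
    refine ContinuousAt.mul ?_ continuousAt_const
    unfold hk
    refine ContinuousAt.mul ?_ ?_
    · exact ContinuousAt.rpow_const (by fun_prop) (Or.inl (by positivity))
    · exact Real.continuous_exp.continuousAt.comp
        (continuousAt_const.div (by fun_prop) (by positivity))

set_option maxHeartbeats 1000000 in
lemma sum_heatSg_le_lintegral_greedyTotal {n : ℕ} {ϱ lam : ℝ} (hϱ : 2 < ϱ) (hl : 0 < lam)
    {h : Rn n → ℝ} (hm : Measurable h) (hM : ∀ x, |h x| ≤ lam) {s : ℝ} (hs0 : 0 < s) {K N : ℕ}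
    {m : ℕ → ℕ} (hmanti : Antitone m) (hmle : ∀ j, m j ≤ K) (hmpos : ∀ j ≤ N, 0 < m j)
    (x : Rn n) :
    ∑ j ∈ Finset.range N, ENNReal.ofReal
      (|heatSg n (m j * (2 * s)) h x - heatSg n (m (j + 1) * (2 * s)) h x| ^ ϱ) ≤
      ∫⁻ ω, greedyTotal ϱ lam (rwalk n s h K x ω) K ∂(stepLaw n s K) := by
  set p : ℕ → ℕ := fun j => K - m j with hp
  have hpm : Monotone p := fun i j hij => Nat.sub_le_sub_left (hmanti hij) _
  have hav : ∀ j ≤ N, heatSg n (m j * (2 * s)) h x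
      = ∫ ω, rwalk n s h K x ω (p j) ∂(stepLaw n s K) := by
    intro j hj
    have := hmpos j hj
    rw [integral_rwalk hs0.le hm hM _ _ (Nat.sub_le _ _), ← av_eq_heatSg (by positivity)]
    rw [Nat.sub_sub_self (hmle j)]
  have hrm : ∀ i, Measurable fun ω => rwalk n s h K x ω i := fun i =>
    (measurable_rwalk s hm K i).comp (measurable_const.prodMk measurable_id)
  have hrb : ∀ ω i, |rwalk n s h K x ω i| ≤ lam := fun ω i => abs_av_le _ hM _
  have hri : ∀ i, Integrable (fun ω => rwalk n s h K x ω i) (stepLaw n s K) := fun i =>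
    Integrable.of_bound (hrm i).aestronglyMeasurable lam
      (Filter.Eventually.of_forall fun ω => hrb ω i)
  calc _ ≤ ∑ j ∈ Finset.range N, ∫⁻ ω, ENNReal.ofReal (|rwalk n s h K x ω (p j)
        - rwalk n s h K x ω (p (j + 1))| ^ ϱ) ∂(stepLaw n s K) := by
        refine Finset.sum_le_sum fun j hj => ?_
        have hj := Finset.mem_range.1 hj
        rw [hav j hj.le, hav (j + 1) hj, ← integral_sub (hri _) (hri _)]
        exact ofReal_abs_integral_rpow_le ((hrm _).sub (hrm _)) (by linarith)
    _ = ∫⁻ ω, ∑ j ∈ Finset.range N, ENNReal.ofReal (|rwalk n s h K x ω (p j)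
        - rwalk n s h K x ω (p (j + 1))| ^ ϱ) ∂(stepLaw n s K) := by
        rw [lintegral_finsetSum]
        intro j _
        exact (((hrm _).sub (hrm _)).abs.pow_const ϱ).ennreal_ofReal
    _ ≤ _ := by
        refine lintegral_mono fun ω => ?_
        exact sum_jumps_le (by linarith) hl (fun i _ => hrb ω i) hpm (Nat.sub_le _ _)

lemma sum_heatInc_le_liminf {n : ℕ} {ϱ lam : ℝ} (hϱ : 2 < ϱ) (hl : 0 < lam) {h : Rn n → ℝ}
    (hm : Measurable h) (hM : ∀ x, |h x| ≤ lam) (hi : Integrable h) {t : ℕ → ℝ}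
    (ht : StrictAnti t) (h0 : ∀ j, 0 < t j) (N : ℕ) (x : Rn n) :
    ∑ j ∈ Finset.range N, ENNReal.ofReal (|heatInc n t h x j| ^ ϱ) ≤
      Filter.liminf (fun k => varMaj n ϱ lam h k x) Filter.atTop := by
  set m : ℕ → ℕ → ℕ := fun k j => ⌊t j * 2 ^ k⌋₊ with hmdef
  set τ : ℕ → ℕ → ℝ := fun k j => m k j * (1 / 2) ^ k with hτ
  have hτlim : ∀ j, Filter.Tendsto (fun k => τ k j) Filter.atTop (nhds (t j)) := by
    intro j
    have h1 := tendsto_nat_floor_mul_div_atTop (R := ℝ) (h0 j).le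
    have h2 := h1.comp (tendsto_pow_atTop_atTop_of_one_lt (one_lt_two (α := ℝ)))
    refine h2.congr fun k => ?_
    simp only [hτ, hmdef, Function.comp, one_div, inv_pow]
    rfl
  have hlim : Filter.Tendsto (fun k => ∑ j ∈ Finset.range N,
      ENNReal.ofReal (|heatSg n (τ k j) h x - heatSg n (τ k (j + 1)) h x| ^ ϱ)) Filter.atTop
      (nhds (∑ j ∈ Finset.range N, ENNReal.ofReal (|heatInc n t h x j| ^ ϱ))) := by
    refine tendsto_finsetSum _ fun j _ => ?_
    refine (ENNReal.continuous_ofReal.tendsto _).comp ?_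
    refine Filter.Tendsto.rpow_const ?_ (Or.inr (by linarith))
    refine Filter.Tendsto.abs ?_
    exact ((continuousAt_heatSg_time (h0 _) hi x).tendsto.comp (hτlim j)).sub
      ((continuousAt_heatSg_time (h0 _) hi x).tendsto.comp (hτlim (j + 1)))
  rw [← hlim.liminf_eq]
  refine Filter.liminf_le_liminf ?_
  have hbig : ∀ᶠ k : ℕ in Filter.atTop, t 0 ≤ 2 ^ k ∧ 1 ≤ t N * 2 ^ k := by
    have h2 := tendsto_pow_atTop_atTop_of_one_lt (one_lt_two (α := ℝ))
    filter_upwards [h2.eventually_ge_atTop (t 0), h2.eventually_ge_atTop (1 / t N)] with k h1 h2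
    refine ⟨h1, ?_⟩
    rw [div_le_iff₀ (h0 N)] at h2
    linarith
  filter_upwards [hbig] with k ⟨hk1, hk2⟩
  have hmanti : Antitone (m k) := fun i j hij =>
    Nat.floor_mono (mul_le_mul_of_nonneg_right (ht.antitone hij) (by positivity))
  have hmle : ∀ j, m k j ≤ 4 ^ k := by
    intro j
    refine Nat.floor_le_of_le ?_
    push_cast
    calc t j * 2 ^ k ≤ 2 ^ k * 2 ^ k := by
          gcongr; exact (ht.antitone (Nat.zero_le j)).trans hk1
      _ = 4 ^ k := by rw [← mul_pow]; norm_num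
  have hmpos : ∀ j ≤ N, 0 < m k j := by
    intro j hj
    refine Nat.floor_pos.2 (hk2.trans ?_)
    gcongr; exact ht.antitone hj
  have key := sum_heatSg_le_lintegral_greedyTotal hϱ hl hm hM
    (s := (1 / 2) ^ k / 2) (by positivity) hmanti hmle hmpos x
  simp only [show 2 * ((1 / 2 : ℝ) ^ k / 2) = (1 / 2) ^ k by ring] at key
  exact key

/-- The variation of a bounded function, in terms of its supremum and its integral. -/
lemma lintegral_varHeat_rpow_le {n : ℕ} {ϱ lam : ℝ} (hϱ : 2 < ϱ) (hl : 0 < lam) {h : Rn n → ℝ}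
    (hm : Measurable h) (hM : ∀ x, |h x| ≤ lam) (hi : Integrable h) :
    ∫⁻ x, varHeat n ϱ h x ^ ϱ ≤
      ENNReal.ofReal (6 ^ ϱ * (1 - (1 / 2) ^ (ϱ - 2))⁻¹) * ENNReal.ofReal (lam ^ (ϱ - 1)) *
        ∫⁻ x, ENNReal.ofReal |h x| := by
  have h0ϱ : 0 < ϱ := by linarith
  calc _ ≤ ∫⁻ x, Filter.liminf (fun k => varMaj n ϱ lam h k x) Filter.atTop := by
        refine lintegral_mono fun x => ?_
        rw [← ENNReal.le_rpow_inv_iff h0ϱ]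
        refine iSup_le fun t => iSup_le fun ht => iSup_le fun h0 => iSup_le fun _ => ?_
        rw [one_div]
        refine ENNReal.rpow_le_rpow ?_ (by positivity)
        rw [ENNReal.tsum_eq_iSup_nat]
        exact iSup_le fun N => sum_heatInc_le_liminf hϱ hl hm hM hi ht h0 N x
    _ ≤ Filter.liminf (fun k => ∫⁻ x, varMaj n ϱ lam h k x) Filter.atTop :=
        lintegral_liminf_le fun k => measurable_varMaj ϱ lam hm k
    _ ≤ _ := by
        refine (Filter.liminf_le_liminf (Filter.Eventually.of_forall fun k =>
          lintegral_varMaj_le hϱ hl hm hM k)).trans ?_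
        simp

/-- Indices of dyadic cubes: a scale and a lattice position. -/
abbrev Idx (n : ℕ) := ℤ × (Fin n → ℤ)

variable {n : ℕ}

/-- The side length of a dyadic cube. -/
def ell (q : Idx n) : ℝ := 2 ^ q.1

lemma ell_pos (q : Idx n) : 0 < ell q := by unfold ell; positivity

/-- The half-open dyadic cube with index `q`. -/
def dq (q : Idx n) : Set (Rn n) := {y | ∀ i, ⌊y i / ell q⌋ = q.2 i}

/-- The index of the dyadic cube of scale `j` that contains `x`. -/
def idx (j : ℤ) (x : Rn n) : Idx n := (j, fun i => ⌊x i / 2 ^ j⌋)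

/-- The `i`-th dyadic ancestor. -/
def anc (i : ℕ) (q : Idx n) : Idx n := (q.1 + i, fun a => q.2 a / 2 ^ i)

/-- The center of a dyadic cube. -/
def cen (q : Idx n) : Rn n := WithLp.toLp 2 fun i => (q.2 i + 1 / 2) * ell q

/-- The closed threefold enlargement of a dyadic cube. -/
def tq (q : Idx n) : Set (Rn n) := cube (cen q) (3 * ell q)

lemma mem_dq_iff {q : Idx n} {x : Rn n} : x ∈ dq q ↔ idx q.1 x = q := by
  simp only [dq, mem_ofPred_eq, idx, ell]
  constructor
  · intro h; ext1
    · rfl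
    · funext i; exact h i
  · intro h i
    exact congrFun (congrArg Prod.snd h) i

lemma mem_dq_idx (j : ℤ) (x : Rn n) : x ∈ dq (idx j x) := fun _ => rfl

@[simp] lemma idx_fst (j : ℤ) (x : Rn n) : (idx j x).1 = j := rfl

@[simp] lemma anc_fst (i : ℕ) (q : Idx n) : (anc i q).1 = q.1 + i := rfl

@[simp] lemma anc_zero (q : Idx n) : anc 0 q = q := by
  simp [anc]

lemma anc_anc (i i' : ℕ) (q : Idx n) : anc i (anc i' q) = anc (i' + i) q := by
  unfold anc
  ext1
  · push_cast; ring
  · funext a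
    simp only
    rw [Int.ediv_ediv_of_nonneg (by positivity), pow_add]

lemma ell_anc (i : ℕ) (q : Idx n) : ell (anc i q) = 2 ^ i * ell q := by
  unfold ell
  rw [anc_fst, zpow_add₀ two_ne_zero, zpow_natCast, mul_comm]

lemma anc_idx (i : ℕ) (j : ℤ) (x : Rn n) : anc i (idx j x) = idx (j + i) x := by
  unfold anc idx
  ext1
  · rfl
  · funext a
    simp only
    have h := Int.floor_div_natCast (x a / 2 ^ j) (2 ^ i)
    push_cast at h
    rw [← h, zpow_add₀ two_ne_zero, zpow_natCast, div_div]

lemma dq_subset_anc (i : ℕ) (q : Idx n) : dq q ⊆ dq (anc i q) := by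
  intro x hx
  rw [mem_dq_iff] at hx ⊢
  rw [anc_fst, ← anc_idx, hx]

/-- Dyadic cubes are nested. -/
lemma eq_anc_of_mem {q q' : Idx n} {x : Rn n} (hx : x ∈ dq q) (hx' : x ∈ dq q')
    (h : q.1 ≤ q'.1) : q' = anc (q'.1 - q.1).toNat q := by
  rw [mem_dq_iff] at hx hx'
  conv_rhs => rw [← hx]
  rw [anc_idx, ← hx']
  simp only [idx_fst]
  congr 1
  omega

lemma mem_dq_bounds {q : Idx n} {x : Rn n} :
    x ∈ dq q ↔ ∀ i, q.2 i * ell q ≤ x i ∧ x i < (q.2 i + 1) * ell q := by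
  have := ell_pos q
  refine forall_congr' fun i => ?_
  rw [Int.floor_eq_iff, le_div_iff₀ this, div_lt_iff₀ this]

lemma cen_apply (q : Idx n) (i : Fin n) : cen q i = (q.2 i + 1 / 2) * ell q := rfl

lemma cen_mem (q : Idx n) : cen q ∈ dq q := by
  rw [mem_dq_bounds]
  intro i
  have := ell_pos q
  rw [cen_apply]
  constructor <;> nlinarith

lemma mem_cube_iff {c x : Rn n} {r : ℝ} : x ∈ cube c r ↔ ∀ i, |x i - c i| ≤ r / 2 := Iff.rfl

lemma dq_subset_cube (q : Idx n) : dq q ⊆ cube (cen q) (ell q) := by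
  intro x hx i
  rw [mem_dq_bounds] at hx
  have := hx i
  rw [cen_apply, abs_le]
  constructor <;> nlinarith

lemma cube_mono (c : Rn n) {r r' : ℝ} (h : r ≤ r') : cube c r ⊆ cube c r' := fun _ hx i =>
  (hx i).trans (by linarith)

lemma cube_subset_cube {c c' : Rn n} {r r' : ℝ} (h : ∀ i, |c i - c' i| ≤ (r' - r) / 2) :
    cube c r ⊆ cube c' r' := fun x hx i => by
  have h1 := hx i
  have h2 := h i
  have h3 := abs_sub_le (x i) (c i) (c' i)
  linarith

lemma dq_subset_tq (q : Idx n) : dq q ⊆ tq q :=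
  (dq_subset_cube q).trans (cube_mono _ (by have := ell_pos q; linarith))

lemma tq_subset_anc (i : ℕ) (q : Idx n) : tq q ⊆ tq (anc i q) := by
  have h0 := dq_subset_anc i q (cen_mem q)
  rw [mem_dq_bounds] at h0
  rcases Nat.eq_zero_or_pos i with rfl | hi
  · simp
  refine cube_subset_cube fun a => ?_
  have h1 := h0 a
  have h2 := dq_subset_cube _ (dq_subset_anc i q (cen_mem q)) a
  refine h2.trans ?_
  rw [ell_anc]
  have : (2 : ℝ) ≤ 2 ^ i := by
    calc (2 : ℝ) = 2 ^ 1 := by norm_num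
      _ ≤ 2 ^ i := pow_le_pow_right₀ (by norm_num) hi
  have := ell_pos q
  nlinarith

lemma measurableSet_dq (q : Idx n) : MeasurableSet (dq q) := by
  have : dq q = ⋂ i, {y : Rn n | ⌊y i / ell q⌋ = q.2 i} := by ext; simp [dq]
  rw [this]
  refine MeasurableSet.iInter fun i => ?_
  have hm : Measurable fun y : Rn n => ⌊y i / ell q⌋ := by
    refine Int.measurable_floor.comp ?_
    fun_prop
  exact hm (measurableSet_singleton (q.2 i))

lemma isClosed_cube (c : Rn n) (r : ℝ) : IsClosed (cube c r) := by
  have : cube c r = ⋂ i, {y : Rn n | |y i - c i| ≤ r / 2} := by ext; simp [cube]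
  rw [this]
  exact isClosed_iInter fun i => isClosed_le (by fun_prop) continuous_const

lemma measurableSet_cube (c : Rn n) (r : ℝ) : MeasurableSet (cube c r) :=
  (isClosed_cube c r).measurableSet

lemma measurableSet_tq (q : Idx n) : MeasurableSet (tq q) := measurableSet_cube _ _

lemma volume_cube (c : Rn n) {r : ℝ} (hr : 0 ≤ r) :
    volume (cube c r) = ENNReal.ofReal (r ^ n) := by
  have e : cube c r = (WithLp.ofLp : Rn n → (Fin n → ℝ)) ⁻¹'
      (Icc (fun i => c i - r / 2) (fun i => c i + r / 2)) := by
    ext x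
    simp only [mem_cube_iff, mem_preimage, mem_Icc, Pi.le_def, abs_le]
    rw [← forall_and]
    refine forall_congr' fun i => ?_
    constructor <;> rintro ⟨h1, h2⟩ <;> constructor <;> linarith
  rw [e, (PiLp.volume_preserving_ofLp (Fin n)).measure_preimage
    measurableSet_Icc.nullMeasurableSet, Real.volume_Icc_pi]
  simp only [add_sub_sub_cancel, add_halves, Finset.prod_const, Finset.card_univ, Fintype.card_fin]
  rw [ENNReal.ofReal_pow hr]

lemma volume_dq (q : Idx n) : volume (dq q) = ENNReal.ofReal (ell q ^ n) := by
  have e : dq q = (WithLp.ofLp : Rn n → (Fin n → ℝ)) ⁻¹'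
      (Set.pi univ fun i => Ico (q.2 i * ell q) ((q.2 i + 1) * ell q)) := by
    ext x
    rw [mem_dq_bounds]
    simp
  rw [e, (PiLp.volume_preserving_ofLp (Fin n)).measure_preimage
    (MeasurableSet.univ_pi fun _ => measurableSet_Ico).nullMeasurableSet, Real.volume_pi_Ico]
  have : ∀ i, ((q.2 i : ℝ) + 1) * ell q - q.2 i * ell q = ell q := fun i => by ring
  simp only [this, Finset.prod_const, Finset.card_univ, Fintype.card_fin]
  rw [ENNReal.ofReal_pow (ell_pos q).le]

lemma volume_cube_mul (q : Idx n) (c : Rn n) {a : ℝ} (ha : 0 ≤ a) :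
    volume (cube c (a * ell q)) = ENNReal.ofReal (a ^ n) * volume (dq q) := by
  have := ell_pos q
  rw [volume_cube _ (by positivity), volume_dq, mul_pow, ENNReal.ofReal_mul (by positivity)]

lemma volume_tq (q : Idx n) : volume (tq q) = 3 ^ n * volume (dq q) := by
  rw [tq, volume_cube_mul q _ (by norm_num), ENNReal.ofReal_pow (by norm_num)]
  norm_num

lemma volume_dq_anc (i : ℕ) (q : Idx n) :
    volume (dq (anc i q)) = 2 ^ (n * i) * volume (dq q) := by
  rw [volume_dq, volume_dq, ell_anc, mul_pow, ENNReal.ofReal_mul (by positivity), ← pow_mul,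
    ENNReal.ofReal_pow (by norm_num), mul_comm i n]
  norm_num

lemma volume_dq_pos (q : Idx n) : 0 < volume (dq q) := by
  rw [volume_dq, ENNReal.ofReal_pos]
  exact pow_pos (ell_pos q) n

lemma volume_dq_ne_zero (q : Idx n) : volume (dq q) ≠ 0 := (volume_dq_pos q).ne'

lemma volume_dq_ne_top (q : Idx n) : volume (dq q) ≠ ∞ := by
  rw [volume_dq]; exact ENNReal.ofReal_ne_top

lemma volume_tq_ne_top (q : Idx n) : volume (tq q) ≠ ∞ := by
  rw [volume_tq]; exact ENNReal.mul_ne_top (by simp) (volume_dq_ne_top q)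

/-- `q` satisfies `B` and none of its strict ancestors does. -/
def MaxD (B : Idx n → Prop) (q : Idx n) : Prop := B q ∧ ∀ i : ℕ, 0 < i → ¬ B (anc i q)

lemma MaxD.eq_of_mem {B : Idx n → Prop} {q q' : Idx n} (h : MaxD B q) (h' : MaxD B q') {x : Rn n}
    (hx : x ∈ dq q) (hx' : x ∈ dq q') : q = q' := by
  wlog hle : q.1 ≤ q'.1 generalizing q q'
  · exact (this h' h hx' hx (le_of_not_ge hle)).symm
  have e := eq_anc_of_mem hx hx' hle
  rcases Nat.eq_zero_or_pos (q'.1 - q.1).toNat with h0 | h0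
  · rw [h0, anc_zero] at e; exact e.symm
  · exact absurd h'.1 (e ▸ h.2 _ h0)

lemma MaxD.disjoint {B : Idx n → Prop} {q q' : Idx n} (h : MaxD B q) (h' : MaxD B q')
    (hne : q ≠ q') : Disjoint (dq q) (dq q') :=
  Set.disjoint_left.2 fun _ hx hx' => hne (h.eq_of_mem h' hx hx')

lemma pairwise_disjoint_maxD (B : Idx n → Prop) :
    Pairwise (Function.onFun Disjoint fun q : {q // MaxD B q} => dq q.1) := fun q q' hne =>
  q.2.disjoint q'.2 fun h => hne (Subtype.ext h)

lemma exists_maxD {B : Idx n → Prop} {q : Idx n} (hq : B q)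
    (hb : ∃ N : ℕ, ∀ i ≥ N, ¬ B (anc i q)) : ∃ i, MaxD B (anc i q) := by
  classical
  obtain ⟨N, hN⟩ := hb
  have h0 : B (anc 0 q) := by simpa using hq
  have hs := Nat.findGreatest_spec (P := fun i => B (anc i q)) (Nat.zero_le N) h0
  refine ⟨_, hs, fun i hi hB => ?_⟩
  rw [anc_anc] at hB
  rcases le_or_gt N (Nat.findGreatest (fun i => B (anc i q)) N + i) with h | h
  · exact hN _ h hB
  · have := Nat.le_findGreatest (P := fun i => B (anc i q)) h.le hB
    omega

/-- If the dyadic averages of `κ` at the points of `E` are at most `α`, then `κ E ≤ α |E|`. -/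
lemma measure_le_of_dyadic {κ : Measure (Rn n)} {α : ℝ≥0∞} (hα : α ≠ ∞) {E : Set (Rn n)}
    (hE : ∀ x ∈ E, ∀ j : ℤ, κ (dq (idx j x)) ≤ α * volume (dq (idx j x))) :
    κ E ≤ α * volume E := by
  have main : ∀ U : Set (Rn n), E ⊆ U → IsOpen U → κ E ≤ α * volume U := by
    intro U hEU hU
    set B : Idx n → Prop := fun q => dq q ⊆ U ∧ q.1 ≤ 0 with hB
    set S := {q : {q // MaxD B q} // (dq q.1 ∩ E).Nonempty}
    have hdis : Pairwise (Function.onFun Disjoint fun q : S => dq q.1.1) := fun q q' hne =>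
      pairwise_disjoint_maxD B fun h => hne (Subtype.ext h)
    have hcov : E ⊆ ⋃ q : S, dq q.1.1 := by
      intro x hx
      obtain ⟨ε, hε, hball⟩ := Metric.isOpen_iff.1 hU x (hEU hx)
      obtain ⟨k, hk⟩ := exists_pow_lt_of_lt_one (show 0 < ε / (n + 1) by positivity)
        (show (1 / 2 : ℝ) < 1 by norm_num)
      have hBx : B (idx (-k) x) := by
        refine ⟨fun y hy => hball ?_, by simp⟩
        have hx' := mem_dq_bounds.1 (mem_dq_idx (-k : ℤ) x)
        have hy' := mem_dq_bounds.1 hy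
        have hl : ell (idx (-k : ℤ) x) = (1 / 2) ^ k := by simp [ell]
        rw [hl] at hx' hy'
        rw [Metric.mem_ball, dist_eq_norm]
        have h1 : ‖y - x‖ ≤ ∑ i, ‖(y - x) i‖ := by
          rw [EuclideanSpace.norm_eq]
          refine Real.sqrt_le_iff.2 ⟨by positivity, ?_⟩
          exact Finset.sum_sq_le_sq_sum_of_nonneg fun i _ => norm_nonneg _
        have h2 : ∑ i, ‖(y - x) i‖ ≤ ∑ i : Fin n, (1 / 2 : ℝ) ^ k := by
          refine Finset.sum_le_sum fun i _ => ?_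
          have a1 := hx' i
          have a2 := hy' i
          rw [PiLp.sub_apply, Real.norm_eq_abs, abs_le]
          constructor <;> linarith
        rw [Finset.sum_const, Finset.card_univ, Fintype.card_fin, nsmul_eq_mul] at h2
        rw [lt_div_iff₀ (by positivity)] at hk
        have h3 : 0 < (1 / 2 : ℝ) ^ k := by positivity
        nlinarith
      obtain ⟨i, hi⟩ := exists_maxD hBx ⟨k + 1, fun i hi hBi => by
        have := hBi.2
        simp at this
        omega⟩
      exact mem_iUnion.2 ⟨⟨⟨_, hi⟩, x, dq_subset_anc i _ (mem_dq_idx _ _), hx⟩,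
        dq_subset_anc i _ (mem_dq_idx _ _)⟩
    calc κ E ≤ κ (⋃ q : S, dq q.1.1) := measure_mono hcov
      _ ≤ ∑' q : S, κ (dq q.1.1) := measure_iUnion_le _
      _ ≤ ∑' q : S, α * volume (dq q.1.1) := by
          refine ENNReal.tsum_le_tsum fun q => ?_
          obtain ⟨x, hx, hxE⟩ := q.2
          have := hE x hxE q.1.1.1
          rwa [mem_dq_iff.1 hx] at this
      _ = α * volume (⋃ q : S, dq q.1.1) := by
          rw [ENNReal.tsum_mul_left, measure_iUnion hdis fun q => measurableSet_dq _]
      _ ≤ α * volume U := by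
          gcongr
          exact iUnion_subset fun q => q.1.2.1.1
  rcases eq_or_ne α 0 with rfl | h0
  · simpa using main univ (subset_univ _) isOpen_univ
  rw [Set.measure_eq_iInf_isOpen E volume, ENNReal.mul_iInf_of_ne h0 hα]
  refine le_iInf fun U => ?_
  rw [ENNReal.mul_iInf_of_ne h0 hα]
  refine le_iInf fun hEU => ?_
  rw [ENNReal.mul_iInf_of_ne h0 hα]
  exact le_iInf fun hU => main U hEU hU

/-- The average of `κ` over the dyadic cube `q` exceeds `α`. -/
def Bad (κ : Measure (Rn n)) (α : ℝ≥0∞) (q : Idx n) : Prop := α * volume (dq q) < κ (dq q)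

lemma exists_le_mul_volume_anc (hn : 0 < n) {M α : ℝ≥0∞} (hM : M ≠ ∞) (hα : α ≠ 0) (q : Idx n) :
    ∃ N : ℕ, ∀ i ≥ N, M ≤ α * volume (dq (anc i q)) := by
  have h0 : α * volume (dq q) ≠ 0 := mul_ne_zero hα (volume_dq_ne_zero q)
  obtain ⟨N, hN⟩ := ENNReal.exists_nat_mul_gt h0 hM
  refine ⟨N, fun i hi => hN.le.trans ?_⟩
  rw [volume_dq_anc, mul_left_comm]
  gcongr
  calc (N : ℝ≥0∞) ≤ ((2 ^ (n * i) : ℕ) : ℝ≥0∞) := by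
        refine Nat.cast_le.2 (hi.trans ((Nat.lt_two_pow_self).le.trans ?_))
        exact Nat.pow_le_pow_right (by norm_num) (Nat.le_mul_of_pos_left i hn)
    _ = _ := by push_cast; rfl

lemma Bad.exists_maxD (hn : 0 < n) {κ : Measure (Rn n)} {α : ℝ≥0∞} (hκ : κ univ ≠ ∞)
    (hα : α ≠ 0) {q : Idx n} (hq : Bad κ α q) : ∃ i, MaxD (Bad κ α) (anc i q) := by
  refine MixedWeak.exists_maxD hq ?_
  obtain ⟨N, hN⟩ := exists_le_mul_volume_anc hn hκ hα q
  exact ⟨N, fun i hi h => absurd h (not_lt.2 ((measure_mono (subset_univ _)).trans (hN i hi)))⟩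

lemma tsum_maxD_volume_le {κ : Measure (Rn n)} {α : ℝ≥0∞} {B : Idx n → Prop}
    (hB : ∀ q, B q → α * volume (dq q) ≤ κ (dq q)) :
    α * ∑' q : {q // MaxD B q}, volume (dq q.1) ≤ κ (⋃ q : {q // MaxD B q}, dq q.1) := by
  rw [measure_iUnion (pairwise_disjoint_maxD B) fun q => measurableSet_dq _,
    ← ENNReal.tsum_mul_left]
  exact ENNReal.tsum_le_tsum fun q => hB _ q.2.1

lemma MaxD.measure_le {κ : Measure (Rn n)} {α : ℝ≥0∞} {q : Idx n} (h : MaxD (Bad κ α) q) :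
    κ (dq q) ≤ 2 ^ n * α * volume (dq q) := by
  have h1 := not_lt.1 (h.2 1 one_pos)
  rw [volume_dq_anc, mul_one] at h1
  calc κ (dq q) ≤ κ (dq (anc 1 q)) := measure_mono (dq_subset_anc 1 q)
    _ ≤ _ := h1
    _ = _ := by ring

lemma measure_le_of_disjoint_maxD (hn : 0 < n) {κ : Measure (Rn n)} {α : ℝ≥0∞} (hκ : κ univ ≠ ∞)
    (hα : α ≠ 0) (hα' : α ≠ ∞) {E : Set (Rn n)}
    (hE : ∀ x ∈ E, ∀ q, MaxD (Bad κ α) q → x ∉ dq q) : κ E ≤ α * volume E := by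
  refine measure_le_of_dyadic hα' fun x hx j => ?_
  by_contra hb
  obtain ⟨i, hi⟩ := Bad.exists_maxD hn hκ hα (q := idx j x) (not_le.1 hb)
  exact hE x hx _ hi (dq_subset_anc i _ (mem_dq_idx j x))

/-- Calderón–Zygmund decomposition of a set inside a dyadic cube. -/
lemma exists_cz_set (hn : 0 < n) {E : Set (Rn n)} {Q : Idx n} {α : ℝ≥0∞} (hE : MeasurableSet E)
    (hEQ : E ⊆ dq Q) (hα : α ≠ 0) (hα1 : α < 1) (hEα : volume E ≤ α * volume (dq Q)) :
    ∃ B : Idx n → Prop, volume (E \ ⋃ q : {q // MaxD B q}, dq q.1) = 0 ∧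
      (∀ q, MaxD B q → volume (E ∩ dq q) ≤ 2 ^ n * α * volume (dq q)) ∧
      (α * ∑' q : {q // MaxD B q}, volume (dq q.1) ≤ volume E) ∧
      ∀ q, MaxD B q → dq q ⊆ dq Q := by
  set κ := volume.restrict E with hκ
  have hEt : volume E ≠ ∞ := ne_top_of_le_ne_top (volume_dq_ne_top Q) (measure_mono hEQ)
  have hκt : κ univ ≠ ∞ := by rwa [hκ, Measure.restrict_apply_univ]
  have hκa : ∀ q, κ (dq q) = volume (E ∩ dq q) := fun q => by
    rw [hκ, Measure.restrict_apply (measurableSet_dq q), inter_comm]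
  refine ⟨Bad κ α, ?_, fun q hq => ?_, ?_, fun q hq => ?_⟩
  · set G := E \ ⋃ q : {q // MaxD (Bad κ α) q}, dq q.1 with hG
    have hGm : MeasurableSet G := hE.diff (MeasurableSet.iUnion fun q => measurableSet_dq _)
    have h1 := measure_le_of_disjoint_maxD hn hκt hα (ne_top_of_lt hα1) (E := G)
      fun x hx q hq hxq => hx.2 (mem_iUnion.2 ⟨⟨q, hq⟩, hxq⟩)
    rw [hκ, Measure.restrict_apply hGm, inter_eq_left.2 sdiff_subset] at h1
    by_contra h0
    have h2 : volume G ≠ ∞ := ne_top_of_le_ne_top hEt (measure_mono sdiff_subset)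
    have h3 : α * volume G < 1 * volume G := ENNReal.mul_lt_mul_left h0 h2 hα1
    rw [one_mul] at h3
    exact absurd h1 (not_le.2 h3)
  · rw [← hκa]; exact hq.measure_le
  · refine (tsum_maxD_volume_le (κ := κ) fun q hq => hq.le).trans ?_
    rw [← Measure.restrict_apply_univ E]
    exact measure_mono (subset_univ _)
  · have hb : α * volume (dq q) < volume (E ∩ dq q) := hκa q ▸ hq.1
    have hne : (E ∩ dq q).Nonempty := nonempty_of_measure_ne_zero (ne_bot_of_gt hb)
    obtain ⟨x, hxE, hxq⟩ := hne
    rcases le_or_gt q.1 Q.1 with h | h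
    · rw [eq_anc_of_mem hxq (hEQ hxE) h]
      exact dq_subset_anc _ _
    · exfalso
      have e := eq_anc_of_mem (hEQ hxE) hxq h.le
      have h1 : volume (dq Q) ≤ volume (dq q) := by rw [e]; exact measure_mono (dq_subset_anc _ _)
      refine absurd hb (not_lt.2 ?_)
      calc volume (E ∩ dq q) ≤ volume E := measure_mono inter_subset_left
        _ ≤ α * volume (dq Q) := hEα
        _ ≤ _ := by gcongr

/-- `x` and `y` differ by at most `A`. -/
def near (A x y : ℝ≥0∞) : Prop := x ≤ y + A ∧ y ≤ x + A

lemma near.symm {A x y : ℝ≥0∞} (h : near A x y) : near A y x := ⟨h.2, h.1⟩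

lemma near_self (A x : ℝ≥0∞) : near A x x := ⟨le_self_add, le_self_add⟩

lemma near.trans {A B x y z : ℝ≥0∞} (h : near A x y) (h' : near B y z) : near (A + B) x z := by
  constructor
  · calc x ≤ y + A := h.1
      _ ≤ (z + B) + A := by gcongr; exact h'.1
      _ = _ := by ring
  · calc z ≤ y + B := h'.2
      _ ≤ (x + A) + B := by gcongr; exact h.2
      _ = _ := by ring

lemma near.mono {A B x y : ℝ≥0∞} (h : near A x y) (hAB : A ≤ B) : near B x y :=
  ⟨h.1.trans (by gcongr), h.2.trans (by gcongr)⟩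

lemma measurableSet_near {F : Rn n → ℝ≥0∞} (hF : Measurable F) (A c : ℝ≥0∞) :
    MeasurableSet {x | near A (F x) c} :=
  (measurableSet_le hF measurable_const).inter
    (measurableSet_le measurable_const (hF.add measurable_const))

/-- A John–Nirenberg inequality with dyadic medians. -/
lemma john_nirenberg (hn : 0 < n) {F : Rn n → ℝ≥0∞} (hF : Measurable F) {c : Idx n → ℝ≥0∞}
    {A : ℝ≥0∞} (H : ∀ Q, volume {x ∈ dq Q | ¬ near A (F x) (c Q)} ≤
      (2 ^ (n + 3))⁻¹ * volume (dq Q)) (s : ℕ) (Q : Idx n) :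
    volume {x ∈ dq Q | ¬ near (2 * A * s) (F x) (c Q)} ≤ (2 ^ s)⁻¹ * volume (dq Q) := by
  induction s generalizing Q with
  | zero => 
    simp only [pow_zero, inv_one, one_mul]
    exact measure_mono (sep_subset _ _)
  | succ s ih =>
    set E := {x ∈ dq Q | ¬ near A (F x) (c Q)} with hE
    set α : ℝ≥0∞ := (2 ^ (n + 2))⁻¹ with hα
    have h2 : (2 : ℝ≥0∞) ≠ 0 := by norm_num
    have h2' : (2 : ℝ≥0∞) ≠ ∞ := by norm_num
    have hEm : MeasurableSet E := (measurableSet_dq Q).inter (measurableSet_near hF A _).compl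
    have hα0 : α ≠ 0 := ENNReal.inv_ne_zero.2 (by finiteness)
    have hεα : (2 ^ (n + 3))⁻¹ = α * 2⁻¹ := by
      rw [hα, ← ENNReal.mul_inv (by simp) (by simp), ← pow_succ]
    have hα1 : α < 1 := by
      rw [hα, ENNReal.inv_lt_one]
      exact one_lt_pow₀ (by norm_num) (by omega)
    have hαt : α ≠ ∞ := ne_top_of_lt hα1
    have hε : volume E ≤ α * 2⁻¹ * volume (dq Q) := hεα ▸ H Q
    obtain ⟨B, hB1, hB2, hB3, hB4⟩ := exists_cz_set hn hEm (sep_subset _ _) hα0 hα1 (hε.trans (by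
      gcongr
      exact mul_le_of_le_one_right' (by simp)))
    have hnear : ∀ q, MaxD B q → near (2 * A) (c q) (c Q) := by
      intro q hq
      by_contra hcon
      have hsub : dq q ⊆ (E ∩ dq q) ∪ {x ∈ dq q | ¬ near A (F x) (c q)} := by
        intro x hx
        by_cases h1 : near A (F x) (c Q)
        · refine Or.inr ⟨hx, fun h3 => hcon ?_⟩
          rw [two_mul]
          exact h3.symm.trans h1
        · exact Or.inl ⟨⟨hB4 q hq hx, h1⟩, hx⟩
      have h4 := (measure_mono hsub).trans ((measure_union_le _ _).trans
        (add_le_add (hB2 q hq) (H q)))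
      rw [← add_mul] at h4
      have h5 : (2 ^ n * α + (2 ^ (n + 3))⁻¹ : ℝ≥0∞) < 1 := by
        have e1 : (2 ^ n * α : ℝ≥0∞) = 4⁻¹ := by
          rw [hα, pow_add, ENNReal.mul_inv (by simp) (by simp), ← mul_assoc,
            ENNReal.mul_inv_cancel (by simp) (by simp), one_mul]
          norm_num
        have e2 : ((2 : ℝ≥0∞) ^ (n + 3))⁻¹ ≤ 8⁻¹ := by
          rw [ENNReal.inv_le_inv]
          calc (8 : ℝ≥0∞) = 2 ^ 3 := by norm_num
            _ ≤ 2 ^ (n + 3) := pow_le_pow_right₀ (by norm_num) (by omega)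
        calc (2 ^ n * α + (2 ^ (n + 3))⁻¹ : ℝ≥0∞) ≤ 4⁻¹ + 8⁻¹ := by rw [e1]; gcongr
          _ < 1 := by
            rw [← ENNReal.toReal_lt_toReal (by finiteness) (by finiteness),
              ENNReal.toReal_add (by finiteness) (by finiteness)]
            norm_num
      have h6 : _ < 1 * volume (dq q) :=
        ENNReal.mul_lt_mul_left (volume_dq_ne_zero q) (volume_dq_ne_top q) h5
      rw [one_mul] at h6
      exact absurd h4 (not_le.2 h6)
    have hsub : {x ∈ dq Q | ¬ near (2 * A * (s + 1 : ℕ)) (F x) (c Q)} ⊆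
        (E \ ⋃ q : {q // MaxD B q}, dq q.1) ∪
        ⋃ q : {q // MaxD B q}, {x ∈ dq q.1 | ¬ near (2 * A * s) (F x) (c q.1)} := by
      rintro x ⟨hxQ, hx⟩
      have hxE : x ∈ E := ⟨hxQ, fun h => hx (h.mono (by
        calc A ≤ 2 * A * 1 := by rw [mul_one, two_mul]; exact le_self_add
          _ ≤ _ := by gcongr; push_cast; exact le_add_self))⟩
      by_cases hU : x ∈ ⋃ q : {q // MaxD B q}, dq q.1
      · obtain ⟨q, hq⟩ := mem_iUnion.1 hU
        refine Or.inr (mem_iUnion.2 ⟨q, hq, fun h => hx ?_⟩)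
        refine (h.trans (hnear _ q.2)).mono (le_of_eq ?_)
        push_cast; ring
      · exact Or.inl ⟨hxE, hU⟩
    have hsum : ∑' q : {q // MaxD B q}, volume (dq q.1) ≤ 2⁻¹ * volume (dq Q) := by
      have := hB3.trans hε
      rw [mul_assoc] at this
      exact (ENNReal.mul_le_mul_iff_right hα0 hαt).1 this
    calc _ ≤ _ := measure_mono hsub
      _ ≤ 0 + ∑' q : {q // MaxD B q}, (2 ^ s)⁻¹ * volume (dq q.1) := by
          refine (measure_union_le _ _).trans (add_le_add hB1.le ?_)
          exact (measure_iUnion_le _).trans (ENNReal.tsum_le_tsum fun q => ih q.1)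
      _ = (2 ^ s)⁻¹ * ∑' q : {q // MaxD B q}, volume (dq q.1) := by
          rw [zero_add, ENNReal.tsum_mul_left]
      _ ≤ (2 ^ s)⁻¹ * (2⁻¹ * volume (dq Q)) := by gcongr
      _ = _ := by
          rw [pow_succ, ENNReal.mul_inv (by simp) (by simp), mul_assoc]

/-- The kernel of the `j`-th increment of the heat semigroup along `t`. -/
def hd (n : ℕ) (t : ℕ → ℝ) (j : ℕ) (z : Rn n) : ℝ := hk n (t j) z - hk n (t (j + 1)) z

lemma hd_neg (t : ℕ → ℝ) (j : ℕ) (z : Rn n) : hd n t j (-z) = hd n t j z := by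
  simp only [hd, hk_neg]

lemma continuous_hd (t : ℕ → ℝ) (j : ℕ) : Continuous (hd n t j) :=
  (continuous_hk n _).sub (continuous_hk n _)

lemma integrable_hd_mul {t : ℕ → ℝ} (h0 : ∀ j, 0 < t j) {g : Rn n → ℝ} (hg : Integrable g)
    (x : Rn n) (j : ℕ) : Integrable fun y => hd n t j (x - y) * g y := by
  simp only [hd, sub_mul]
  exact (integrable_hk_mul (h0 _) hg x).sub (integrable_hk_mul (h0 _) hg x)

lemma heatInc_eq_integral {t : ℕ → ℝ} (h0 : ∀ j, 0 < t j) {g : Rn n → ℝ} (hg : Integrable g)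
    (x : Rn n) (j : ℕ) : heatInc n t g x j = ∫ y, hd n t j (x - y) * g y := by
  simp only [heatInc, heatSg_eq, hd, sub_mul]
  rw [integral_sub (integrable_hk_mul (h0 _) hg x) (integrable_hk_mul (h0 _) hg x)]

lemma norm_le_sum_abs (z : Rn n) : ‖z‖ ≤ ∑ i, |z i| := by
  rw [EuclideanSpace.norm_eq]
  refine Real.sqrt_le_iff.2 ⟨by positivity, ?_⟩
  exact Finset.sum_sq_le_sq_sum_of_nonneg fun i _ => norm_nonneg _

lemma norm_sub_le_of_mem_cube {c a b : Rn n} {r : ℝ} (ha : a ∈ cube c r) (hb : b ∈ cube c r) :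
    ‖a - b‖ ≤ n * r := by
  refine (norm_le_sum_abs _).trans ?_
  calc ∑ i, |(a - b) i| ≤ ∑ i : Fin n, r := by
        refine Finset.sum_le_sum fun i _ => ?_
        have h1 := abs_le.1 (ha i)
        have h2 := abs_le.1 (hb i)
        rw [PiLp.sub_apply, abs_le]
        constructor <;> linarith [h1.1, h1.2, h2.1, h2.2]
    _ = n * r := by simp

lemma abs_apply_le_norm (z : Rn n) (i : Fin n) : |z i| ≤ ‖z‖ := PiLp.norm_apply_le z i

lemma add_smul_sub_mem_cube {c a b : Rn n} {r s : ℝ} (ha : a ∈ cube c r) (hb : b ∈ cube c r)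
    (hs : s ∈ Icc (0 : ℝ) 1) : b + s • (a - b) ∈ cube c r := by
  intro i
  have h1 := abs_le.1 (ha i)
  have h2 := abs_le.1 (hb i)
  simp only [PiLp.add_apply, PiLp.smul_apply, PiLp.sub_apply, smul_eq_mul]
  rw [abs_le]
  constructor <;> nlinarith [hs.1, hs.2, h1.1, h1.2, h2.1, h2.2]

lemma exists_sum_hd_sub_le (n : ℕ) : ∃ C : ℝ≥0∞, C ≠ ∞ ∧ ∀ t : ℕ → ℝ, Antitone t →
    (∀ j, 0 < t j) → ∀ (N : ℕ) (c a b z : Rn n) (r d : ℝ), 0 < d → a ∈ cube c r →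
    b ∈ cube c r → (∀ w ∈ cube c r, d ≤ ‖z - w‖) →
    ∑ j ∈ Finset.range N, ‖hd n t j (z - a) - hd n t j (z - b)‖ₑ ≤
      C * ENNReal.ofReal (r / d ^ (n + 1)) := by
  obtain ⟨C, hC0, hC⟩ := exists_kernel_variation n
  refine ⟨ENNReal.ofReal (C * n), ENNReal.ofReal_ne_top, ?_⟩
  intro t ht h0 N c a b z r d hd0 ha hb hw
  have h := hC t ht h0 N (z - b) (b - a) d hd0 fun s hs => by
    have := hw _ (add_smul_sub_mem_cube ha hb hs)
    have e : z - b + s • (b - a) = z - (b + s • (a - b)) := by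
      rw [← neg_sub a b, smul_neg]; abel
    rwa [e]
  rw [sub_add_sub_cancel] at h
  simp only [Real.enorm_eq_ofReal_abs]
  rw [← ENNReal.ofReal_sum_of_nonneg fun _ _ => abs_nonneg _,
    ← ENNReal.ofReal_mul (by positivity)]
  refine ENNReal.ofReal_le_ofReal (h.trans ?_)
  rw [mul_div_assoc, mul_assoc, ← mul_div_assoc (n : ℝ)]
  gcongr
  exact norm_sub_le_of_mem_cube hb ha

lemma le_norm_sub_of_notMem {q : Idx n} {i : ℕ} {z w : Rn n}
    (hz : z ∉ cube (cen q) (3 * 2 ^ i * ell q)) (hw : w ∈ cube (cen q) (ell q)) :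
    2 ^ i * ell q ≤ ‖z - w‖ := by
  rw [mem_cube_iff] at hz
  push Not at hz
  obtain ⟨a, ha⟩ := hz
  refine le_trans ?_ (abs_apply_le_norm (z - w) a)
  have h1 := hw a
  have h2 := abs_sub_le (z a) (w a) (cen q a)
  have h3 : (1 : ℝ) ≤ 2 ^ i := one_le_pow₀ (by norm_num)
  have := ell_pos q
  rw [PiLp.sub_apply]
  nlinarith

lemma exists_notMem_cube (q : Idx n) {x : Rn n} (hx : x ∉ tq q) :
    ∃ i : ℕ, x ∉ cube (cen q) (3 * 2 ^ i * ell q) ∧ x ∈ cube (cen q) (3 * 2 ^ (i + 1) * ell q) := by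
  classical
  have hex : ∃ i : ℕ, x ∈ cube (cen q) (3 * 2 ^ i * ell q) := by
    obtain ⟨i, hi⟩ := pow_unbounded_of_one_lt (‖x - cen q‖ / ell q) (one_lt_two (α := ℝ))
    refine ⟨i, fun a => ?_⟩
    rw [div_lt_iff₀ (ell_pos q)] at hi
    have := abs_apply_le_norm (x - cen q) a
    rw [PiLp.sub_apply] at this
    have := ell_pos q
    have h3 : (1 : ℝ) ≤ 2 ^ i := one_le_pow₀ (by norm_num)
    nlinarith
  have hs := Nat.find_spec hex
  have hne : Nat.find hex ≠ 0 := fun h => hx (by rw [h] at hs; simpa [tq] using hs)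
  obtain ⟨i, hi⟩ := Nat.exists_eq_succ_of_ne_zero hne
  refine ⟨i, Nat.find_min hex (by omega), ?_⟩
  rw [hi] at hs
  exact hs

/-- A majorant of the kernel oscillation over a dyadic cube, as a sum over dyadic shells. -/
def shellW (C : ℝ≥0∞) (q : Idx n) (x : Rn n) : ℝ≥0∞ :=
  ∑' i : ℕ, (cube (cen q) (3 * 2 ^ (i + 1) * ell q)).indicator
    (fun _ => C * ENNReal.ofReal (ell q / (2 ^ i * ell q) ^ (n + 1))) x

lemma measurable_shellW (C : ℝ≥0∞) (q : Idx n) : Measurable (shellW C q) :=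
  Measurable.tsum fun _ => measurable_const.indicator (measurableSet_cube _ _)

lemma lintegral_shellW (C : ℝ≥0∞) (q : Idx n) : ∫⁻ x, shellW C q x = C * (6 ^ n * 2) := by
  unfold shellW
  rw [lintegral_tsum fun i =>
    (measurable_const.indicator (measurableSet_cube _ _)).aemeasurable]
  have hl := ell_pos q
  have e : ∀ i : ℕ, ∫⁻ x, (cube (cen q) (3 * 2 ^ (i + 1) * ell q)).indicator
      (fun _ => C * ENNReal.ofReal (ell q / (2 ^ i * ell q) ^ (n + 1))) x =
      C * 6 ^ n * ENNReal.ofReal ((1 / 2) ^ i) := by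
    intro i
    rw [lintegral_indicator_const (measurableSet_cube _ _), volume_cube _ (by positivity),
      mul_assoc C, ← ENNReal.ofReal_mul (by positivity)]
    have : (6 : ℝ≥0∞) ^ n = ENNReal.ofReal (6 ^ n) := by
      rw [ENNReal.ofReal_pow (by norm_num)]; norm_num
    rw [this, mul_assoc C, ← ENNReal.ofReal_mul (by positivity)]
    congr 2
    rw [one_div, inv_pow]
    rw [show 3 * 2 ^ (i + 1) * ell q = 6 * (2 ^ i * ell q) by ring]
    field_simp
    ring
  simp only [e]
  rw [ENNReal.tsum_mul_left, ← ENNReal.ofReal_tsum_of_nonneg (fun _ => by positivity)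
    summable_geometric_two, tsum_geometric_two, mul_assoc]
  norm_num

lemma exists_sum_hd_le_shellW (n : ℕ) : ∃ C : ℝ≥0∞, C ≠ ∞ ∧ ∀ t : ℕ → ℝ, Antitone t →
    (∀ j, 0 < t j) → ∀ (N : ℕ) (q : Idx n) (x y : Rn n), x ∉ tq q → y ∈ dq q →
    ∑ j ∈ Finset.range N, ‖hd n t j (x - y) - hd n t j (x - cen q)‖ₑ ≤ shellW C q x := by
  obtain ⟨C, hC0, hC⟩ := exists_sum_hd_sub_le n
  refine ⟨C, hC0, ?_⟩
  intro t ht h0 N q x y hx hy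
  obtain ⟨i, hi, hi'⟩ := exists_notMem_cube q hx
  have hl := ell_pos q
  refine (hC t ht h0 N (cen q) y (cen q) x (ell q) (2 ^ i * ell q) (by positivity)
    (dq_subset_cube q hy) (dq_subset_cube q (cen_mem q)) fun w hw =>
      le_norm_sub_of_notMem hi hw).trans ?_
  refine le_trans (le_of_eq ?_) (ENNReal.le_tsum i)
  rw [indicator_of_mem hi']

/-- The function equal to `f1 q` on each maximal cube `q` of `B`, and to `f0` elsewhere. -/
def glue {β : Type*} (B : Idx n → Prop) (f0 : Rn n → β) (f1 : Idx n → β) (y : Rn n) : β :=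
  open Classical in if h : ∃ q, MaxD B q ∧ y ∈ dq q then f1 h.choose else f0 y

lemma glue_of_mem {β : Type*} {B : Idx n → Prop} (f0 : Rn n → β) (f1 : Idx n → β) {q : Idx n}
    (hq : MaxD B q) {y : Rn n} (hy : y ∈ dq q) : glue B f0 f1 y = f1 q := by
  have h : ∃ q, MaxD B q ∧ y ∈ dq q := ⟨q, hq, hy⟩
  rw [glue, dif_pos h, h.choose_spec.1.eq_of_mem hq h.choose_spec.2 hy]

lemma glue_of_notMem {β : Type*} {B : Idx n → Prop} (f0 : Rn n → β) (f1 : Idx n → β) {y : Rn n}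
    (hy : ∀ q, MaxD B q → y ∉ dq q) : glue B f0 f1 y = f0 y := by
  rw [glue, dif_neg]
  rintro ⟨q, hq, h⟩
  exact hy q hq h

lemma measurable_glue {β : Type*} [MeasurableSpace β] (B : Idx n → Prop) {f0 : Rn n → β}
    (hf : Measurable f0) (f1 : Idx n → β) : Measurable (glue B f0 f1) := by
  intro s hs
  have e : glue B f0 f1 ⁻¹' s = (f0 ⁻¹' s \ ⋃ q : {q // MaxD B q}, dq q.1) ∪
      ⋃ q : {q : Idx n // MaxD B q ∧ f1 q ∈ s}, dq q.1 := by
    ext y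
    by_cases hy : ∃ q, MaxD B q ∧ y ∈ dq q
    · obtain ⟨q, hq, hyq⟩ := hy
      rw [mem_preimage, glue_of_mem f0 f1 hq hyq]
      constructor
      · exact fun h => Or.inr (mem_iUnion.2 ⟨⟨q, hq, h⟩, hyq⟩)
      · rintro (h | h)
        · exact absurd (mem_iUnion.2 ⟨⟨q, hq⟩, hyq⟩) h.2
        · obtain ⟨q', hq'⟩ := mem_iUnion.1 h
          rw [hq.eq_of_mem q'.2.1 hyq hq']
          exact q'.2.2
    · have hy' : ∀ q, MaxD B q → y ∉ dq q := fun q hq h => hy ⟨q, hq, h⟩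
      rw [mem_preimage, glue_of_notMem f0 f1 hy']
      constructor
      · refine fun h => Or.inl ⟨h, fun h' => ?_⟩
        obtain ⟨q', hq'⟩ := mem_iUnion.1 h'
        exact hy' _ q'.2 hq'
      · rintro (h | h)
        · exact h.1
        · obtain ⟨q', hq'⟩ := mem_iUnion.1 h
          exact absurd hq' (hy' _ q'.2.1)
  rw [e]
  exact ((hf hs).diff (MeasurableSet.iUnion fun q => measurableSet_dq _)).union
    (MeasurableSet.iUnion fun q => measurableSet_dq _)

lemma heatInc_zero (t : ℕ → ℝ) (x : Rn n) (j : ℕ) : heatInc n t (fun _ => 0) x j = 0 := by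
  simp [heatInc, heatSg]

lemma exists_varHeat_bad_le (n : ℕ) : ∃ C : ℝ≥0∞, C ≠ ∞ ∧ ∀ (ϱ : ℝ), 1 ≤ ϱ →
    ∀ (B : Idx n → Prop) (b : Rn n → ℝ), Measurable b → Integrable b →
    (∀ y, (∀ q, MaxD B q → y ∉ dq q) → b y = 0) → (∀ q, MaxD B q → ∫ y in dq q, b y = 0) →
    ∀ x, (∀ q, MaxD B q → x ∉ tq q) →
    varHeat n ϱ b x ≤ ∑' q : {q // MaxD B q}, shellW C q.1 x * ∫⁻ y in dq q.1, ‖b y‖ₑ := by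
  obtain ⟨C, hC0, hC⟩ := exists_sum_hd_le_shellW n
  refine ⟨C, hC0, fun ϱ hϱ B b hbm hbi hb0 hbq x hx => ?_⟩
  have hz : varHeat n ϱ (fun _ : Rn n => (0 : ℝ)) x = 0 := varHeat_zero (by linarith) x
  rw [← zero_add (∑' q : {q // MaxD B q}, _), ← hz]
  refine varHeat_le_add hϱ fun t ht h0 N => ?_
  have hU : ∀ j, ‖heatInc n t b x j‖ₑ ≤ ∑' q : {q // MaxD B q},
      ∫⁻ y in dq q.1, ‖hd n t j (x - y) - hd n t j (x - cen q.1)‖ₑ * ‖b y‖ₑ := by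
    intro j
    have hi := integrable_hd_mul h0 hbi x j
    rw [heatInc_eq_integral h0 hbi]
    have e1 : ∫ y, hd n t j (x - y) * b y
        = ∫ y in ⋃ q : {q // MaxD B q}, dq q.1, hd n t j (x - y) * b y := by
      rw [setIntegral_eq_integral_of_forall_compl_eq_zero]
      intro y hy
      rw [hb0 y fun q hq h => hy (mem_iUnion.2 ⟨⟨q, hq⟩, h⟩), mul_zero]
    rw [e1, ← (hasSum_integral_iUnion (fun q : {q // MaxD B q} => measurableSet_dq q.1)
      (pairwise_disjoint_maxD B) hi.integrableOn).tsum_eq]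
    refine enorm_tsum_le_tsum_enorm.trans (ENNReal.tsum_le_tsum fun q => ?_)
    have e2 : ∫ y in dq q.1, hd n t j (x - y) * b y
        = ∫ y in dq q.1, (hd n t j (x - y) - hd n t j (x - cen q.1)) * b y := by
      simp only [sub_mul]
      rw [integral_sub hi.integrableOn (hbi.integrableOn.const_mul _), integral_const_mul,
        hbq _ q.2, mul_zero, sub_zero]
    rw [e2]
    refine (enorm_integral_le_lintegral_enorm _).trans (le_of_eq ?_)
    simp only [enorm_mul]
  have hm : ∀ (j : ℕ) (q : Idx n), Measurable fun y : Rn n =>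
      ‖hd n t j (x - y) - hd n t j (x - cen q)‖ₑ * ‖b y‖ₑ := fun j q =>
    (((continuous_hd t j).comp (continuous_const.sub continuous_id)).measurable.sub_const
      _).enorm.mul hbm.enorm
  calc _ = ∑ j ∈ Finset.range N, ‖heatInc n t b x j‖ₑ := by
        simp only [heatInc_zero, sub_zero, Real.enorm_eq_ofReal_abs]
    _ ≤ ∑ j ∈ Finset.range N, ∑' q : {q // MaxD B q},
      ∫⁻ y in dq q.1, ‖hd n t j (x - y) - hd n t j (x - cen q.1)‖ₑ * ‖b y‖ₑ :=
        Finset.sum_le_sum fun j _ => hU j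
    _ = ∑' q : {q // MaxD B q}, ∫⁻ y in dq q.1, (∑ j ∈ Finset.range N,
          ‖hd n t j (x - y) - hd n t j (x - cen q.1)‖ₑ) * ‖b y‖ₑ := by
        rw [← Summable.tsum_finsetSum fun _ _ => ENNReal.summable]
        refine tsum_congr fun q => ?_
        rw [← lintegral_finsetSum _ fun j _ => hm j q.1]
        simp only [Finset.sum_mul]
    _ ≤ ∑' q : {q // MaxD B q}, ∫⁻ y in dq q.1, shellW C q.1 x * ‖b y‖ₑ := by
        refine ENNReal.tsum_le_tsum fun q => ?_
        refine setLIntegral_mono (hbm.enorm.const_mul _) fun y hy => ?_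
        gcongr
        exact hC t ht.antitone h0 N q.1 x y (hx _ q.2) hy
    _ = _ := by
        refine tsum_congr fun q => ?_
        rw [lintegral_const_mul _ hbm.enorm]

/-- The average of `g` over a dyadic cube. -/
def dAvg (g : Rn n → ℝ) (q : Idx n) : ℝ := (volume.real (dq q))⁻¹ * ∫ y in dq q, g y

lemma volume_real_dq_pos (q : Idx n) : 0 < volume.real (dq q) :=
  ENNReal.toReal_pos (volume_dq_ne_zero q) (volume_dq_ne_top q)

lemma enorm_dAvg_mul_le (g : Rn n → ℝ) (q : Idx n) :
    ‖dAvg g q‖ₑ * volume (dq q) ≤ ∫⁻ y in dq q, ‖g y‖ₑ := by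
  have h : volume (dq q) = ‖volume.real (dq q)‖ₑ := by
    rw [Real.enorm_eq_ofReal measureReal_nonneg, ofReal_measureReal (volume_dq_ne_top q)]
  rw [h, ← enorm_mul, dAvg, mul_comm, ← mul_assoc, mul_inv_cancel₀ (volume_real_dq_pos q).ne',
    one_mul]
  exact enorm_integral_le_lintegral_enorm _

/-- The measure `|g| dx`. -/
def kap (g : Rn n → ℝ) : Measure (Rn n) := volume.withDensity fun y => ‖g y‖ₑ

lemma kap_apply (g : Rn n → ℝ) {s : Set (Rn n)} (hs : MeasurableSet s) :
    kap g s = ∫⁻ y in s, ‖g y‖ₑ := withDensity_apply _ hs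

lemma kap_univ (g : Rn n → ℝ) : kap g univ = ∫⁻ y, ‖g y‖ₑ := by
  rw [kap_apply g MeasurableSet.univ, Measure.restrict_univ]

lemma ae_enorm_le_of_disjoint (hn : 0 < n) {g : Rn n → ℝ} (hgm : Measurable g)
    (hgi : Integrable g) {α : ℝ≥0∞} (hα : α ≠ 0) (hα' : α ≠ ∞) :
    ∀ᵐ y, (∀ q, MaxD (Bad (kap g) α) q → y ∉ dq q) → ‖g y‖ₑ ≤ α := by
  set G := (⋃ q : {q // MaxD (Bad (kap g) α) q}, dq q.1)ᶜ with hG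
  have hGm : MeasurableSet G := (MeasurableSet.iUnion fun q => measurableSet_dq _).compl
  have hGmem : ∀ y, (∀ q, MaxD (Bad (kap g) α) q → y ∉ dq q) ↔ y ∈ G := by
    intro y; simp [hG]
  have h : (fun y => ‖g y‖ₑ) ≤ᵐ[volume.restrict G] fun _ => α := by
    refine ae_le_of_forall_setLIntegral_le_of_sigmaFinite hgm.enorm fun s hs _ => ?_
    rw [Measure.restrict_restrict hs, ← kap_apply g (hs.inter hGm), setLIntegral_const]
    refine measure_le_of_disjoint_maxD hn ?_ hα hα' fun x hx => (hGmem x).2 hx.2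
    rw [kap_univ]
    exact hgi.2.ne
  rw [Filter.EventuallyLE, ae_restrict_iff' hGm] at h
  filter_upwards [h] with y hy hy'
  exact hy ((hGmem y).1 hy')

/-- The good part of the Calderón–Zygmund decomposition. -/
def goodPart (g : Rn n → ℝ) (α : ℝ≥0∞) : Rn n → ℝ := glue (Bad (kap g) α) g (dAvg g)

lemma enorm_dAvg_le {g : Rn n → ℝ} {α : ℝ≥0∞} {q : Idx n} (hq : MaxD (Bad (kap g) α) q) :
    ‖dAvg g q‖ₑ ≤ 2 ^ n * α := by
  have h1 := enorm_dAvg_mul_le g q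
  rw [← kap_apply g (measurableSet_dq q)] at h1
  have h1 := h1.trans hq.measure_le
  exact (ENNReal.mul_le_mul_iff_left (volume_dq_ne_zero q) (volume_dq_ne_top q)).1 h1

lemma ae_enorm_goodPart_le (hn : 0 < n) {g : Rn n → ℝ} (hgm : Measurable g)
    (hgi : Integrable g) {α : ℝ≥0∞} (hα : α ≠ 0) (hα' : α ≠ ∞) :
    ∀ᵐ y, ‖goodPart g α y‖ₑ ≤ 2 ^ n * α := by
  filter_upwards [ae_enorm_le_of_disjoint hn hgm hgi hα hα'] with y hy
  by_cases h : ∃ q, MaxD (Bad (kap g) α) q ∧ y ∈ dq q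
  · obtain ⟨q, hq, hyq⟩ := h
    rw [goodPart, glue_of_mem _ _ hq hyq]
    exact enorm_dAvg_le hq
  · have h' : ∀ q, MaxD (Bad (kap g) α) q → y ∉ dq q := fun q hq hyq => h ⟨q, hq, hyq⟩
    rw [goodPart, glue_of_notMem _ _ h']
    exact (hy h').trans (le_mul_of_one_le_left' (one_le_pow₀ (by norm_num)))

lemma lintegral_goodPart_le {g : Rn n → ℝ} (α : ℝ≥0∞) :
    ∫⁻ y, ‖goodPart g α y‖ₑ ≤ ∫⁻ y, ‖g y‖ₑ := by
  set U := ⋃ q : {q // MaxD (Bad (kap g) α) q}, dq q.1 with hU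
  have hUm : MeasurableSet U := MeasurableSet.iUnion fun q => measurableSet_dq _
  rw [← lintegral_add_compl _ hUm, ← lintegral_add_compl (fun y => ‖g y‖ₑ) hUm]
  refine add_le_add ?_ (le_of_eq ?_)
  · rw [hU, lintegral_iUnion (fun q => measurableSet_dq _) (pairwise_disjoint_maxD _),
      lintegral_iUnion (fun q => measurableSet_dq _) (pairwise_disjoint_maxD _)]
    refine ENNReal.tsum_le_tsum fun q => ?_
    calc _ = ∫⁻ y in dq q.1, ‖dAvg g q.1‖ₑ := by
          refine setLIntegral_congr_fun (measurableSet_dq _) fun y hy => ?_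
          simp only [goodPart, glue_of_mem _ _ q.2 hy]
      _ ≤ _ := by
          rw [setLIntegral_const]
          exact enorm_dAvg_mul_le g q.1
  · refine setLIntegral_congr_fun hUm.compl fun y hy => ?_
    rw [goodPart, glue_of_notMem]
    exact fun q hq h => hy (mem_iUnion.2 ⟨⟨q, hq⟩, h⟩)

lemma measurable_goodPart {g : Rn n → ℝ} (hg : Measurable g) (α : ℝ≥0∞) :
    Measurable (goodPart g α) := measurable_glue _ hg _

lemma integrable_goodPart {g : Rn n → ℝ} (hg : Measurable g) (hgi : Integrable g) (α : ℝ≥0∞) :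
    Integrable (goodPart g α) :=
  ⟨(measurable_goodPart hg α).aestronglyMeasurable,
    (lintegral_goodPart_le α).trans_lt hgi.2⟩

lemma setIntegral_sub_goodPart {g : Rn n → ℝ} (hg : Measurable g) (hgi : Integrable g)
    {α : ℝ≥0∞} {q : Idx n} (hq : MaxD (Bad (kap g) α) q) :
    ∫ y in dq q, (g y - goodPart g α y) = 0 := by
  rw [integral_sub hgi.integrableOn (integrable_goodPart hg hgi α).integrableOn,
    setIntegral_congr_fun (f := goodPart g α) (g := fun _ => dAvg g q) (measurableSet_dq q)
      fun y hy => glue_of_mem g (dAvg g) hq hy, setIntegral_const, smul_eq_mul, dAvg,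
    ← mul_assoc, mul_inv_cancel₀ (volume_real_dq_pos q).ne', one_mul, sub_self]

/-- Weak type `(1,1)` of the variation at bounded functions. -/
lemma mul_volume_varHeat_le_of_bounded {ϱ lam : ℝ} (hϱ : 2 < ϱ) (hl : 0 < lam) {h : Rn n → ℝ}
    (hm : Measurable h) (hM : ∀ x, |h x| ≤ 2 ^ n * lam) (hi : Integrable h) :
    ENNReal.ofReal lam * volume {x | ENNReal.ofReal lam ≤ varHeat n ϱ h x} ≤
      ENNReal.ofReal (6 ^ ϱ * (1 - (1 / 2) ^ (ϱ - 2))⁻¹) * ENNReal.ofReal ((2 ^ n) ^ (ϱ - 1)) *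
        ∫⁻ x, ‖h x‖ₑ := by
  have h0 : 0 < ϱ := by linarith
  have h1 : 0 < (lam : ℝ) ^ (ϱ - 1) := Real.rpow_pos_of_pos hl _
  have hA := lintegral_varHeat_rpow_le hϱ (by positivity) hm hM hi
  have hC := mul_meas_ge_le_lintegral₀
    (((measurable_varHeat h0 hi).pow_const ϱ).aemeasurable (μ := volume))
    (ENNReal.ofReal lam ^ ϱ)
  have e : {x | ENNReal.ofReal lam ^ ϱ ≤ varHeat n ϱ h x ^ ϱ}
      = {x | ENNReal.ofReal lam ≤ varHeat n ϱ h x} := by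
    ext x; exact ENNReal.rpow_le_rpow_iff h0
  rw [e] at hC
  have hB := hC.trans hA
  have e1 : ENNReal.ofReal lam ^ ϱ = ENNReal.ofReal (lam ^ (ϱ - 1)) * ENNReal.ofReal lam := by
    rw [ENNReal.ofReal_rpow_of_pos hl, ← ENNReal.ofReal_mul h1.le]
    congr 1
    rw [← Real.rpow_add_one hl.ne']
    ring_nf
  have e2 : ENNReal.ofReal ((2 ^ n * lam) ^ (ϱ - 1))
      = ENNReal.ofReal (lam ^ (ϱ - 1)) * ENNReal.ofReal ((2 ^ n) ^ (ϱ - 1)) := by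
    rw [← ENNReal.ofReal_mul h1.le, Real.mul_rpow (by positivity) hl.le, mul_comm]
  rw [e1, e2] at hB
  simp only [← Real.enorm_eq_ofReal_abs] at hB
  refine (ENNReal.mul_le_mul_iff_right (a := ENNReal.ofReal (lam ^ (ϱ - 1)))
    (ENNReal.ofReal_pos.2 h1).ne' ENNReal.ofReal_ne_top).1 ?_
  calc _ = _ := by rw [← mul_assoc]
    _ ≤ _ := hB
    _ = _ := by ring

lemma mul_volume_iUnion_tq_le {κ : Measure (Rn n)} {α : ℝ≥0∞} :
    α * volume (⋃ q : {q // MaxD (Bad κ α) q}, tq q.1) ≤ 3 ^ n * κ univ := by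
  calc _ ≤ α * ∑' q : {q // MaxD (Bad κ α) q}, volume (tq q.1) := by
        gcongr; exact measure_iUnion_le _
    _ = 3 ^ n * (α * ∑' q : {q // MaxD (Bad κ α) q}, volume (dq q.1)) := by
        simp only [volume_tq]
        rw [ENNReal.tsum_mul_left]; ring
    _ ≤ _ := by
        gcongr
        exact (tsum_maxD_volume_le fun q hq => hq.le).trans (measure_mono (subset_univ _))

lemma lintegral_tsum_shellW (K : ℝ≥0∞) (B : Idx n → Prop) (b : Rn n → ℝ) :
    ∫⁻ x, ∑' q : {q // MaxD B q}, shellW K q.1 x * ∫⁻ y in dq q.1, ‖b y‖ₑ =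
      K * (6 ^ n * 2) * ∫⁻ y in ⋃ q : {q // MaxD B q}, dq q.1, ‖b y‖ₑ := by
  have hm : ∀ q : {q // MaxD B q}, AEMeasurable
      (fun x => shellW K q.1 x * ∫⁻ y in dq q.1, ‖b y‖ₑ) volume :=
    fun q => ((measurable_shellW K q.1).mul_const _).aemeasurable
  rw [lintegral_tsum hm, lintegral_iUnion (fun q => measurableSet_dq _) (pairwise_disjoint_maxD _),
    ← ENNReal.tsum_mul_left]
  refine tsum_congr fun q => ?_
  rw [lintegral_mul_const _ (measurable_shellW K _), lintegral_shellW]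

/-- Weak type `(1,1)` of the variation operator. -/
lemma exists_weak_type (hn : 0 < n) {ϱ : ℝ} (hϱ : 2 < ϱ) : ∃ C : ℝ≥0∞, C ≠ ∞ ∧
    ∀ g : Rn n → ℝ, Measurable g → Integrable g → ∀ α : ℝ≥0∞, α ≠ ∞ →
    α * volume {x | α < varHeat n ϱ g x} ≤ C * ∫⁻ y, ‖g y‖ₑ := by
  have h1ϱ : 1 ≤ ϱ := by linarith
  obtain ⟨K, hK, hbad⟩ := exists_varHeat_bad_le n
  set A := ENNReal.ofReal (6 ^ ϱ * (1 - (1 / 2) ^ (ϱ - 2))⁻¹) *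
    ENNReal.ofReal ((2 ^ n) ^ (ϱ - 1)) with hA
  have hA' : A ≠ ∞ := ENNReal.mul_ne_top ENNReal.ofReal_ne_top ENNReal.ofReal_ne_top
  refine ⟨2 * (A + (3 ^ n + K * (6 ^ n * 2) * 2)), ?_, fun g hg hgi α hα => ?_⟩
  · have : K * (6 ^ n * 2) * 2 ≠ ∞ := by finiteness
    finiteness
  rcases eq_or_ne α 0 with rfl | hα0
  · simp
  set lam := α.toReal / 2 with hlam
  have hlpos : 0 < lam := half_pos (ENNReal.toReal_pos hα0 hα)
  set a := ENNReal.ofReal lam with ha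
  have hαa : α = 2 * a := by
    rw [ha, hlam, ENNReal.ofReal_div_of_pos two_pos, ENNReal.ofReal_toReal hα,
      ENNReal.ofReal_ofNat, ENNReal.mul_div_cancel two_ne_zero ENNReal.ofNat_ne_top]
  have ha0 : a ≠ 0 := (ENNReal.ofReal_pos.2 hlpos).ne'
  have ha1 : a ≠ ∞ := ENNReal.ofReal_ne_top
  set G := goodPart g a with hG
  have hGm := measurable_goodPart hg a
  have hGi := integrable_goodPart hg hgi a
  set L := 2 ^ n * lam with hL
  have hL0 : 0 < L := by positivity
  set h : Rn n → ℝ := fun y => max (min (G y) L) (-L) with hh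
  have hhm : Measurable h := (hGm.min measurable_const).max measurable_const
  have hhM : ∀ y, |h y| ≤ L := fun y =>
    abs_le.2 ⟨le_max_right _ _, max_le (min_le_right _ _) (by linarith)⟩
  have hhG : h =ᵐ[volume] G := by
    filter_upwards [ae_enorm_goodPart_le hn hg hgi ha0 ha1] with y hy
    have e : (2 : ℝ≥0∞) ^ n * a = ENNReal.ofReal L := by
      rw [hL, ENNReal.ofReal_mul (by positivity), ENNReal.ofReal_pow (by norm_num), ha]; simp
    rw [e, Real.enorm_eq_ofReal_abs, ENNReal.ofReal_le_ofReal_iff hL0.le, abs_le] at hy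
    simp only [hh]
    rw [min_eq_left hy.2, max_eq_left hy.1]
  have hhi : Integrable h := hGi.congr hhG.symm
  set b : Rn n → ℝ := fun y => g y - G y with hb
  have hbm : Measurable b := hg.sub hGm
  have hbi : Integrable b := hgi.sub hGi
  have hb1 : ∫⁻ y, ‖b y‖ₑ ≤ 2 * ∫⁻ y, ‖g y‖ₑ := by
    calc _ ≤ ∫⁻ y, (‖g y‖ₑ + ‖G y‖ₑ) := lintegral_mono fun y => enorm_sub_le
      _ = (∫⁻ y, ‖g y‖ₑ) + ∫⁻ y, ‖G y‖ₑ := lintegral_add_left hg.enorm _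
      _ ≤ (∫⁻ y, ‖g y‖ₑ) + ∫⁻ y, ‖g y‖ₑ :=
          add_le_add le_rfl (lintegral_goodPart_le a)
      _ = _ := by ring
  have hsum : ∀ x, varHeat n ϱ g x ≤ varHeat n ϱ h x + varHeat n ϱ b x := by
    intro x
    have e : g =ᵐ[volume] fun y => h y + b y := by
      filter_upwards [hhG] with y hy
      rw [hy]; simp [hb]
    rw [varHeat_congr_ae e]
    exact varHeat_add_le h1ϱ hhi hbi x
  set W : Rn n → ℝ≥0∞ := fun x => ∑' q : {q // MaxD (Bad (kap g) a) q},
    shellW K q.1 x * ∫⁻ y in dq q.1, ‖b y‖ₑ with hW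
  have hWm : Measurable W :=
    Measurable.tsum fun q => (measurable_shellW K q.1).mul_const _
  have hWi : ∫⁻ x, W x ≤ K * (6 ^ n * 2) * (2 * ∫⁻ y, ‖g y‖ₑ) := by
    rw [hW, lintegral_tsum_shellW]
    gcongr
    exact (setLIntegral_le_lintegral _ _).trans hb1
  set U := ⋃ q : {q // MaxD (Bad (kap g) a) q}, tq q.1 with hU
  have hsub : {x | α < varHeat n ϱ g x} ⊆
      {x | a ≤ varHeat n ϱ h x} ∪ (U ∪ {x | a ≤ W x}) := by
    intro x hx
    by_contra hc
    simp only [mem_union, mem_ofPred_eq, not_or, not_le] at hc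
    have hVb : varHeat n ϱ b x ≤ W x := by
      refine hbad ϱ h1ϱ _ b hbm hbi (fun y hy => ?_) (fun q hq => ?_) x fun q hq hxq =>
        hc.2.1 (mem_iUnion.2 ⟨⟨q, hq⟩, hxq⟩)
      · simp only [hb, hG]
        rw [goodPart, glue_of_notMem _ _ hy, sub_self]
      · exact setIntegral_sub_goodPart hg hgi hq
    have : α < α := calc
      α < varHeat n ϱ g x := hx
      _ ≤ varHeat n ϱ h x + varHeat n ϱ b x := hsum x
      _ ≤ a + a := add_le_add hc.1.le (hVb.trans hc.2.2.le)
      _ = α := by rw [hαa, two_mul]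
    exact lt_irrefl _ this
  have hp1 := mul_volume_varHeat_le_of_bounded hϱ hlpos hhm hhM hhi
  have hp1' : ∫⁻ x, ‖h x‖ₑ ≤ ∫⁻ x, ‖g x‖ₑ := by
    rw [lintegral_congr_ae (hhG.mono fun y hy => by simp only [hy] : _ =ᵐ[volume] fun y => ‖G y‖ₑ)]
    exact lintegral_goodPart_le a
  have hp2 : a * volume U ≤ 3 ^ n * ∫⁻ y, ‖g y‖ₑ := by
    rw [← kap_univ]; exact mul_volume_iUnion_tq_le
  have hp3 := (mul_meas_ge_le_lintegral₀ (hWm.aemeasurable (μ := volume)) a).trans hWi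
  calc α * volume {x | α < varHeat n ϱ g x}
      ≤ 2 * a * (volume {x | a ≤ varHeat n ϱ h x} + (volume U + volume {x | a ≤ W x})) := by
        rw [hαa.symm]
        gcongr
        exact (measure_mono hsub).trans ((measure_union_le _ _).trans
          (by gcongr; exact measure_union_le _ _))
    _ = 2 * (a * volume {x | a ≤ varHeat n ϱ h x} +
          (a * volume U + a * volume {x | a ≤ W x})) := by ring
    _ ≤ 2 * (A * (∫⁻ y, ‖g y‖ₑ) + (3 ^ n * (∫⁻ y, ‖g y‖ₑ)
          + K * (6 ^ n * 2) * (2 * ∫⁻ y, ‖g y‖ₑ))) := by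
        have hp1'' := hp1.trans (mul_le_mul_right hp1' _)
        gcongr
    _ = _ := by ring

lemma lintegral_shellW_le {κ : Measure (Rn n)} {α : ℝ≥0∞} {q : Idx n}
    (h : ∀ i : ℕ, κ (tq (anc i q)) ≤ α * volume (tq (anc i q))) (C : ℝ≥0∞) :
    ∫⁻ x, shellW C q x ∂κ ≤ C * (6 ^ n * 2) * (2 ^ n * α) := by
  rw [← lintegral_shellW]
  unfold shellW
  have hm : ∀ (m : Measure (Rn n)) (i : ℕ), AEMeasurable
      ((cube (cen q) (3 * 2 ^ (i + 1) * ell q)).indicator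
      (fun _ => C * ENNReal.ofReal (ell q / (2 ^ i * ell q) ^ (n + 1)))) m := fun m i =>
    (measurable_const.indicator (measurableSet_cube _ _)).aemeasurable
  rw [lintegral_tsum (hm _), lintegral_tsum (hm _), ← ENNReal.tsum_mul_right]
  refine ENNReal.tsum_le_tsum fun i => ?_
  rw [lintegral_indicator_const (measurableSet_cube _ _),
    lintegral_indicator_const (measurableSet_cube _ _), mul_assoc (C * _)]
  have hl := ell_pos q
  have hsub : cube (cen q) (3 * 2 ^ (i + 1) * ell q) ⊆ tq (anc (i + 2) q) := by
    have h1 := dq_subset_cube _ (dq_subset_anc (i + 2) q (cen_mem q))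
    refine cube_subset_cube fun a => (h1 a).trans ?_
    rw [ell_anc]
    have h3 : (0 : ℝ) < 2 ^ i := by positivity
    rw [pow_add, pow_add]
    nlinarith
  refine mul_le_mul le_rfl ((measure_mono hsub).trans ((h (i + 2)).trans (le_of_eq ?_)))
    zero_le zero_le
  rw [tq, volume_cube _ (by rw [ell_anc]; positivity), volume_cube _ (by positivity),
    ell_anc, show 3 * (2 ^ (i + 2) * ell q) = 2 * (3 * 2 ^ (i + 1) * ell q) by ring, mul_pow,
    ENNReal.ofReal_mul (by positivity), ENNReal.ofReal_pow (by norm_num), ENNReal.ofReal_ofNat]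
  ring

/-- The part of the variation near a cube coming from far away. -/
def farVar (n : ℕ) (ϱ : ℝ) (g : Rn n → ℝ) (q : Idx n) : ℝ≥0∞ :=
  varHeat n ϱ ((tq q)ᶜ.indicator g) (cen q)

lemma farVar_eq_zero {ϱ : ℝ} (hϱ : 0 < ϱ) {g : Rn n → ℝ} {q : Idx n}
    (h : ∀ y, y ∉ tq q → g y = 0) : farVar n ϱ g q = 0 := by
  have : (tq q)ᶜ.indicator g = fun _ => 0 := by
    ext y
    by_cases hy : y ∈ tq q
    · simp [hy]
    · simp [h y hy]
  rw [farVar, this, varHeat_zero hϱ]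

lemma exists_near_farVar (n : ℕ) : ∃ C : ℝ≥0∞, C ≠ ∞ ∧ ∀ (ϱ : ℝ), 1 ≤ ϱ →
    ∀ (g : Rn n → ℝ), Measurable g → Integrable g → ∀ (q : Idx n) (α : ℝ≥0∞),
    (∀ i : ℕ, kap g (tq (anc i q)) ≤ α * volume (tq (anc i q))) → ∀ x ∈ dq q,
    near (C * α) (varHeat n ϱ ((tq q)ᶜ.indicator g) x) (farVar n ϱ g q) := by
  obtain ⟨K, hK, hsh⟩ := exists_sum_hd_le_shellW n
  refine ⟨K * (6 ^ n * 2) * 2 ^ n, by finiteness, fun ϱ hϱ g hg hgi q α hα x hx => ?_⟩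
  set b := (tq q)ᶜ.indicator g with hb
  have hbm : Measurable b := hg.indicator (measurableSet_tq q).compl
  have hbi : Integrable b := hgi.indicator (measurableSet_tq q).compl
  have key : ∀ t : ℕ → ℝ, StrictAnti t → (∀ j, 0 < t j) → ∀ N,
      ∑ j ∈ Finset.range N, ‖heatInc n t b x j - heatInc n t b (cen q) j‖ₑ ≤
        K * (6 ^ n * 2) * 2 ^ n * α := by
    intro t ht h0 N
    have hm : ∀ j : ℕ, Measurable fun y : Rn n =>
        ‖hd n t j (y - x) - hd n t j (y - cen q)‖ₑ * ‖b y‖ₑ := fun j =>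
      ((((continuous_hd t j).comp (continuous_id.sub continuous_const)).sub
        ((continuous_hd t j).comp (continuous_id.sub continuous_const))).measurable).enorm.mul
          hbm.enorm
    calc _ ≤ ∑ j ∈ Finset.range N,
          ∫⁻ y, ‖hd n t j (y - x) - hd n t j (y - cen q)‖ₑ * ‖b y‖ₑ := by
          refine Finset.sum_le_sum fun j _ => ?_
          rw [heatInc_eq_integral h0 hbi, heatInc_eq_integral h0 hbi,
            ← integral_sub (integrable_hd_mul h0 hbi x j) (integrable_hd_mul h0 hbi _ j)]
          refine (enorm_integral_le_lintegral_enorm _).trans (le_of_eq ?_)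
          refine lintegral_congr fun y => ?_
          rw [← sub_mul, enorm_mul, ← hd_neg, ← hd_neg t j (cen q - y), neg_sub, neg_sub]
      _ = ∫⁻ y, (∑ j ∈ Finset.range N,
          ‖hd n t j (y - x) - hd n t j (y - cen q)‖ₑ) * ‖b y‖ₑ := by
          rw [← lintegral_finsetSum _ fun j _ => hm j]
          simp only [Finset.sum_mul]
      _ ≤ ∫⁻ y, shellW K q y * ‖g y‖ₑ := by
          refine lintegral_mono fun y => ?_
          by_cases hy : y ∈ tq q
          · simp [hb, hy]
          · rw [hb, indicator_of_mem (show y ∈ (tq q)ᶜ from hy)]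
            gcongr
            exact hsh t ht.antitone h0 N q y x hy hx
      _ = ∫⁻ y, shellW K q y ∂(kap g) := by
          rw [kap, lintegral_withDensity_eq_lintegral_mul _ hg.enorm (measurable_shellW K q)]
          simp only [Pi.mul_apply, mul_comm]
      _ ≤ _ := (lintegral_shellW_le hα K).trans (le_of_eq (by ring))
  constructor
  · refine varHeat_le_add hϱ fun t ht h0 N => ?_
    simpa only [Real.enorm_eq_ofReal_abs] using key t ht h0 N
  · refine varHeat_le_add hϱ fun t ht h0 N => ?_
    simpa only [Real.enorm_eq_ofReal_abs, abs_sub_comm] using key t ht h0 N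

/-- Mean oscillation of the variation on a cube, in terms of the averages over larger cubes. -/
lemma exists_osc (hn : 0 < n) {ϱ : ℝ} (hϱ : 2 < ϱ) {ε : ℝ≥0∞} (hε : ε ≠ 0) :
    ∃ B : ℝ≥0∞, B ≠ 0 ∧ B ≠ ∞ ∧ ∀ (g : Rn n → ℝ), Measurable g → Integrable g →
    ∀ (q : Idx n) (α : ℝ≥0∞), α ≠ 0 → α ≠ ∞ →
    (∀ i : ℕ, kap g (tq (anc i q)) ≤ α * volume (tq (anc i q))) →
    volume {x ∈ dq q | ¬ near (B * α) (varHeat n ϱ g x) (farVar n ϱ g q)} ≤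
      ε * volume (dq q) := by
  have h1ϱ : 1 ≤ ϱ := by linarith
  obtain ⟨C, hC, hfar⟩ := exists_near_farVar n
  obtain ⟨W, hW, hweak⟩ := exists_weak_type hn hϱ
  wlog hε1 : ε ≠ ∞ generalizing ε
  · obtain ⟨B, h0, h1, h2⟩ := this (ε := 1) one_ne_zero one_ne_top
    refine ⟨B, h0, h1, fun g hg hgi q α hα0 hα hq => (h2 g hg hgi q α hα0 hα hq).trans ?_⟩
    rw [not_ne_iff.1 hε1]
    gcongr
    exact le_top
  set A : ℝ≥0∞ := 2 * W * 3 ^ n / ε + 1 with hA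
  have hA1 : A ≠ ∞ := by
    have : 2 * W * 3 ^ n / ε ≠ ∞ := ENNReal.div_ne_top (by finiteness) hε
    finiteness
  have hA0 : A ≠ 0 := by simp [hA]
  have hAε : 2 * W * 3 ^ n ≤ ε * A := by
    calc 2 * W * 3 ^ n = ε * (2 * W * 3 ^ n / ε) := (ENNReal.mul_div_cancel hε hε1).symm
      _ ≤ _ := by gcongr; exact le_self_add
  refine ⟨C + A, by simp [hA0], by finiteness, fun g hg hgi q α hα0 hα hq => ?_⟩
  set a := (tq q).indicator g with ha
  set b := (tq q)ᶜ.indicator g with hb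
  have ham : Measurable a := hg.indicator (measurableSet_tq q)
  have hai : Integrable a := hgi.indicator (measurableSet_tq q)
  have hbi : Integrable b := hgi.indicator (measurableSet_tq q).compl
  have hab : ∀ y, a y + b y = g y := fun y => by
    simp only [ha, hb]
    exact congrFun (indicator_self_add_compl (tq q) g) y
  have h1 : ∀ x, varHeat n ϱ g x ≤ varHeat n ϱ a x + varHeat n ϱ b x := fun x => by
    have := varHeat_add_le h1ϱ hai hbi x
    simpa only [hab] using this
  have h2 : ∀ x, varHeat n ϱ b x ≤ varHeat n ϱ g x + varHeat n ϱ (fun y => -a y) x := fun x => by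
    have := varHeat_add_le h1ϱ hgi hai.neg x
    have e : (fun y => g y + (-a) y) = b := by
      ext y; rw [← hab, Pi.neg_apply]; ring
    rwa [e] at this
  have hnorm : ∫⁻ y, ‖a y‖ₑ ≤ α * (3 ^ n * volume (dq q)) := by
    have e : ∫⁻ y, ‖a y‖ₑ = kap g (tq q) := by
      rw [kap_apply g (measurableSet_tq q), ← lintegral_indicator (measurableSet_tq q)]
      refine lintegral_congr fun y => ?_
      by_cases hy : y ∈ tq q <;> simp [ha, hy]
    rw [e, ← volume_tq]
    simpa using hq 0
  have hw1 := hweak a ham hai (A * α) (by finiteness)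
  have hw2 := hweak (fun y => -a y) ham.neg hai.neg (A * α) (by finiteness)
  simp only [enorm_neg] at hw2
  have hsub : {x ∈ dq q | ¬ near ((C + A) * α) (varHeat n ϱ g x) (farVar n ϱ g q)} ⊆
      {x | A * α < varHeat n ϱ a x} ∪ {x | A * α < varHeat n ϱ (fun y => -a y) x} := by
    rintro x ⟨hxq, hx⟩
    by_contra hc
    simp only [mem_union, mem_ofPred_eq, not_or, not_lt] at hc
    refine hx ?_
    have hn1 : near (A * α) (varHeat n ϱ g x) (varHeat n ϱ b x) := by
      constructor
      · rw [add_comm]; exact (h1 x).trans (by gcongr; exact hc.1)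
      · exact (h2 x).trans (by gcongr; exact hc.2)
    refine (hn1.trans (hfar ϱ h1ϱ g hg hgi q α hq x hxq)).mono (le_of_eq (by ring))
  have hAα : A * α ≠ 0 := mul_ne_zero hA0 hα0
  refine (ENNReal.mul_le_mul_iff_right hAα (by finiteness)).1 ?_
  calc A * α * volume {x ∈ dq q | ¬ near ((C + A) * α) (varHeat n ϱ g x) (farVar n ϱ g q)}
      ≤ A * α * (volume {x | A * α < varHeat n ϱ a x}
          + volume {x | A * α < varHeat n ϱ (fun y => -a y) x}) := by
        gcongr
        exact (measure_mono hsub).trans (measure_union_le _ _)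
    _ ≤ W * (α * (3 ^ n * volume (dq q))) + W * (α * (3 ^ n * volume (dq q))) := by
        rw [mul_add]
        exact add_le_add (hw1.trans (by gcongr)) (hw2.trans (by gcongr))
    _ = (2 * W * 3 ^ n) * (α * volume (dq q)) := by ring
    _ ≤ ε * A * (α * volume (dq q)) := by gcongr
    _ = _ := by ring

lemma two_zpow_ne_zero (k : ℤ) : (2 : ℝ≥0∞) ^ k ≠ 0 :=
  (ENNReal.zpow_pos two_ne_zero ofNat_ne_top k).ne'

lemma two_zpow_ne_top (k : ℤ) : (2 : ℝ≥0∞) ^ k ≠ ∞ :=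
  ENNReal.zpow_ne_top two_ne_zero ofNat_ne_top k

lemma two_zpow_add (k m : ℤ) : (2 : ℝ≥0∞) ^ (k + m) = 2 ^ k * 2 ^ m :=
  ENNReal.zpow_add two_ne_zero ofNat_ne_top k m

lemma two_zpow_mono {k m : ℤ} (h : k ≤ m) : (2 : ℝ≥0∞) ^ k ≤ 2 ^ m :=
  ENNReal.zpow_le_of_le (by norm_num) h

/-- The enlarged cube has density larger than `2 ^ k`. -/
def TBad (κ : Measure (Rn n)) (k : ℤ) (q : Idx n) : Prop := 2 ^ k * volume (tq q) < κ (tq q)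

lemma TBad.anti {κ : Measure (Rn n)} {k m : ℤ} {q : Idx n} (h : TBad κ m q) (hkm : k ≤ m) :
    TBad κ k q := lt_of_le_of_lt (mul_le_mul_left (two_zpow_mono hkm) _) h

lemma TBad.exists_maxD (hn : 0 < n) {κ : Measure (Rn n)} (hκ : κ univ ≠ ∞) {k : ℤ} {q : Idx n}
    (h : TBad κ k q) : ∃ i, MaxD (TBad κ k) (anc i q) := by
  refine MixedWeak.exists_maxD h ?_
  obtain ⟨N, hN⟩ := exists_le_mul_volume_anc hn hκ (two_zpow_ne_zero k) q
  exact ⟨N, fun i hi hb => absurd hb (not_lt.2 ((measure_mono (subset_univ _)).trans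
    ((hN i hi).trans (by gcongr; exact dq_subset_tq _))))⟩

lemma volume_tq_anc (i : ℕ) (q : Idx n) :
    volume (tq (anc i q)) = 2 ^ (n * i) * volume (tq q) := by
  rw [volume_tq, volume_tq, volume_dq_anc]; ring

lemma le_of_not_tbad {κ : Measure (Rn n)} {k : ℤ} {q : Idx n} (h : ¬ TBad κ k q) :
    κ (tq q) ≤ 2 ^ k * volume (tq q) := not_lt.1 h

lemma maxD_tbad_measure_le {κ : Measure (Rn n)} {k : ℤ} {q : Idx n} (h : MaxD (TBad κ k) q)
    (i : ℕ) : κ (tq (anc i q)) ≤ 2 ^ n * 2 ^ k * volume (tq (anc i q)) := by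
  rcases Nat.eq_zero_or_pos i with rfl | hi
  · calc κ (tq (anc 0 q)) ≤ κ (tq (anc 1 q)) := by
          rw [anc_zero]; exact measure_mono (tq_subset_anc 1 q)
      _ ≤ 2 ^ k * volume (tq (anc 1 q)) := le_of_not_tbad (h.2 1 one_pos)
      _ = _ := by rw [volume_tq_anc, anc_zero]; ring
  · refine (le_of_not_tbad (h.2 i hi)).trans ?_
    gcongr
    exact le_mul_of_one_le_left' (one_le_pow₀ (by norm_num))

/-- On each principal cube of level `k`, the variation modified on the principal cubes of level
`k + 1` has exponentially small oscillation. -/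
lemma exists_principal_john_nirenberg (hn : 0 < n) {ϱ : ℝ} (hϱ : 2 < ϱ) :
    ∃ B : ℝ≥0∞, B ≠ ∞ ∧ ∀ (g : Rn n → ℝ), Measurable g → Integrable g →
    ∀ (k : ℤ) (s : ℕ) (q : Idx n), MaxD (TBad (kap g) k) q →
    volume {x ∈ dq q | ¬ near (B * 2 ^ k * s)
      (glue (TBad (kap g) (k + 1)) (varHeat n ϱ g) (farVar n ϱ g) x) (farVar n ϱ g q)} ≤
      (2 ^ s)⁻¹ * volume (dq q) := by
  classical
  have hε : ((2 : ℝ≥0∞) ^ (n + 4))⁻¹ ≠ 0 := ENNReal.inv_ne_zero.2 (by finiteness)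
  obtain ⟨B, hB0, hB, hosc⟩ := exists_osc hn hϱ hε
  refine ⟨8 * B * 2 ^ n, by finiteness, fun g hg hgi k s q hq => ?_⟩
  set κ := kap g with hκ
  have hκ1 : κ univ ≠ ∞ := by rw [hκ, kap_univ]; exact hgi.2.ne
  set T := TBad κ (k + 1) with hT
  set F := varHeat n ϱ g with hF
  set c := farVar n ϱ g with hc
  have hFm : Measurable F := measurable_varHeat (by linarith) hgi
  set α : ℝ≥0∞ := 2 ^ (k + 1) with hα
  have hα0 : α ≠ 0 := two_zpow_ne_zero _
  have hα1 : α ≠ ∞ := two_zpow_ne_top _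
  set α' : ℝ≥0∞ := 2 ^ n * α with hα'
  have hαα' : α ≤ α' := le_mul_of_one_le_left' (one_le_pow₀ (by norm_num))
  set ε : ℝ≥0∞ := (2 ^ (n + 4))⁻¹ with hεd
  have hε2 : ε ≤ 2⁻¹ := by
    rw [hεd]
    refine ENNReal.inv_le_inv.2 ?_
    calc (2 : ℝ≥0∞) = 2 ^ 1 := by norm_num
      _ ≤ _ := pow_le_pow_right₀ (by norm_num) (by omega)
  have hε3 : 2 * ε = (2 ^ (n + 3))⁻¹ := by
    rw [hεd, pow_succ, ENNReal.mul_inv (by simp) (by simp), mul_comm, mul_assoc,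
      ENNReal.inv_mul_cancel two_ne_zero ofNat_ne_top, mul_one]
  set c' : Idx n → ℝ≥0∞ := fun Q =>
    if ∃ q', MaxD T q' ∧ dq Q ⊆ dq q' then glue T F c (cen Q) else c Q with hc'
  have H : ∀ Q, volume {x ∈ dq Q | ¬ near (2 * (B * α')) (glue T F c x) (c' Q)} ≤
      (2 ^ (n + 3))⁻¹ * volume (dq Q) := by
    intro Q
    by_cases hQ : ∃ q', MaxD T q' ∧ dq Q ⊆ dq q'
    · have : {x ∈ dq Q | ¬ near (2 * (B * α')) (glue T F c x) (c' Q)} = ∅ := by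
        refine eq_empty_of_forall_notMem fun x hx => hx.2 ?_
        simp only [hc', if_pos hQ]
        obtain ⟨q', hq', hsub⟩ := hQ
        rw [glue_of_mem F c hq' (hsub hx.1), glue_of_mem F c hq' (hsub (cen_mem Q))]
        exact near_self _ _
      rw [this, measure_empty]
      exact zero_le
    · have hQ1 : ∀ i, κ (tq (anc i Q)) ≤ α * volume (tq (anc i Q)) := by
        intro i
        refine le_of_not_tbad fun hb => hQ ?_
        obtain ⟨i', hi'⟩ := hb.exists_maxD hn hκ1
        exact ⟨_, hi', (dq_subset_anc i Q).trans (dq_subset_anc i' _)⟩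
      have hcQ : c' Q = c Q := by simp only [hc', if_neg hQ]
      rw [hcQ]
      set E := {x ∈ dq Q | ¬ near (B * α) (F x) (c Q)} with hE
      have hEm : MeasurableSet E := (measurableSet_dq Q).inter (measurableSet_near hFm _ _).compl
      have hEQ : volume E ≤ ε * volume (dq Q) := hosc g hg hgi Q α hα0 hα1 hQ1
      have hI : ∀ q', MaxD T q' → ¬ near (2 * (B * α')) (c q') (c Q) → dq q' ⊆ dq Q →
          volume (dq q') ≤ 2 * volume (E ∩ dq q') := by
        intro q' hq' hnq hsub
        have h1 := hosc g hg hgi q' α' (mul_ne_zero (by positivity) hα0) (by finiteness)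
          fun i => maxD_tbad_measure_le hq' i
        have h2 : dq q' ⊆ {x ∈ dq q' | ¬ near (B * α') (F x) (c q')} ∪ (E ∩ dq q') := by
          intro x hx
          by_cases h3 : near (B * α') (F x) (c q')
          · refine Or.inr ⟨⟨hsub hx, fun h4 => hnq ?_⟩, hx⟩
            rw [two_mul]
            exact (h3.symm.trans h4).mono (by gcongr)
          · exact Or.inl ⟨hx, h3⟩
        have h3 : volume (dq q') ≤ 2⁻¹ * volume (dq q') + volume (E ∩ dq q') :=
          (measure_mono h2).trans ((measure_union_le _ _).trans
            (add_le_add (h1.trans (by gcongr)) le_rfl))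
        have h4 : 2⁻¹ * volume (dq q') ≤ volume (E ∩ dq q') := by
          have h5 : volume (dq q') = 2⁻¹ * volume (dq q') + 2⁻¹ * volume (dq q') := by
            rw [← add_mul, ENNReal.inv_two_add_inv_two, one_mul]
          have hfin : 2⁻¹ * volume (dq q') ≠ ∞ :=
            ENNReal.mul_ne_top (by norm_num) (volume_dq_ne_top q')
          nth_rewrite 1 [h5] at h3
          exact (ENNReal.add_le_add_iff_left hfin).1 h3
        calc volume (dq q') = 2 * (2⁻¹ * volume (dq q')) := by
              rw [← mul_assoc, ENNReal.mul_inv_cancel two_ne_zero ofNat_ne_top, one_mul]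
          _ ≤ _ := by gcongr
      set U := ⋃ q' : {q' // MaxD T q'}, dq q'.1 with hU
      have hUm : MeasurableSet U := MeasurableSet.iUnion fun q => measurableSet_dq _
      have hsub : {x ∈ dq Q | ¬ near (2 * (B * α')) (glue T F c x) (c Q)} ⊆
          (E \ U) ∪ ⋃ q' : {q' : {q' // MaxD T q'} //
            ¬ near (2 * (B * α')) (c q'.1) (c Q) ∧ dq q'.1 ⊆ dq Q}, dq q'.1.1 := by
        rintro x ⟨hxQ, hx⟩
        by_cases hxU : ∃ q', MaxD T q' ∧ x ∈ dq q'
        · obtain ⟨q', hq', hxq⟩ := hxU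
          rw [glue_of_mem F c hq' hxq] at hx
          refine Or.inr (mem_iUnion.2 ⟨⟨⟨q', hq'⟩, hx, ?_⟩, hxq⟩)
          rcases le_total q'.1 Q.1 with h | h
          · rw [eq_anc_of_mem hxq hxQ h]
            exact dq_subset_anc _ _
          · refine absurd ⟨q', hq', ?_⟩ hQ
            rw [eq_anc_of_mem hxQ hxq h]
            exact dq_subset_anc _ _
        · have hx' : ∀ q', MaxD T q' → x ∉ dq q' := fun q' h1 h2 => hxU ⟨q', h1, h2⟩
          rw [glue_of_notMem F c hx'] at hx
          refine Or.inl ⟨⟨hxQ, fun h => hx (h.mono ?_)⟩, ?_⟩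
          · calc B * α ≤ B * α' := by gcongr
              _ ≤ _ := le_mul_of_one_le_left' (by norm_num)
          · rw [hU, mem_iUnion]
            rintro ⟨q', h⟩
            exact hx' _ q'.2 h
      calc _ ≤ volume (E \ U) + ∑' q' : {q' : {q' // MaxD T q'} //
            ¬ near (2 * (B * α')) (c q'.1) (c Q) ∧ dq q'.1 ⊆ dq Q}, volume (dq q'.1.1) :=
            (measure_mono hsub).trans ((measure_union_le _ _).trans
              (add_le_add le_rfl (measure_iUnion_le _)))
        _ ≤ 2 * volume (E \ U) + ∑' q' : {q' : {q' // MaxD T q'} //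
            ¬ near (2 * (B * α')) (c q'.1) (c Q) ∧ dq q'.1 ⊆ dq Q},
              2 * volume (E ∩ dq q'.1.1) := by
            gcongr with q'
            · exact le_mul_of_one_le_left' (by norm_num)
            · exact hI _ q'.1.2 q'.2.1 q'.2.2
        _ ≤ 2 * volume (E \ U) + ∑' q' : {q' // MaxD T q'}, 2 * volume (E ∩ dq q'.1) := by
            gcongr
            exact ENNReal.tsum_comp_le_tsum_of_injective Subtype.val_injective
              (fun q' : {q' // MaxD T q'} => 2 * volume (E ∩ dq q'.1))
        _ = 2 * (volume (E \ U) + volume (E ∩ U)) := by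
            rw [ENNReal.tsum_mul_left, ← mul_add, hU, inter_iUnion,
              measure_iUnion _ fun q' => hEm.inter (measurableSet_dq _)]
            exact fun a b hab => (pairwise_disjoint_maxD T hab).mono inter_subset_right
              inter_subset_right
        _ = 2 * volume E := by rw [add_comm, measure_inter_add_sdiff E hUm]
        _ ≤ 2 * (ε * volume (dq Q)) := by gcongr
        _ = _ := by rw [← mul_assoc, hε3]
  have hJN := john_nirenberg hn (measurable_glue T hFm c) H s q
  have hcq : c' q = c q := by
    by_cases hQ : ∃ q', MaxD T q' ∧ dq q ⊆ dq q'
    · simp only [hc', if_pos hQ]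
      obtain ⟨q', hq', hsub⟩ := hQ
      have hmem := cen_mem q
      rw [glue_of_mem F c hq' (hsub hmem)]
      rcases le_total q.1 q'.1 with h | h
      · have e := eq_anc_of_mem hmem (hsub hmem) h
        rcases Nat.eq_zero_or_pos (q'.1 - q.1).toNat with h0 | h0
        · rw [e, h0, anc_zero]
        · exact absurd (e ▸ hq'.1.anti (by omega)) (hq.2 _ h0)
      · have e := eq_anc_of_mem (hsub hmem) hmem h
        rcases Nat.eq_zero_or_pos (q.1 - q'.1).toNat with h0 | h0
        · rw [e, h0, anc_zero]
        · exfalso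
          have h1 : volume (dq q) ≤ volume (dq q') := measure_mono hsub
          have h2 : volume (dq q) = 2 ^ (n * (q.1 - q'.1).toNat) * volume (dq q') := by
            conv_lhs => rw [e]
            rw [volume_dq_anc]
          have h3 : (2 : ℝ≥0∞) ^ (n * (q.1 - q'.1).toNat) * volume (dq q')
              ≤ 1 * volume (dq q') := by rw [← h2, one_mul]; exact h1
          have h4 := (ENNReal.mul_le_mul_iff_left (volume_dq_ne_zero q')
            (volume_dq_ne_top q')).1 h3
          exact absurd h4 (not_le.2 (one_lt_pow₀ (by norm_num) (Nat.mul_pos hn h0).ne'))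
    · simp only [hc', if_neg hQ]
  rw [hcq] at hJN
  have e : 2 * (2 * (B * α')) * (s : ℝ≥0∞) = 8 * B * 2 ^ n * 2 ^ k * s := by
    rw [hα', hα, two_zpow_add, zpow_one]; ring
  rwa [e] at hJN

lemma sum_range_mul_inv_two_pow_le (J M : ℕ) :
    ∑ j ∈ Finset.range M, (2 : ℝ≥0∞)⁻¹ ^ j * ((j - J : ℕ) : ℝ≥0∞) ≤ 2 * 2⁻¹ ^ J := by
  have h1 : ∀ M : ℕ, ∑ i ∈ Finset.range M, (1 / 2 : ℝ) ^ i * i + (M + 1) * 2 * (1 / 2) ^ M = 2 := by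
    intro M
    induction M with
    | zero => simp
    | succ M ih => rw [Finset.sum_range_succ]; push_cast; rw [pow_succ]; linarith [ih]
  have h2 : ∑ i ∈ Finset.range M, (2 : ℝ≥0∞)⁻¹ ^ i * i ≤ 2 := by
    have e : ∀ i : ℕ, (2 : ℝ≥0∞)⁻¹ ^ i * i = ENNReal.ofReal ((1 / 2 : ℝ) ^ i * i) := by
      intro i
      rw [ENNReal.ofReal_mul (by positivity), ENNReal.ofReal_pow (by norm_num), one_div,
        ENNReal.ofReal_inv_of_pos two_pos, ENNReal.ofReal_ofNat, ENNReal.ofReal_natCast]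
    simp only [e]
    rw [← ENNReal.ofReal_sum_of_nonneg fun i _ => by positivity, ← ENNReal.ofReal_ofNat 2]
    refine ENNReal.ofReal_le_ofReal ?_
    have h3 : (0 : ℝ) ≤ (M + 1) * 2 * (1 / 2) ^ M := by positivity
    have := h1 M
    simp only [OfNat.ofNat] at *
    linarith
  calc _ ≤ ∑ j ∈ Finset.range (J + M), (2 : ℝ≥0∞)⁻¹ ^ j * ((j - J : ℕ) : ℝ≥0∞) :=
        Finset.sum_le_sum_of_subset (Finset.range_mono (by omega))
    _ = ∑ i ∈ Finset.range M, (2 : ℝ≥0∞)⁻¹ ^ (J + i) * (i : ℝ≥0∞) := by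
        rw [Finset.sum_range_add, Finset.sum_eq_zero, zero_add]
        · refine Finset.sum_congr rfl fun i _ => ?_
          rw [Nat.add_sub_cancel_left]
        · intro j hj
          rw [Nat.sub_eq_zero_of_le (Finset.mem_range.1 hj).le]; simp
    _ = (∑ i ∈ Finset.range M, (2 : ℝ≥0∞)⁻¹ ^ i * i) * 2⁻¹ ^ J := by
        rw [Finset.sum_mul]
        refine Finset.sum_congr rfl fun i _ => ?_
        ring
    _ ≤ _ := by gcongr

lemma exists_subset_tq_idx {S : Set (Rn n)} (hS : Bornology.IsBounded S) (x : Rn n) :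
    ∃ i₀ : ℕ, S ⊆ tq (idx i₀ x) := by
  obtain ⟨r, hr⟩ := hS.subset_closedBall x
  obtain ⟨i, hi⟩ := pow_unbounded_of_one_lt r (one_lt_two (α := ℝ))
  refine ⟨i, fun y hy a => ?_⟩
  have h1 : ‖y - x‖ ≤ r := by simpa [dist_eq_norm] using hr hy
  have h2 := abs_apply_le_norm (y - x) a
  have h3 := dq_subset_cube _ (mem_dq_idx i x) a
  have h4 : ell (idx (i : ℤ) x) = 2 ^ i := by simp [ell, idx_fst]
  rw [PiLp.sub_apply] at h2
  rw [h4] at h3 ⊢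
  have := abs_sub_le (y a) (x a) (cen (idx (i : ℤ) x) a)
  linarith

/-- Localization of the superlevel sets of the variation on exponentially small subsets of
principal cubes. -/
lemma exists_bad_sets (hn : 0 < n) {ϱ : ℝ} (hϱ : 2 < ϱ) (R : ℕ) :
    ∃ J : ℕ, ∀ g : Rn n → ℝ, Measurable g → Integrable g → HasCompactSupport g →
    kap g univ ≠ 0 → ∃ S : ℕ → ℤ → Idx n → Set (Rn n),
    (∀ j k q, MeasurableSet (S j k q) ∧ S j k q ⊆ dq q) ∧
    (∀ j k q, MaxD (TBad (kap g) k) q →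
      volume (S j k q) ≤ (2 ^ (R * (j - J)))⁻¹ * volume (dq q)) ∧
    ∀ (x : Rn n) (m : ℤ), 2 ^ m < varHeat n ϱ g x →
      ∃ (j : ℕ) (q : Idx n), MaxD (TBad (kap g) (m - j)) q ∧ x ∈ S j (m - j) q := by
  obtain ⟨B, hB, hJN⟩ := exists_principal_john_nirenberg hn hϱ
  obtain ⟨J, hJ⟩ := ENNReal.exists_nat_gt (show B * R * 2 ≠ ∞ by finiteness)
  have hJ' : B * R * (2 * 2⁻¹ ^ J) ≤ 1 := by
    rw [← mul_assoc, ← ENNReal.inv_pow, ← div_eq_mul_inv]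
    refine ENNReal.div_le_of_le_mul ?_
    rw [one_mul]
    refine hJ.le.trans ?_
    exact_mod_cast Nat.lt_two_pow_self.le
  refine ⟨J, fun g hg hgi hgc hκ0 => ?_⟩
  set κ := kap g with hκ
  have hκ1 : κ univ ≠ ∞ := by rw [hκ, kap_univ]; exact hgi.2.ne
  set F := varHeat n ϱ g with hF
  set c := farVar n ϱ g with hc
  have h0ϱ : 0 < ϱ := by linarith
  have hFm : Measurable F := measurable_varHeat h0ϱ hgi
  refine ⟨fun j k q => {x ∈ dq q | j = 0 ∨ ¬ near (B * 2 ^ k * (R * (j - J) : ℕ))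
    (glue (TBad κ (k + 1)) F c x) (c q)}, fun j k q => ⟨?_, sep_subset _ _⟩, ?_, ?_⟩
  · refine (measurableSet_dq q).inter ((MeasurableSet.const (j = 0)).union ?_)
    exact (measurableSet_near (measurable_glue _ hFm c) _ _).compl
  · intro j k q hq
    rcases Nat.eq_zero_or_pos j with rfl | hj
    · simp only [Nat.zero_sub, mul_zero, pow_zero, inv_one, one_mul]
      exact measure_mono (sep_subset _ _)
    · simp only [hj.ne', false_or]
      exact hJN g hg hgi k _ q hq
  intro x m hxm
  by_contra hcon
  push Not at hcon
  obtain ⟨i₀, hi₀⟩ := exists_subset_tq_idx hgc.isBounded x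
  have hsupp : ∀ y, y ∉ tq (idx i₀ x) → g y = 0 := fun y hy => by
    by_contra h
    exact hy (hi₀ (subset_tsupport g h))
  have hκtq : κ (tq (idx i₀ x)) = κ univ := by
    rw [hκ, kap_univ, kap_apply g (measurableSet_tq _), setLIntegral_eq_of_support_subset]
    intro y hy
    by_contra h
    exact hy (by simp [hsupp y h])
  have hbig : ∃ j₁ : ℕ, ∀ j ≥ j₁, TBad κ (m - j) (idx i₀ x) := by
    set V := volume (tq (idx (i₀ : ℤ) x)) with hV
    have hV' : V ≠ ∞ := volume_tq_ne_top _
    obtain ⟨j₁, hj₁⟩ := ENNReal.exists_nat_gt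
      (show 2 ^ m * V / κ univ ≠ ∞ from
        ENNReal.div_ne_top (ENNReal.mul_ne_top (two_zpow_ne_top m) hV') hκ0)
    refine ⟨j₁, fun j hj => ?_⟩
    rw [TBad, hκtq, sub_eq_add_neg, two_zpow_add, ENNReal.zpow_neg, zpow_natCast, mul_right_comm,
      ← div_eq_mul_inv]
    refine ENNReal.div_lt_of_lt_mul' ?_
    refine (ENNReal.div_lt_iff (Or.inl hκ0) (Or.inl hκ1)).1 (hj₁.trans_le ?_)
    exact_mod_cast hj.trans Nat.lt_two_pow_self.le
  obtain ⟨j₁, hj₁⟩ := hbig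
  have hfar : ∀ j ≥ j₁, ∃ q, MaxD (TBad κ (m - j)) q ∧ x ∈ dq q ∧ c q = 0 := by
    intro j hj
    obtain ⟨i, hi⟩ := (hj₁ j hj).exists_maxD hn hκ1
    refine ⟨_, hi, dq_subset_anc i _ (mem_dq_idx _ x), farVar_eq_zero h0ϱ fun y hy => ?_⟩
    exact hsupp y fun h => hy (tq_subset_anc i _ h)
  classical
  have hex : ∃ j : ℕ, ∃ q, MaxD (TBad κ (m - j)) q ∧ x ∈ dq q := by
    obtain ⟨q, h1, h2, -⟩ := hfar j₁ le_rfl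
    exact ⟨j₁, q, h1, h2⟩
  set j₀ := Nat.find hex with hj₀
  have hj₀s := Nat.find_spec hex
  have hj₀m : ∀ j < j₀, ∀ q, MaxD (TBad κ (m - j)) q → x ∉ dq q := fun j hj q h1 h2 =>
    Nat.find_min hex hj ⟨q, h1, h2⟩
  have hpos : j₀ ≠ 0 := by
    intro h0
    obtain ⟨q, h1, h2⟩ := hj₀s
    rw [← hj₀, h0] at h1
    exact hcon 0 q h1 ⟨h2, Or.inl rfl⟩
  have hstep : ∀ j : ℕ, j ≠ 0 → ∀ q, MaxD (TBad κ (m - j)) q → x ∈ dq q →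
      glue (TBad κ (m - j + 1)) F c x ≤ c q + B * 2 ^ (m - j) * (R * (j - J) : ℕ) := by
    intro j hj q h1 h2
    by_contra hlt
    exact hcon j q h1 ⟨h2, Or.inr fun h => hlt h.1⟩
  have hchain : ∀ j ≥ j₀, ∃ q, MaxD (TBad κ (m - j)) q ∧ x ∈ dq q ∧
      F x ≤ c q + ∑ i ∈ Finset.range (j + 1), B * 2 ^ (m - i) * (R * (i - J) : ℕ) := by
    intro j hj
    induction j, hj using Nat.le_induction with
    | base =>
      obtain ⟨q, h1, h2⟩ := hj₀s
      refine ⟨q, h1, h2, ?_⟩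
      have h3 := hstep j₀ hpos q h1 h2
      rw [glue_of_notMem] at h3
      · refine h3.trans ?_
        gcongr
        exact Finset.single_le_sum (f := fun i : ℕ => B * 2 ^ (m - i) * ((R * (i - J) : ℕ) : ℝ≥0∞))
          (fun _ _ => zero_le) (Finset.self_mem_range_succ j₀)
      · have e : m - (j₀ : ℤ) + 1 = m - ((j₀ - 1 : ℕ) : ℤ) := by
          push_cast [Nat.one_le_iff_ne_zero.2 hpos]; ring
        rw [e]
        exact hj₀m _ (by omega)
    | succ j hj ih =>
      obtain ⟨q', h1', h2', h3'⟩ := ih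
      have hb : TBad κ (m - (j + 1 : ℕ)) q' := h1'.1.anti (by push_cast; omega)
      obtain ⟨i, hi⟩ := hb.exists_maxD hn hκ1
      have hx := dq_subset_anc i _ h2'
      refine ⟨_, hi, hx, ?_⟩
      have h3 := hstep (j + 1) (by omega) _ hi hx
      rw [show m - ((j + 1 : ℕ) : ℤ) + 1 = m - j by push_cast; ring,
        glue_of_mem F c h1' h2'] at h3
      rw [Finset.sum_range_succ, ← add_assoc, add_right_comm]
      exact h3'.trans (by gcongr)
  set M := max j₀ j₁ with hM
  obtain ⟨q, h1, h2, h3⟩ := hchain M (le_max_left _ _)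
  obtain ⟨q', h1', h2', h3'⟩ := hfar M (le_max_right _ _)
  rw [h1.eq_of_mem h1' h2 h2', h3', zero_add] at h3
  have : (2 : ℝ≥0∞) ^ m < 2 ^ m := calc
    (2 : ℝ≥0∞) ^ m < F x := hxm
    _ ≤ _ := h3
    _ = 2 ^ m * (B * R * ∑ i ∈ Finset.range (M + 1),
        (2 : ℝ≥0∞)⁻¹ ^ i * ((i - J : ℕ) : ℝ≥0∞)) := by
        rw [Finset.mul_sum, Finset.mul_sum]
        refine Finset.sum_congr rfl fun i _ => ?_
        rw [sub_eq_add_neg, two_zpow_add, ENNReal.zpow_neg, zpow_natCast, ENNReal.inv_pow]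
        push_cast
        ring
    _ ≤ 2 ^ m * (B * R * (2 * 2⁻¹ ^ J)) := by
        gcongr
        exact sum_range_mul_inv_two_pow_le J _
    _ ≤ 2 ^ m * 1 := by gcongr
    _ = 2 ^ m := mul_one _
  exact lt_irrefl _ this

/-- The measure with density `w`. -/
def wm (w : Rn n → ℝ) : Measure (Rn n) := volume.withDensity fun x => ENNReal.ofReal (w x)

lemma wm_apply (w : Rn n → ℝ) {s : Set (Rn n)} (hs : MeasurableSet s) : wm w s = wMeas w s :=
  withDensity_apply _ hs

/-- Quantitative domination of Lebesgue measure by `W` on cubes, together with finiteness and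
positivity of `W` on cubes. -/
structure PowDom (W : Measure (Rn n)) (N : ℕ) (C : ℝ≥0∞) : Prop where
  ac : W ≪ volume
  ne_top : ∀ c r, W (cube c r) ≠ ∞
  ne_zero : ∀ c r, 0 < r → W (cube c r) ≠ 0
  le : ∀ c r, 0 < r → ∀ E, MeasurableSet E → E ⊆ cube c r →
    volume E ^ (N + 1) * W (cube c r) ≤ C * W E * volume (cube c r) ^ (N + 1)

lemma isBounded_cube (c : Rn n) (r : ℝ) : Bornology.IsBounded (cube c r) := by
  rw [isBounded_iff_forall_norm_le]
  refine ⟨‖c‖ + n * (|r| / 2 * 2), fun y hy => ?_⟩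
  have h1 : ‖y - c‖ ≤ n * (|r| / 2 * 2) := by
    rw [EuclideanSpace.norm_eq]
    have hn : (n : ℝ) ≤ n ^ 2 := by exact_mod_cast Nat.le_self_pow two_ne_zero n
    refine Real.sqrt_le_iff.2 ⟨by positivity, ?_⟩
    calc ∑ i, ‖(y - c) i‖ ^ 2 ≤ ∑ _i : Fin n, (|r| / 2 * 2) ^ 2 := by
          refine Finset.sum_le_sum fun i _ => ?_
          have h2 := hy i
          have h3 := le_abs_self r
          have : |(y - c) i| ≤ |r| / 2 * 2 := by
            rw [PiLp.sub_apply]; linarith [abs_nonneg r]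
          rw [Real.norm_eq_abs]
          gcongr
      _ = n * (|r| / 2 * 2) ^ 2 := by simp
      _ ≤ (n * (|r| / 2 * 2)) ^ 2 := by
          rw [mul_pow (n : ℝ)]; exact mul_le_mul_of_nonneg_right hn (sq_nonneg _)
  calc ‖y‖ = ‖(y - c) + c‖ := by rw [sub_add_cancel]
    _ ≤ _ := norm_add_le _ _
    _ ≤ _ := by linarith

lemma wm_cube_ne_top {w : Rn n → ℝ} (hw : IsWeight w) (c : Rn n) (r : ℝ) : wm w (cube c r) ≠ ∞ := by
  rw [wm_apply w (measurableSet_cube c r), wMeas]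
  have h1 : IntegrableOn w (cube c r) := by
    refine (hw.1.integrableOn_isCompact (isBounded_cube c r).isCompact_closure).mono_set
      subset_closure
  refine ne_top_of_le_ne_top h1.2.ne (lintegral_mono fun x => ?_)
  exact Real.ofReal_le_enorm _

lemma wm_ne_zero {w : Rn n → ℝ} (hw : IsWeight w) {s : Set (Rn n)} (hs : MeasurableSet s)
    (h0 : volume s ≠ 0) : wm w s ≠ 0 := by
  intro h
  have hm : AEMeasurable w := hw.1.aestronglyMeasurable.aemeasurable
  rw [wm_apply w hs, wMeas, lintegral_eq_zero_iff' hm.ennreal_ofReal.restrict] at h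
  apply h0
  have h2 := ae_restrict_of_ae (s := s) hw.2
  have h3 : ∀ᵐ x ∂(volume.restrict s), False := by
    filter_upwards [h, h2] with x h1 h2
    simp only [Pi.zero_apply, ENNReal.ofReal_eq_zero] at h1
    linarith
  have h4 : volume.restrict s = 0 := by
    simpa using h3
  simpa using h4

lemma volume_cube_ne_zero (c : Rn n) {r : ℝ} (hr : 0 < r) : volume (cube c r) ≠ 0 := by
  rw [volume_cube c hr.le]; simp; positivity

lemma volume_cube_ne_top (c : Rn n) {r : ℝ} (hr : 0 < r) : volume (cube c r) ≠ ∞ := by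
  rw [volume_cube c hr.le]; finiteness

lemma IsA1.average_le {w : Rn n → ℝ} {C : ℝ} (h : ∀ (c : Rn n) (r : ℝ), 0 < r →
    wMeas w (cube c r) ≤ ENNReal.ofReal C * ENNReal.ofReal (r ^ n) *
      essInf (fun x => ENNReal.ofReal (w x)) (volume.restrict (cube c r))) {c : Rn n} {r : ℝ}
    (hr : 0 < r) : ∀ᵐ x ∂volume.restrict (cube c r),
      wm w (cube c r) ≤ ENNReal.ofReal C * volume (cube c r) * ENNReal.ofReal (w x) := by
  have h1 := ae_essInf_le (f := fun x => ENNReal.ofReal (w x)) (μ := volume.restrict (cube c r))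
  filter_upwards [h1] with x hx
  rw [wm_apply w (measurableSet_cube c r), volume_cube c hr.le]
  exact (h c r hr).trans (by gcongr)

lemma IsA1.powDom {w : Rn n → ℝ} (hw : IsWeight w) (h : IsA1 w) :
    ∃ C : ℝ≥0∞, C ≠ ∞ ∧ PowDom (wm w) 1 C := by
  obtain ⟨C, -, hC⟩ := h
  refine ⟨ENNReal.ofReal C, by finiteness,
    withDensity_absolutelyContinuous _ _, wm_cube_ne_top hw,
    fun c r hr => wm_ne_zero hw (measurableSet_cube c r) (volume_cube_ne_zero c hr),
    fun c r hr E hE hEs => ?_⟩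
  have h1 := ae_restrict_of_ae_restrict_of_subset hEs (IsA1.average_le hC hr (c := c))
  have h2 : volume E * wm w (cube c r) ≤ ENNReal.ofReal C * volume (cube c r) * wm w E := by
    rw [wm_apply w hE, wMeas, ← lintegral_const_mul' _ _
      (ENNReal.mul_ne_top ofReal_ne_top (volume_cube_ne_top c hr)), mul_comm, ← setLIntegral_const]
    exact lintegral_mono_ae h1
  calc volume E ^ (1 + 1) * wm w (cube c r) = volume E * (volume E * wm w (cube c r)) := by ring
    _ ≤ volume (cube c r) * (ENNReal.ofReal C * volume (cube c r) * wm w E) := by gcongr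
    _ = _ := by ring

lemma IsAp.powDom {p : ℝ} (hp : 1 < p) {w : Rn n → ℝ} (hw : IsWeight w) (h : IsAp p w) :
    ∃ (N : ℕ) (C : ℝ≥0∞), 1 ≤ N ∧ C ≠ ∞ ∧ PowDom (wm w) N C := by
  obtain ⟨C, -, hC⟩ := h
  obtain ⟨N, hN⟩ := exists_nat_ge p
  have hN1 : 1 ≤ N := by
    have : (1 : ℝ) < N := hp.trans_le hN
    exact_mod_cast this.le
  refine ⟨N, ENNReal.ofReal C, hN1, by finiteness,
    withDensity_absolutelyContinuous _ _, wm_cube_ne_top hw,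
    fun c r hr => wm_ne_zero hw (measurableSet_cube c r) (volume_cube_ne_zero c hr),
    fun c r hr E hE hEs => ?_⟩
  have hp0 : 0 < p := by linarith
  have hpq : p.HolderConjugate (p / (p - 1)) := Real.HolderConjugate.conjExponent hp
  have hm : AEMeasurable w (volume.restrict E) :=
    hw.1.aestronglyMeasurable.aemeasurable.restrict
  have hhold : volume E ≤ wm w E ^ (1 / p) *
      (∫⁻ y in cube c r, ENNReal.ofReal (w y ^ (1 - p / (p - 1)))) ^ (1 / (p / (p - 1))) := by
    calc volume E = ∫⁻ y in E, ENNReal.ofReal (w y ^ (1 / p)) * ENNReal.ofReal (w y ^ (-(1 / p))) := by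
          rw [← setLIntegral_one]
          refine lintegral_congr_ae ?_
          filter_upwards [ae_restrict_of_ae hw.2] with y hy
          rw [← ENNReal.ofReal_mul (by positivity), ← Real.rpow_add hy, add_neg_cancel,
            Real.rpow_zero, ENNReal.ofReal_one]
      _ ≤ (∫⁻ y in E, ENNReal.ofReal (w y ^ (1 / p)) ^ p) ^ (1 / p) *
          (∫⁻ y in E, ENNReal.ofReal (w y ^ (-(1 / p))) ^ (p / (p - 1))) ^ (1 / (p / (p - 1))) :=
          ENNReal.lintegral_mul_le_Lp_mul_Lq _ hpq (by fun_prop) (by fun_prop)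
      _ = wm w E ^ (1 / p) * (∫⁻ y in E, ENNReal.ofReal (w y ^ (1 - p / (p - 1)))) ^
          (1 / (p / (p - 1))) := by
          rw [wm_apply w hE, wMeas]
          congr 2
          · refine lintegral_congr_ae ?_
            filter_upwards [ae_restrict_of_ae hw.2] with y hy
            rw [ENNReal.ofReal_rpow_of_pos (by positivity), ← Real.rpow_mul hy.le,
              one_div_mul_cancel hp0.ne', Real.rpow_one]
          · refine lintegral_congr_ae ?_
            filter_upwards [ae_restrict_of_ae hw.2] with y hy
            rw [ENNReal.ofReal_rpow_of_pos (by positivity), ← Real.rpow_mul hy.le]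
            congr 2
            have : p - 1 ≠ 0 := by linarith
            field_simp
            ring
      _ ≤ _ := by gcongr
  set K := ∫⁻ y in cube c r, ENNReal.ofReal (w y ^ (1 - p / (p - 1))) with hK
  have h2 : volume E ^ p ≤ wm w E * K ^ (p - 1) := by
    calc volume E ^ p ≤ (wm w E ^ (1 / p) * K ^ (1 / (p / (p - 1)))) ^ p := by gcongr
      _ = _ := by
        rw [ENNReal.mul_rpow_of_nonneg _ _ hp0.le, ← ENNReal.rpow_mul, ← ENNReal.rpow_mul,
          one_div_mul_cancel hp0.ne', ENNReal.rpow_one]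
        congr 2
        have : p - 1 ≠ 0 := by linarith
        field_simp
  set Q := volume (cube c r) with hQ
  have hN' : 0 ≤ (N : ℝ) + 1 - p := by linarith
  have h3 : ∀ a : ℝ≥0∞, a ^ (N + 1) = a ^ ((N : ℝ) + 1 - p) * a ^ p := by
    intro a
    rw [← ENNReal.rpow_add_of_nonneg _ _ hN' hp0.le, sub_add_cancel, ← ENNReal.rpow_natCast]
    push_cast
    rfl
  calc volume E ^ (N + 1) * wm w (cube c r)
      = volume E ^ ((N : ℝ) + 1 - p) * (volume E ^ p * wm w (cube c r)) := by rw [h3, mul_assoc]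
    _ ≤ Q ^ ((N : ℝ) + 1 - p) * (wm w E * K ^ (p - 1) * wm w (cube c r)) := by
        gcongr
        exact measure_mono hEs
    _ = Q ^ ((N : ℝ) + 1 - p) * (wm w E * (wm w (cube c r) * K ^ (p - 1))) := by ring
    _ ≤ Q ^ ((N : ℝ) + 1 - p) * (wm w E * (ENNReal.ofReal C * Q ^ p)) := by
        have := hC c r hr
        rw [← volume_cube c hr.le, ← wm_apply w (measurableSet_cube c r)] at this
        gcongr _ * (_ * ?_)
    _ = ENNReal.ofReal C * wm w E * Q ^ (N + 1) := by rw [h3]; ring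

lemma IsAinfty.powDom {w : Rn n → ℝ} (hw : IsWeight w) (h : IsAinfty w) :
    ∃ (N : ℕ) (C : ℝ≥0∞), 1 ≤ N ∧ C ≠ ∞ ∧ PowDom (wm w) N C := by
  rcases h with h | ⟨p, hp, h⟩
  · obtain ⟨C, hC, h⟩ := IsA1.powDom hw h
    exact ⟨1, C, le_rfl, hC, h⟩
  · exact IsAp.powDom hp hw h

namespace PowDom

variable {W : Measure (Rn n)} {N : ℕ} {C : ℝ≥0∞}

lemma tq_ne_top (h : PowDom W N C) (q : Idx n) : W (tq q) ≠ ∞ := h.ne_top _ _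

lemma dq_ne_top (h : PowDom W N C) (q : Idx n) : W (dq q) ≠ ∞ :=
  ne_top_of_le_ne_top (h.tq_ne_top q) (measure_mono (dq_subset_tq q))

lemma doubling (h : PowDom W N C) (q : Idx n) {c : Rn n} {a : ℝ} (ha : 0 < a)
    (hq : dq q ⊆ cube c (a * ell q)) :
    W (cube c (a * ell q)) ≤ C * ENNReal.ofReal (a ^ n) ^ (N + 1) * W (dq q) := by
  have h1 := h.le c _ (mul_pos ha (ell_pos q)) _ (measurableSet_dq q) hq
  rw [volume_cube_mul q c ha.le, mul_pow] at h1
  have h2 : volume (dq q) ^ (N + 1) * W (cube c (a * ell q)) ≤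
      volume (dq q) ^ (N + 1) * (C * ENNReal.ofReal (a ^ n) ^ (N + 1) * W (dq q)) :=
    h1.trans (le_of_eq (by ring))
  rwa [ENNReal.mul_le_mul_iff_right (pow_ne_zero _ (volume_dq_ne_zero q))
    (ENNReal.pow_ne_top (volume_dq_ne_top q))] at h2

lemma dq_ne_zero (h : PowDom W N C) (q : Idx n) : W (dq q) ≠ 0 := by
  intro h0
  have h1 := h.doubling q one_pos ((dq_subset_cube q).trans (cube_mono _ (by rw [one_mul])))
  rw [h0, mul_zero] at h1
  exact h.ne_zero _ _ (mul_pos one_pos (ell_pos q)) (le_antisymm h1 zero_le)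

lemma pow_mul_le (h : PowDom W N C) {q : Idx n} {E : Set (Rn n)} (hE : MeasurableSet E)
    (hEq : E ⊆ dq q) : volume E ^ (N + 1) * W (dq q) ≤ C * W E * volume (dq q) ^ (N + 1) := by
  have h1 := h.le _ _ (ell_pos q) E hE (hEq.trans (dq_subset_cube q))
  rw [volume_cube _ (ell_pos q).le, ← volume_dq] at h1
  refine le_trans ?_ h1
  gcongr
  exact dq_subset_cube q

lemma exists_half (h : PowDom W N C) (hC : C ≠ ∞) : ∃ θ : ℝ≥0∞, θ < 1 ∧ ∀ (q : Idx n)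
    (E : Set (Rn n)), MeasurableSet E → E ⊆ dq q → volume E ≤ 2⁻¹ * volume (dq q) →
    W E ≤ θ * W (dq q) := by
  set D : ℝ≥0∞ := C * 2 ^ (N + 1) + 1 with hD
  have hDt : D ≠ ∞ := by finiteness
  have hD0 : D ≠ 0 := by rw [hD]; simp
  refine ⟨1 - D⁻¹, ENNReal.sub_lt_self one_ne_top one_ne_zero (ENNReal.inv_ne_zero.2 hDt),
    fun q E hE hEq hv => ?_⟩
  have hadd : ∀ m : Measure (Rn n), m E + m (dq q \ E) = m (dq q) := fun m => by
    have h1 := measure_inter_add_sdiff (μ := m) (dq q) hE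
    rwa [inter_eq_self_of_subset_right hEq] at h1
  have hv' : 2⁻¹ * volume (dq q) ≤ volume (dq q \ E) := by
    by_contra hlt
    rw [not_le] at hlt
    have h1 := ENNReal.add_lt_add_of_le_of_lt
      (ne_top_of_le_ne_top (volume_dq_ne_top q) (measure_mono hEq)) hv hlt
    rw [hadd, ← add_mul, ENNReal.inv_two_add_inv_two, one_mul] at h1
    exact lt_irrefl _ h1
  have h1 := h.pow_mul_le ((measurableSet_dq q).diff hE) sdiff_subset
  have h2 : W (dq q) ≤ D * W (dq q \ E) := by
    have h3 : volume (dq q) ^ (N + 1) * (2⁻¹ ^ (N + 1) * W (dq q)) ≤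
        volume (dq q) ^ (N + 1) * (C * W (dq q \ E)) := calc
      _ = (2⁻¹ * volume (dq q)) ^ (N + 1) * W (dq q) := by ring
      _ ≤ volume (dq q \ E) ^ (N + 1) * W (dq q) := by gcongr
      _ ≤ _ := h1
      _ = _ := by ring
    rw [ENNReal.mul_le_mul_iff_right (pow_ne_zero _ (volume_dq_ne_zero q))
      (ENNReal.pow_ne_top (volume_dq_ne_top q))] at h3
    calc W (dq q) = 2 ^ (N + 1) * (2⁻¹ ^ (N + 1) * W (dq q)) := by
          rw [← mul_assoc, ← mul_pow, ENNReal.mul_inv_cancel two_ne_zero ofNat_ne_top, one_pow,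
            one_mul]
      _ ≤ 2 ^ (N + 1) * (C * W (dq q \ E)) := by gcongr
      _ = C * 2 ^ (N + 1) * W (dq q \ E) := by ring
      _ ≤ _ := by gcongr; exact le_self_add
  rw [ENNReal.sub_mul (fun _ _ => h.dq_ne_top q), one_mul]
  refine ENNReal.le_sub_of_add_le_right
    (ENNReal.mul_ne_top (ENNReal.inv_ne_top.2 hD0) (h.dq_ne_top q)) ?_
  rw [← hadd W]
  gcongr
  calc D⁻¹ * (W E + W (dq q \ E)) ≤ D⁻¹ * (D * W (dq q \ E)) := by rw [hadd W]; gcongr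
    _ = _ := by rw [← mul_assoc, ENNReal.inv_mul_cancel hD0 hDt, one_mul]

lemma exists_decay_aux (hn : 0 < n) (h : PowDom W N C) {θ : ℝ≥0∞} (hθ : ∀ (q : Idx n)
    (E : Set (Rn n)), MeasurableSet E → E ⊆ dq q → volume E ≤ 2⁻¹ * volume (dq q) →
    W E ≤ θ * W (dq q)) (s : ℕ) : ∀ (q : Idx n) (E : Set (Rn n)), MeasurableSet E → E ⊆ dq q →
    volume E ≤ (2 ^ ((n + 1) * s))⁻¹ * volume (dq q) → W E ≤ θ ^ s * W (dq q) := by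
  induction s with
  | zero =>
    intro q E hE hEq hv
    rw [pow_zero, one_mul]; exact measure_mono hEq
  | succ s ih =>
    intro Q E hE hEQ hv
    set α : ℝ≥0∞ := (2 ^ ((n + 1) * s + n))⁻¹ with hα
    have hα0 : α ≠ 0 := by rw [hα]; simp
    have hα1 : α < 1 := by
      rw [hα, ENNReal.inv_lt_one]
      exact one_lt_pow₀ (by norm_num) (by omega)
    have hvα : volume E ≤ α * 2⁻¹ * volume (dq Q) := by
      refine hv.trans (le_of_eq ?_)
      rw [hα, ← ENNReal.mul_inv (by simp) (by simp), ← pow_succ]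
      congr 3
    obtain ⟨B, h1, h2, h3, h4⟩ := exists_cz_set hn hE hEQ hα0 hα1 (hvα.trans (by
      gcongr
      calc α * 2⁻¹ ≤ α * 1 := by gcongr; simp
        _ = α := mul_one _))
    set U := ⋃ q : {q // MaxD B q}, dq q.1 with hU
    have hUm : MeasurableSet U := MeasurableSet.iUnion fun q => measurableSet_dq _
    have hd := pairwise_disjoint_maxD B
    have hUv : volume U ≤ 2⁻¹ * volume (dq Q) := by
      rw [hU, measure_iUnion hd fun q => measurableSet_dq _]
      rw [← ENNReal.mul_le_mul_iff_right hα0 hα1.ne_top, ← mul_assoc]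
      exact h3.trans hvα
    have hUs : U ⊆ dq Q := iUnion_subset fun q => h4 _ q.2
    have hEU : W E ≤ ∑' q : {q // MaxD B q}, W (E ∩ dq q.1) := by
      calc W E ≤ W (E ∩ U) + W (E \ U) := measure_le_inter_add_sdiff _ _ _
        _ = W (⋃ q : {q // MaxD B q}, E ∩ dq q.1) := by rw [h.ac h1, add_zero, hU, inter_iUnion]
        _ ≤ _ := measure_iUnion_le _
    calc W E ≤ ∑' q : {q // MaxD B q}, W (E ∩ dq q.1) := hEU
      _ ≤ ∑' q : {q // MaxD B q}, θ ^ s * W (dq q.1) := by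
          refine ENNReal.tsum_le_tsum fun q => ih _ _ (hE.inter (measurableSet_dq _))
            inter_subset_right ((h2 _ q.2).trans (le_of_eq ?_))
          congr 1
          rw [hα, pow_add, ENNReal.mul_inv (by simp) (by simp), mul_left_comm,
            ENNReal.mul_inv_cancel (by simp) (by finiteness), mul_one]
      _ = θ ^ s * W U := by
          rw [ENNReal.tsum_mul_left, hU, measure_iUnion hd fun q => measurableSet_dq _]
      _ ≤ θ ^ s * (θ * W (dq Q)) := by gcongr; exact hθ _ _ hUm hUs hUv
      _ = _ := by ring

lemma exists_decay (hn : 0 < n) (h : PowDom W N C) (hC : C ≠ ∞) : ∃ M : ℕ, 1 ≤ M ∧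
    ∀ (s : ℕ) (q : Idx n) (E : Set (Rn n)), MeasurableSet E → E ⊆ dq q →
    volume E ≤ (2 ^ (M * s))⁻¹ * volume (dq q) → W E ≤ (2 ^ s)⁻¹ * W (dq q) := by
  obtain ⟨θ, hθ1, hθ⟩ := h.exists_half hC
  obtain ⟨a, ha⟩ : ∃ a : ℕ, θ ^ a ≤ 2⁻¹ := by
    have := (ENNReal.tendsto_pow_atTop_nhds_zero_of_lt_one hθ1).eventually
      (ge_mem_nhds (show (0 : ℝ≥0∞) < 2⁻¹ by simp))
    exact this.exists
  have ha' : θ ^ (a + 1) ≤ 2⁻¹ := by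
    rw [pow_succ]
    exact (mul_le_of_le_one_right' hθ1.le).trans ha
  refine ⟨(n + 1) * (a + 1), by nlinarith, fun s q E hE hEq hv => ?_⟩
  have h1 := exists_decay_aux hn h hθ ((a + 1) * s) q E hE hEq (by rwa [← mul_assoc])
  refine h1.trans ?_
  gcongr
  rw [pow_mul, ENNReal.inv_pow]
  gcongr

end PowDom

lemma ell_le_ell {q q' : Idx n} (h : q'.1 ≤ q.1) : ell q' ≤ ell q :=
  zpow_le_zpow_right₀ one_le_two h

lemma tq_subset_of_inter {q q' : Idx n} (h : q'.1 ≤ q.1) (hne : (tq q' ∩ tq q).Nonempty) :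
    tq q' ⊆ cube (cen q) (9 * ell q) := by
  obtain ⟨x, hx', hx⟩ := hne
  refine cube_subset_cube fun i => ?_
  have h1 := hx i
  have h2 := hx' i
  have h3 := abs_sub_le (cen q' i) (x i) (cen q i)
  have h4 := ell_le_ell h
  rw [abs_sub_comm] at h2
  linarith

lemma cube_nine_subset_tq_anc (q : Idx n) : cube (cen q) (9 * ell q) ⊆ tq (anc 3 q) := by
  refine cube_subset_cube fun i => ?_
  have h1 := dq_subset_cube _ (dq_subset_anc 3 q (cen_mem q)) i
  have h2 := ell_anc 3 q
  have h3 := ell_pos q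
  norm_num at h2
  rw [h2] at h1 ⊢
  linarith

lemma dq_subset_cube_five {q q' : Idx n} (h : q'.1 = q.1) (hne : (tq q ∩ dq q').Nonempty) :
    dq q' ⊆ cube (cen q) (5 * ell q) := by
  obtain ⟨x, hx, hx'⟩ := hne
  intro y hy i
  have h1 := hx i
  have h2 := dq_subset_cube _ hx' i
  have h5 := dq_subset_cube _ hy i
  have h3 := abs_sub_le (cen q' i) (x i) (cen q i)
  have h6 := abs_sub_le (y i) (cen q' i) (cen q i)
  have h4 : ell q' = ell q := by unfold ell; rw [h]
  rw [abs_sub_comm] at h2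
  rw [h4] at h2 h5
  linarith

/-- Decay of a measure on small subsets of dyadic cubes. -/
def Decay (W : Measure (Rn n)) (M : ℕ) : Prop :=
  ∀ (s : ℕ) (q : Idx n) (E : Set (Rn n)), MeasurableSet E → E ⊆ dq q →
    volume E ≤ (2 ^ (M * s))⁻¹ * volume (dq q) → W E ≤ (2 ^ s)⁻¹ * W (dq q)

lemma Decay.tq {W : Measure (Rn n)} {M : ℕ} (h : Decay W M) (s : ℕ) (q : Idx n) {E : Set (Rn n)}
    (hE : MeasurableSet E) (hEq : E ⊆ tq q) (hv : volume E ≤ (2 ^ (M * s))⁻¹ * volume (dq q)) :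
    W E ≤ (2 ^ s)⁻¹ * W (cube (cen q) (5 * ell q)) := by
  set Q : (Fin n → ℤ) → Idx n := fun m => (q.1, m) with hQ
  have hQv : ∀ m, volume (dq (Q m)) = volume (dq q) := fun m => by
    rw [volume_dq, volume_dq]; rfl
  have hd : Pairwise (Function.onFun Disjoint fun m => dq (Q m) ∩ cube (cen q) (5 * ell q)) := by
    intro m m' hm
    refine Set.disjoint_left.2 fun x hx hx' => hm ?_
    have h1 := mem_dq_iff.1 hx.1
    have h2 := mem_dq_iff.1 hx'.1
    exact congrArg Prod.snd (h1.symm.trans h2)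
  calc W E ≤ W (⋃ m, E ∩ dq (Q m)) := by
        refine measure_mono fun x hx => mem_iUnion.2 ⟨_, hx, mem_dq_idx q.1 x⟩
    _ ≤ ∑' m, W (E ∩ dq (Q m)) := measure_iUnion_le _
    _ ≤ ∑' m, (2 ^ s)⁻¹ * W (dq (Q m) ∩ cube (cen q) (5 * ell q)) := by
        refine ENNReal.tsum_le_tsum fun m => ?_
        rcases (E ∩ dq (Q m)).eq_empty_or_nonempty with h0 | h0
        · rw [h0, measure_empty]; exact zero_le
        · rw [inter_eq_self_of_subset_left (dq_subset_cube_five (q := q) (q' := Q m) rfl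
            (h0.mono (inter_subset_inter_left _ hEq)))]
          refine h s _ _ (hE.inter (measurableSet_dq _)) inter_subset_right ?_
          rw [hQv]
          exact (measure_mono inter_subset_left).trans hv
    _ = (2 ^ s)⁻¹ * W (⋃ m, dq (Q m) ∩ cube (cen q) (5 * ell q)) := by
        rw [ENNReal.tsum_mul_left, measure_iUnion hd fun m =>
          (measurableSet_dq _).inter (measurableSet_cube _ _)]
    _ ≤ _ := by
        gcongr
        exact iUnion_subset fun m => inter_subset_right

lemma inv_two_pow_eq_zpow (e : ℕ) : ((2 : ℝ≥0∞) ^ e)⁻¹ = 2 ^ (-(e : ℤ)) := by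
  rw [ENNReal.zpow_neg, zpow_natCast]

lemma exists_le_two_pow {C : ℝ≥0∞} (hC : C ≠ ∞) : ∃ c : ℕ, C ≤ 2 ^ c := by
  obtain ⟨c, hc⟩ := ENNReal.exists_nat_gt hC
  exact ⟨c, hc.le.trans (by exact_mod_cast Nat.lt_two_pow_self.le)⟩

lemma PowDom.volume_level_le {W : Measure (Rn n)} {N : ℕ} {C : ℝ≥0∞} {c : ℕ}
    (h : PowDom W N C) (hN : 1 ≤ N) (hc : C ≤ 2 ^ c) {q : Idx n} {X : Set (Rn n)}
    (hX : MeasurableSet X) (hXq : X ⊆ dq q) {j l : ℤ} (hj1 : 2 ^ j * volume X ≤ W X)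
    (hj2 : W X ≤ 2 ^ (j + 1) * volume X) (hl1 : 2 ^ l * volume (dq q) ≤ W (dq q))
    (hl2 : W (dq q) ≤ 2 ^ (l + 1) * volume (dq q)) :
    volume X ≤ (2 ^ (((l - j).natAbs - (c + 1)) / N))⁻¹ * volume (dq q) := by
  set e := ((l - j).natAbs - (c + 1)) / N with he
  have heN : e * N ≤ (l - j).natAbs - (c + 1) := Nat.div_mul_le_self _ _
  have hee : e ≤ e * N := Nat.le_mul_of_pos_right _ hN
  rcases Nat.eq_zero_or_pos e with h0 | hpos
  · rw [h0, pow_zero, inv_one, one_mul]; exact measure_mono hXq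
  rw [inv_two_pow_eq_zpow]
  have hXt : volume X ≠ ∞ := ne_top_of_le_ne_top (volume_dq_ne_top q) (measure_mono hXq)
  rcases le_or_gt l j with hlj | hlj
  · have h1 : 2 ^ j * volume X ≤ 2 ^ (l + 1) * volume (dq q) :=
      hj1.trans ((measure_mono hXq).trans hl2)
    have h2 : 2 ^ j * volume X ≤ 2 ^ j * (2 ^ (-(e : ℤ)) * volume (dq q)) := by
      refine h1.trans ?_
      rw [← mul_assoc, ← two_zpow_add]
      refine mul_le_mul_left (two_zpow_mono ?_) _
      omega
    rwa [ENNReal.mul_le_mul_iff_right (two_zpow_ne_zero _) (two_zpow_ne_top _)] at h2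
  · rcases eq_or_ne (volume X) 0 with hX0 | hX0
    · rw [hX0]; exact zero_le
    have h1 := h.pow_mul_le hX hXq
    have h2 : (volume X * volume (dq q)) * (2 ^ l * volume X ^ N) ≤
        (volume X * volume (dq q)) * (2 ^ l * (2 ^ (-(e : ℤ)) * volume (dq q)) ^ N) := by
      calc _ = volume X ^ (N + 1) * (2 ^ l * volume (dq q)) := by ring
        _ ≤ volume X ^ (N + 1) * W (dq q) := by gcongr
        _ ≤ 2 ^ c * (2 ^ (j + 1) * volume X) * volume (dq q) ^ (N + 1) := by
            refine h1.trans ?_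
            gcongr
        _ = (volume X * volume (dq q)) * (2 ^ (c + (j + 1)) * volume (dq q) ^ N) := by
            rw [two_zpow_add (c : ℤ), zpow_natCast]; ring
        _ ≤ (volume X * volume (dq q)) * (2 ^ (l - (e * N : ℕ)) * volume (dq q) ^ N) := by
            refine mul_le_mul_right (mul_le_mul_left (two_zpow_mono ?_) _) _
            omega
        _ = _ := by
            rw [sub_eq_add_neg, two_zpow_add, mul_pow, mul_assoc (2 ^ l), ← inv_two_pow_eq_zpow,
              ← inv_two_pow_eq_zpow, pow_mul, ENNReal.inv_pow]
    rw [ENNReal.mul_le_mul_iff_right (mul_ne_zero hX0 (volume_dq_ne_zero q))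
      (ENNReal.mul_ne_top hXt (volume_dq_ne_top q)),
      ENNReal.mul_le_mul_iff_right (two_zpow_ne_zero _) (two_zpow_ne_top _)] at h2
    by_contra hlt
    rw [not_le] at hlt
    exact absurd h2 (not_le.2 (ENNReal.pow_lt_pow_left (by omega) hlt))

lemma tsum_inv_two_pow_div {D : ℕ} (hD : 1 ≤ D) :
    ∑' i : ℕ, ((2 : ℝ≥0∞) ^ (i / D))⁻¹ ≤ 2 * D := by
  have hi : Function.Injective fun i : ℕ => ((i / D, (⟨i % D, Nat.mod_lt _ hD⟩ : Fin D)) :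
      ℕ × Fin D) := by
    intro i i' h
    simp only [Prod.mk.injEq, Fin.mk.injEq] at h
    rw [← Nat.div_add_mod i D, h.1, h.2, Nat.div_add_mod]
  calc _ = ∑' i : ℕ, (fun p : ℕ × Fin D => ((2 : ℝ≥0∞) ^ p.1)⁻¹)
        ((i / D, (⟨i % D, Nat.mod_lt _ hD⟩ : Fin D))) := rfl
    _ ≤ ∑' p : ℕ × Fin D, ((2 : ℝ≥0∞) ^ p.1)⁻¹ := ENNReal.tsum_comp_le_tsum_of_injective hi _
    _ = 2 * D := by
        rw [ENNReal.tsum_prod']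
        simp only [tsum_fintype, Finset.sum_const, Finset.card_univ, Fintype.card_fin,
          nsmul_eq_mul, ENNReal.tsum_mul_left]
        simp only [ENNReal.inv_pow]
        rw [ENNReal.tsum_geometric, ENNReal.one_sub_inv_two, inv_inv, mul_comm]

lemma tsum_int_inv_two_pow_div {D : ℕ} (hD : 1 ≤ D) (k : ℤ) :
    ∑' l : ℤ, ((2 : ℝ≥0∞) ^ ((l - k).natAbs / D))⁻¹ ≤ 2 * (2 * D) := by
  have hi : Function.Injective fun l : ℤ => ((l.natAbs, decide (0 ≤ l)) : ℕ × Bool) := by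
    intro l l' h
    simp only [Prod.mk.injEq, decide_eq_decide] at h
    omega
  refine ((Equiv.subRight k).tsum_eq (fun l : ℤ => ((2 : ℝ≥0∞) ^ (l.natAbs / D))⁻¹)).trans_le ?_
  calc _ = ∑' l : ℤ, (fun p : ℕ × Bool => ((2 : ℝ≥0∞) ^ (p.1 / D))⁻¹)
        (l.natAbs, decide (0 ≤ l)) := rfl
    _ ≤ ∑' p : ℕ × Bool, ((2 : ℝ≥0∞) ^ (p.1 / D))⁻¹ :=
        ENNReal.tsum_comp_le_tsum_of_injective hi _
    _ = 2 * ∑' i : ℕ, ((2 : ℝ≥0∞) ^ (i / D))⁻¹ := by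
        rw [ENNReal.tsum_prod', ← ENNReal.tsum_mul_left]
        refine tsum_congr fun i => ?_
        simp [two_mul]
    _ ≤ _ := by gcongr; exact tsum_inv_two_pow_div hD

lemma inv_two_pow_sub_div_le (i c : ℕ) {D : ℕ} (hD : 1 ≤ D) :
    ((2 : ℝ≥0∞) ^ ((i - c) / D))⁻¹ ≤ 2 ^ c * (2 ^ (i / D))⁻¹ := by
  have h : i / D ≤ (i - c) / D + c := by
    calc i / D ≤ (i - c + D * c) / D := by
          refine Nat.div_le_div_right ?_
          have : c ≤ D * c := Nat.le_mul_of_pos_left _ hD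
          omega
      _ = _ := by rw [Nat.add_mul_div_left _ _ hD]
  rw [← div_eq_mul_inv, ENNReal.le_div_iff_mul_le (Or.inl (by simp)) (Or.inl (by finiteness)),
    mul_comm, ← div_eq_mul_inv]
  refine ENNReal.div_le_of_le_mul ?_
  rw [← pow_add]
  exact pow_le_pow_right₀ (by norm_num) (by omega)

lemma measure_iUnion_maxD {m : Measure (Rn n)} {B : Idx n → Prop} {S : Set (Idx n)}
    (hS : ∀ q ∈ S, MaxD B q) : m (⋃ q : S, dq q.1) = ∑' q : S, m (dq q.1) := by
  refine measure_iUnion (fun q q' hqq => ?_) fun q => measurableSet_dq _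
  refine Set.disjoint_left.2 fun x hx hx' => hqq (Subtype.ext ?_)
  exact (hS _ q.2).eq_of_mem (hS _ q'.2) hx hx'

lemma fst_le_of_ell_le {q q' : Idx n} (h : ell q' ≤ 3 / 2 * ell q) : q'.1 ≤ q.1 := by
  by_contra hlt
  have h1 : (2 : ℝ) ^ (q.1 + 1) ≤ 2 ^ q'.1 := zpow_le_zpow_right₀ one_le_two (by omega)
  have h2 := ell_pos q
  rw [zpow_add_one₀ two_ne_zero] at h1
  unfold ell at *
  linarith

lemma volume_iUnion_tbad_le {κ : Measure (Rn n)} {k j : ℤ} {S : Set (Idx n)} {T : Set (Rn n)}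
    (hS : ∀ q ∈ S, TBad κ k q) (hj : ∀ q ∈ S, q.1 ≤ j) (hT : ∀ q ∈ S, tq q ⊆ T) :
    2 ^ k * volume (⋃ q : S, dq q.1) ≤ 9 ^ n * κ T := by
  obtain ⟨u, hus, hud, hu⟩ := Vitali.exists_disjoint_subfamily_covering_enlargement
    (fun q : Idx n => tq q) S ell (3 / 2) (by norm_num) (fun q _ => (ell_pos q).le) (2 ^ j)
    (fun q hq => zpow_le_zpow_right₀ one_le_two (hj q hq))
    (fun q _ => ⟨_, dq_subset_tq q (cen_mem q)⟩)
  have hsub : (⋃ q : S, dq q.1) ⊆ ⋃ q : u, cube (cen q.1) (9 * ell q.1) := by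
    refine iUnion_subset fun q => ?_
    obtain ⟨b, hb, hne, hle⟩ := hu q.1 q.2
    exact (dq_subset_tq _).trans ((tq_subset_of_inter (fst_le_of_ell_le hle) hne).trans
      (subset_iUnion (fun q : u => cube (cen q.1) (9 * ell q.1)) ⟨b, hb⟩))
  calc _ ≤ 2 ^ k * ∑' q : u, volume (cube (cen q.1) (9 * ell q.1)) := by
        gcongr
        exact (measure_mono hsub).trans (measure_iUnion_le _)
    _ = 9 ^ n * ∑' q : u, 2 ^ k * volume (dq q.1) := by
        rw [← ENNReal.tsum_mul_left, ← ENNReal.tsum_mul_left]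
        refine tsum_congr fun q => ?_
        rw [volume_cube_mul _ _ (by norm_num), ENNReal.ofReal_pow (by norm_num),
          show ENNReal.ofReal 9 = 9 by norm_num]
        ring
    _ ≤ 9 ^ n * ∑' q : u, κ (tq q.1) := by
        gcongr with q
        refine le_trans ?_ (hS _ (hus q.2)).le
        gcongr
        exact dq_subset_tq _
    _ = 9 ^ n * κ (⋃ q : u, tq q.1) := by
        rw [measure_iUnion (fun (q q' : u) hqq => hud q.2 q'.2 fun h => hqq (Subtype.ext h))
          fun q : u => measurableSet_tq q.1]
    _ ≤ _ := by
        gcongr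
        exact iUnion_subset fun q => hT _ (hus q.2)

/-- Pairs of a level `k` and a principal cube of level `k` on which the average of `W` is
comparable to `2 ^ (k + l)`. -/
def lev (κ W : Measure (Rn n)) (l : ℤ) : Set (ℤ × Idx n) :=
  {p | MaxD (TBad κ p.1) p.2 ∧ 2 ^ (p.1 + l) * volume (dq p.2) ≤ W (dq p.2) ∧
    W (dq p.2) ≤ 2 ^ (p.1 + l + 1) * volume (dq p.2)}

/-- The principal cubes of level `k'` in `lev κ W l` that are close to `q` and not larger. -/
def nbr (κ W : Measure (Rn n)) (l : ℤ) (q : Idx n) (k' : ℤ) : Set (Idx n) :=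
  {q' | (k', q') ∈ lev κ W l ∧ q'.1 ≤ q.1 ∧ (tq q' ∩ tq q).Nonempty}

lemma nbr_subset {κ W : Measure (Rn n)} {l k' : ℤ} {q q' : Idx n} (h : q' ∈ nbr κ W l q k') :
    tq q' ⊆ tq (anc 3 q) :=
  (tq_subset_of_inter h.2.1 h.2.2).trans (cube_nine_subset_tq_anc q)

lemma tsum_nbr_le_of_lt {κ W : Measure (Rn n)} {l k k' : ℤ} {q : Idx n}
    (hq : (k, q) ∈ lev κ W l) (hk : k' < k) :
    ∑' q' : nbr κ W l q k', W (dq q'.1) ≤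
      2 * (2 ^ (n * 3) * 3 ^ n) * (2 ^ (k' - k).natAbs)⁻¹ * W (dq q) := by
  calc _ ≤ ∑' q' : nbr κ W l q k', 2 ^ (k' + l + 1) * volume (dq q'.1) :=
        ENNReal.tsum_le_tsum fun q' => q'.2.1.2.2
    _ = 2 ^ (k' + l + 1) * volume (⋃ q' : nbr κ W l q k', dq q'.1) := by
        rw [ENNReal.tsum_mul_left, measure_iUnion_maxD (B := TBad κ k') fun q' hq' => hq'.1.1]
    _ ≤ 2 ^ (k' + l + 1) * volume (tq (anc 3 q)) := by
        gcongr
        exact iUnion_subset fun q' => (dq_subset_tq _).trans (nbr_subset q'.2)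
    _ = 2 * (2 ^ (n * 3) * 3 ^ n) * (2 ^ (k' - k).natAbs)⁻¹ * (2 ^ (k + l) * volume (dq q)) := by
        have e : k' + l + 1 = 1 + -((k' - k).natAbs : ℤ) + (k + l) := by omega
        rw [volume_tq_anc, volume_tq, e, two_zpow_add, two_zpow_add (1 : ℤ), zpow_one,
          inv_two_pow_eq_zpow]
        ring
    _ ≤ _ := by gcongr; exact hq.2.1

lemma PowDom.tsum_nbr_le_of_ge {κ W : Measure (Rn n)} {N M : ℕ} {C : ℝ≥0∞} (hW : PowDom W N C)
    (hM : 1 ≤ M) (hd : Decay W M) {l k k' : ℤ} {q : Idx n}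
    (hq : (k, q) ∈ lev κ W l) (hk : k ≤ k') :
    ∑' q' : nbr κ W l q k', W (dq q'.1) ≤
      2 ^ (6 * n) * (C * ENNReal.ofReal (40 ^ n) ^ (N + 1)) * (2 ^ ((k' - k).natAbs / M))⁻¹ *
        W (dq q) := by
  rw [← measure_iUnion_maxD (B := TBad κ k') fun q' hq' => hq'.1.1]
  set U := ⋃ q' : nbr κ W l q k', dq q'.1 with hU
  set Q := anc 3 q with hQ
  set i := (k' - k).natAbs with hi
  have hUm : MeasurableSet U := MeasurableSet.iUnion fun q => measurableSet_dq _
  have hUt : U ⊆ tq Q := iUnion_subset fun q' => (dq_subset_tq _).trans (nbr_subset q'.2)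
  have hvU : 2 ^ k' * volume U ≤ 9 ^ n * κ (tq Q) :=
    volume_iUnion_tbad_le (fun q' hq' => hq'.1.1.1) (fun q' hq' => hq'.2.1)
      fun q' hq' => nbr_subset hq'
  have hvU' : volume U ≤ 2 ^ (6 * n - i : ℤ) * volume (dq Q) := by
    have h1 : 2 ^ k' * volume U ≤ 2 ^ k' * (2 ^ (6 * n - i : ℤ) * volume (dq Q)) := calc
      _ ≤ 9 ^ n * (2 ^ n * 2 ^ k * (3 ^ n * volume (dq Q))) := by
          refine hvU.trans ?_
          rw [← volume_tq]
          gcongr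
          exact maxD_tbad_measure_le hq.1 3
      _ = 54 ^ n * 2 ^ k * volume (dq Q) := by
          rw [show (54 : ℝ≥0∞) = 9 * 2 * 3 by norm_num, mul_pow, mul_pow]; ring
      _ ≤ (2 ^ 6) ^ n * 2 ^ k * volume (dq Q) := by gcongr; norm_num
      _ = _ := by
          rw [← pow_mul, ← mul_assoc, ← two_zpow_add, ← zpow_natCast, ← two_zpow_add]
          congr 2
          push_cast
          omega
    rwa [ENNReal.mul_le_mul_iff_right (two_zpow_ne_zero _) (two_zpow_ne_top _)] at h1
  have h5 : W U ≤ (2 ^ ((i - 6 * n) / M))⁻¹ * W (cube (cen Q) (5 * ell Q)) := by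
    rcases Nat.eq_zero_or_pos ((i - 6 * n) / M) with h0 | hpos
    · rw [h0, pow_zero, inv_one, one_mul]
      exact measure_mono (hUt.trans (cube_mono _ (by have := ell_pos Q; linarith)))
    · refine hd.tq _ _ hUm hUt (hvU'.trans ?_)
      rw [inv_two_pow_eq_zpow]
      refine mul_le_mul_left (two_zpow_mono ?_) _
      have h1 : M * ((i - 6 * n) / M) ≤ i - 6 * n := Nat.mul_div_le _ _
      have h2 : (i - 6 * n) / M ≤ i - 6 * n := Nat.div_le_self _ _
      omega
  have e8 : (5 : ℝ) * ell Q = 40 * ell q := by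
    rw [hQ, ell_anc]; ring
  have h6 : W (cube (cen Q) (5 * ell Q)) ≤ C * ENNReal.ofReal (40 ^ n) ^ (N + 1) * W (dq q) := by
    rw [e8]
    refine hW.doubling q (by norm_num) ?_
    rw [← e8]
    refine (dq_subset_anc 3 q).trans ((dq_subset_cube _).trans (cube_mono _ ?_))
    have := ell_pos Q
    linarith
  calc W U ≤ 2 ^ (6 * n) * (2 ^ (i / M))⁻¹ *
        (C * ENNReal.ofReal (40 ^ n) ^ (N + 1) * W (dq q)) := by
        refine h5.trans ?_
        gcongr
        exact inv_two_pow_sub_div_le _ _ hM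
    _ = _ := by ring

lemma PowDom.exists_carleson {W : Measure (Rn n)} {N M : ℕ} {C : ℝ≥0∞} (hW : PowDom W N C)
    (hC : C ≠ ∞) (hM : 1 ≤ M) (hd : Decay W M) : ∃ K : ℝ≥0∞, K ≠ ∞ ∧
    ∀ (κ : Measure (Rn n)) (l : ℤ) (p : ℤ × Idx n), p ∈ lev κ W l →
      ∑' k' : ℤ, ∑' q' : nbr κ W l p.2 k', W (dq q'.1) ≤ K * W (dq p.2) := by
  set A : ℝ≥0∞ := 2 * (2 ^ (n * 3) * 3 ^ n) + 2 ^ (6 * n) *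
    (C * ENNReal.ofReal (40 ^ n) ^ (N + 1)) with hA
  have hAt : A ≠ ∞ := by rw [hA]; finiteness
  refine ⟨A * (2 * (2 * M)), by finiteness, fun κ l p hp => ?_⟩
  calc _ ≤ ∑' k' : ℤ, A * (2 ^ ((k' - p.1).natAbs / M))⁻¹ * W (dq p.2) := by
        refine ENNReal.tsum_le_tsum fun k' => ?_
        rcases lt_or_ge k' p.1 with h | h
        · refine (tsum_nbr_le_of_lt hp h).trans ?_
          gcongr
          · exact le_self_add
          · norm_num
          · exact Nat.div_le_self _ _
        · refine (hW.tsum_nbr_le_of_ge hM hd hp h).trans ?_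
          gcongr
          exact le_add_self
    _ ≤ _ := by
        rw [ENNReal.tsum_mul_right, ENNReal.tsum_mul_left]
        gcongr
        exact tsum_int_inv_two_pow_div hM _

lemma tsum_two_zpow_le {A : ℤ → Set (Rn n)} {x : Rn n} {y : ℝ≥0∞} (hy : y ≠ ∞)
    (h : ∀ m, x ∈ A m → 2 ^ m ≤ y) :
    ∑' m : ℤ, (A m).indicator (fun _ => (2 : ℝ≥0∞) ^ m) x ≤ 2 * y := by
  rcases eq_or_ne y 0 with h0 | h0
  · have h1 : ∀ m, (A m).indicator (fun _ => (2 : ℝ≥0∞) ^ m) x = 0 := fun m => by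
      refine indicator_of_notMem (fun hx => ?_) _
      have := h m hx
      rw [h0, nonpos_iff_eq_zero] at this
      exact two_zpow_ne_zero m this
    simp [h1]
  obtain ⟨M, hM1, hM2⟩ := ENNReal.exists_mem_Ico_zpow h0 hy one_lt_two ofNat_ne_top
  have hi : Function.Injective fun i : ℕ => M - (i : ℤ) := fun i i' hii => by
    simp only at hii; omega
  rw [← hi.tsum_eq]
  · calc _ ≤ ∑' i : ℕ, 2 ^ M * (2 : ℝ≥0∞)⁻¹ ^ i := by
          refine ENNReal.tsum_le_tsum fun i => ?_
          refine (indicator_le_self' (fun _ _ => zero_le) x).trans (le_of_eq ?_)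
          rw [sub_eq_add_neg, two_zpow_add, ENNReal.zpow_neg, zpow_natCast, ENNReal.inv_pow]
      _ = 2 * 2 ^ M := by
          rw [ENNReal.tsum_mul_left, ENNReal.tsum_geometric, ENNReal.one_sub_inv_two, inv_inv,
            mul_comm]
      _ ≤ _ := by gcongr
  · intro m hm
    have hx : x ∈ A m := by
      by_contra hx
      exact hm (indicator_of_notMem hx _)
    have h2 : m < M + 1 := by
      by_contra hlt
      exact absurd ((h m hx).trans_lt hM2) (not_lt.2 (two_zpow_mono (by omega)))
    exact ⟨(M - m).toNat, by simp only; omega⟩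

lemma tsum_setOf_snd_mem {α β : Type*} (P : α → Set β) (f : β → ℝ≥0∞) :
    ∑' p : {p : α × β | p.2 ∈ P p.1}, f p.1.2 = ∑' a, ∑' b : P a, f b := by
  rw [tsum_subtype {p : α × β | p.2 ∈ P p.1} (fun p => f p.2), ENNReal.tsum_prod']
  refine tsum_congr fun a => ?_
  rw [tsum_subtype (P a) f]
  rfl

lemma exists_vitali (T : Finset (ℤ × Idx n)) : ∃ u ⊆ (T : Set (ℤ × Idx n)),
    u.PairwiseDisjoint (fun p => tq p.2) ∧ ∀ p ∈ T, ∃ b ∈ u,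
      (tq p.2 ∩ tq b.2).Nonempty ∧ ell p.2 ≤ 3 / 2 * ell b.2 := by
  obtain ⟨u, huT, hud, hu⟩ := Vitali.exists_disjoint_subfamily_covering_enlargement
    (fun p : ℤ × Idx n => tq p.2) (T : Set (ℤ × Idx n)) (fun p => ell p.2) (3 / 2) (by norm_num)
    (fun p _ => (ell_pos p.2).le) (∑ p ∈ T, ell p.2)
    (fun p hp => Finset.single_le_sum (f := fun p : ℤ × Idx n => ell p.2)
      (fun p _ => (ell_pos p.2).le) hp)
    (fun p _ => ⟨_, dq_subset_tq p.2 (cen_mem p.2)⟩)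
  exact ⟨u, huT, hud, hu⟩

lemma sum_lev_le {κ W : Measure (Rn n)} {l : ℤ} {K : ℝ≥0∞} (hK : ∀ p ∈ lev κ W l,
      ∑' k' : ℤ, ∑' q' : nbr κ W l p.2 k', W (dq q'.1) ≤ K * W (dq p.2))
    (T : Finset (ℤ × Idx n)) (hT : ∀ p ∈ T, p ∈ lev κ W l) :
    ∑ p ∈ T, 2 ^ p.1 * volume (dq p.2) ≤ 2 * K * κ (⋃ p ∈ T, tq p.2) := by
  obtain ⟨u, huT, hud, hu⟩ := exists_vitali T
  have hsub : (T : Set (ℤ × Idx n)) ⊆ ⋃ b : u,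
      {p : ℤ × Idx n | p.2 ∈ nbr κ W l b.1.2 p.1} := fun p hp => by
    obtain ⟨b, hb, hne, hle⟩ := hu p hp
    exact mem_iUnion.2 ⟨⟨b, hb⟩, hT p hp, fst_le_of_ell_le hle, hne⟩
  have h1 : ∑ p ∈ T, W (dq p.2) ≤ 2 ^ l * (2 * K * κ (⋃ p ∈ T, tq p.2)) := calc
    _ = ∑' p : (T : Set (ℤ × Idx n)), W (dq p.1.2) := by
        exact (Finset.tsum_subtype T fun p => W (dq p.2)).symm
    _ ≤ ∑' p : (⋃ b : u, {p : ℤ × Idx n | p.2 ∈ nbr κ W l b.1.2 p.1}), W (dq p.1.2) :=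
        ENNReal.tsum_mono_subtype (fun p => W (dq p.2)) hsub
    _ ≤ ∑' b : u, ∑' p : {p : ℤ × Idx n | p.2 ∈ nbr κ W l b.1.2 p.1}, W (dq p.1.2) :=
        ENNReal.tsum_iUnion_le_tsum (ι := u) (fun p : ℤ × Idx n => W (dq p.2))
          fun b => {p : ℤ × Idx n | p.2 ∈ nbr κ W l b.1.2 p.1}
    _ = ∑' b : u, ∑' k' : ℤ, ∑' q' : nbr κ W l b.1.2 k', W (dq q'.1) := by
        exact tsum_congr fun b => tsum_setOf_snd_mem (nbr κ W l b.1.2) fun q => W (dq q)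
    _ ≤ ∑' b : u, K * (2 ^ (b.1.1 + l + 1) * volume (dq b.1.2)) := by
        refine ENNReal.tsum_le_tsum fun b => (hK b.1 (hT _ (huT b.2))).trans ?_
        gcongr
        exact (hT _ (huT b.2)).2.2
    _ ≤ ∑' b : u, 2 ^ l * (2 * K) * κ (tq b.1.2) := by
        refine ENNReal.tsum_le_tsum fun b => ?_
        calc _ = 2 ^ l * (2 * K) * (2 ^ b.1.1 * volume (dq b.1.2)) := by
              rw [two_zpow_add, two_zpow_add, zpow_one]; ring
          _ ≤ 2 ^ l * (2 * K) * (2 ^ b.1.1 * volume (tq b.1.2)) := by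
              gcongr; exact dq_subset_tq _
          _ ≤ _ := by gcongr; exact (hT _ (huT b.2)).1.1.le
    _ = 2 ^ l * (2 * K) * κ (⋃ b : u, tq b.1.2) := by
        rw [ENNReal.tsum_mul_left,
          measure_iUnion (fun (q q' : u) hqq => hud q.2 q'.2 fun h => hqq (Subtype.ext h))
            fun q : u => measurableSet_tq q.1.2]
    _ ≤ 2 ^ l * (2 * K) * κ (⋃ p ∈ T, tq p.2) := by
        gcongr
        exact iUnion_subset fun b => subset_biUnion_of_mem (u := fun p : ℤ × Idx n => tq p.2)
          (huT b.2)
    _ = _ := by ring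
  have h2 : 2 ^ l * ∑ p ∈ T, 2 ^ p.1 * volume (dq p.2) ≤
      2 ^ l * (2 * K * κ (⋃ p ∈ T, tq p.2)) := by
    refine le_trans ?_ h1
    rw [Finset.mul_sum]
    refine Finset.sum_le_sum fun p hp => le_trans (le_of_eq ?_) (hT p hp).2.1
    rw [two_zpow_add]; ring
  rwa [ENNReal.mul_le_mul_iff_right (two_zpow_ne_zero _) (two_zpow_ne_top _)] at h2

lemma exists_level {W : Measure (Rn n)} {q : Idx n} (h0 : W (dq q) ≠ 0) (h1 : W (dq q) ≠ ∞) :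
    ∃ m : ℤ, 2 ^ m * volume (dq q) ≤ W (dq q) ∧ W (dq q) ≤ 2 ^ (m + 1) * volume (dq q) := by
  obtain ⟨m, hm1, hm2⟩ := ENNReal.exists_mem_Ico_zpow
    (ENNReal.div_ne_zero.2 ⟨h0, volume_dq_ne_top q⟩)
    (ENNReal.div_ne_top h1 (volume_dq_ne_zero q)) one_lt_two ofNat_ne_top
  refine ⟨m, ?_, ?_⟩
  · rwa [ENNReal.le_div_iff_mul_le (Or.inl (volume_dq_ne_zero q))
      (Or.inl (volume_dq_ne_top q))] at hm1
  · exact (ENNReal.div_le_iff (volume_dq_ne_zero q) (volume_dq_ne_top q)).1 hm2.le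

lemma tsum_lev_le {u : Rn n → ℝ} {U W : Measure (Rn n)} {C : ℝ≥0∞}
    (hC : C ≠ ∞)
    (hU0 : ∀ q, U (dq q) ≠ 0) (hU1 : ∀ q, U (dq q) ≠ ∞) (hU : ∀ q, ∀ᵐ x ∂volume.restrict (tq q),
      U (tq q) ≤ C * volume (tq q) * ENNReal.ofReal (u x))
    {g : Rn n → ℝ} (hg : Measurable g) {l : ℤ} {K : ℝ≥0∞} (hK : ∀ p ∈ lev (kap g) W l,
      ∑' k' : ℤ, ∑' q' : nbr (kap g) W l p.2 k', W (dq q'.1) ≤ K * W (dq p.2)) :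
    ∑' p : lev (kap g) W l, 2 ^ p.1.1 * U (dq p.1.2) ≤
      2 * (2 * K) * (2 * (C * 3 ^ n)) * ∫⁻ x, ‖g x‖ₑ * ENNReal.ofReal (u x) := by
  classical
  set κ := kap g with hκ
  have hm := fun q => exists_level (hU0 q) (hU1 q)
  choose m hm1 hm2 using hm
  rw [tsum_subtype (lev κ W l) (fun p => 2 ^ p.1 * U (dq p.2)), ENNReal.tsum_eq_iSup_sum]
  refine iSup_le fun F₀ => ?_
  set F := F₀.filter fun p => p ∈ lev κ W l with hF
  have hFl : ∀ p ∈ F, p ∈ lev κ W l := fun p hp => (Finset.mem_filter.1 hp).2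
  set A : ℤ → Set (Rn n) := fun i => ⋃ p ∈ F.filter (fun p => m p.2 = i), tq p.2 with hA
  have hAm : ∀ i, MeasurableSet (A i) := fun i =>
    Finset.measurableSet_biUnion _ fun p _ => measurableSet_tq _
  have hae : ∀ᵐ x : Rn n, ∀ i, x ∈ A i → 2 ^ i ≤ C * 3 ^ n * ENNReal.ofReal (u x) := by
    have h1 : ∀ᵐ x : Rn n, ∀ q, x ∈ tq q →
        U (tq q) ≤ C * volume (tq q) * ENNReal.ofReal (u x) :=
      ae_all_iff.2 fun q => (ae_restrict_iff' (measurableSet_tq q)).1 (hU q)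
    filter_upwards [h1] with x hx i hi
    simp only [hA, mem_iUnion] at hi
    obtain ⟨p, hp, hxp⟩ := hi
    have h2 := hx _ hxp
    rw [← (Finset.mem_filter.1 hp).2]
    have h3 : volume (dq p.2) * 2 ^ m p.2 ≤
        volume (dq p.2) * (C * 3 ^ n * ENNReal.ofReal (u x)) := by
      calc _ = 2 ^ m p.2 * volume (dq p.2) := mul_comm _ _
        _ ≤ U (tq p.2) := (hm1 _).trans (measure_mono (dq_subset_tq _))
        _ ≤ _ := h2
        _ = _ := by rw [volume_tq]; ring
    rwa [ENNReal.mul_le_mul_iff_right (volume_dq_ne_zero _) (volume_dq_ne_top _)] at h3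
  calc ∑ p ∈ F₀, (lev κ W l).indicator (fun p => 2 ^ p.1 * U (dq p.2)) p
      = ∑ p ∈ F, 2 ^ p.1 * U (dq p.2) := by
        rw [hF, Finset.sum_filter]; rfl
    _ = ∑ i ∈ F.image (fun p => m p.2), ∑ p ∈ F with m p.2 = i, 2 ^ p.1 * U (dq p.2) :=
        (Finset.sum_fiberwise_of_maps_to (fun p hp => Finset.mem_image_of_mem _ hp) _).symm
    _ ≤ ∑' i, ∑ p ∈ F with m p.2 = i, 2 ^ p.1 * U (dq p.2) := ENNReal.sum_le_tsum _
    _ ≤ ∑' i, 2 * 2 ^ i * (2 * K * κ (A i)) := by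
        refine ENNReal.tsum_le_tsum fun i => ?_
        refine le_trans ?_ (mul_le_mul_right (sum_lev_le hK _ fun p hp =>
          hFl p (Finset.mem_filter.1 hp).1) _)
        rw [Finset.mul_sum]
        refine Finset.sum_le_sum fun p hp => ?_
        calc 2 ^ p.1 * U (dq p.2) ≤ 2 ^ p.1 * (2 ^ (m p.2 + 1) * volume (dq p.2)) := by
              gcongr; exact hm2 _
          _ = _ := by
              rw [(Finset.mem_filter.1 hp).2, two_zpow_add, zpow_one]; ring
    _ = 2 * (2 * K) * ∑' i, ∫⁻ x, ‖g x‖ₑ * (A i).indicator (fun _ => (2 : ℝ≥0∞) ^ i) x := by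
        rw [← ENNReal.tsum_mul_left]
        refine tsum_congr fun i => ?_
        have : ∫⁻ x, ‖g x‖ₑ * (A i).indicator (fun _ => (2 : ℝ≥0∞) ^ i) x = κ (A i) * 2 ^ i := by
          rw [hκ, kap_apply g (hAm i), ← lintegral_mul_const _ (by fun_prop),
            ← lintegral_indicator (hAm i)]
          refine lintegral_congr fun x => ?_
          by_cases hx : x ∈ A i <;> simp [hx]
        rw [this]; ring
    _ = 2 * (2 * K) * ∫⁻ x, ‖g x‖ₑ * ∑' i, (A i).indicator (fun _ => (2 : ℝ≥0∞) ^ i) x := by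
        have hAa : ∀ i, AEMeasurable
            (fun x => ‖g x‖ₑ * (A i).indicator (fun _ => (2 : ℝ≥0∞) ^ i) x) := fun i =>
          (hg.enorm.mul (measurable_const.indicator (hAm i))).aemeasurable
        rw [← lintegral_tsum hAa]
        simp only [ENNReal.tsum_mul_left]
    _ ≤ 2 * (2 * K) * ∫⁻ x, 2 * (C * 3 ^ n) * (‖g x‖ₑ * ENNReal.ofReal (u x)) := by
        refine mul_le_mul_right (lintegral_mono_ae ?_) _
        filter_upwards [hae] with x hx
        calc _ ≤ ‖g x‖ₑ * (2 * (C * 3 ^ n * ENNReal.ofReal (u x))) := by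
              gcongr
              exact tsum_two_zpow_le (by finiteness) hx
          _ = _ := by ring
    _ = _ := by
        rw [lintegral_const_mul' _ _ (by finiteness)]
        ring

/-- The set where `2 ^ i ≤ v < 2 ^ (i + 1)`. -/
def layer (v : Rn n → ℝ) (i : ℤ) : Set (Rn n) :=
  {x | 2 ^ i ≤ ENNReal.ofReal (v x) ∧ ENNReal.ofReal (v x) < 2 ^ (i + 1)}

lemma measurableSet_layer {v : Rn n → ℝ} (hv : Measurable v) (i : ℤ) :
    MeasurableSet (layer v i) :=
  (measurableSet_le measurable_const hv.ennreal_ofReal).inter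
    (measurableSet_lt hv.ennreal_ofReal measurable_const)

lemma wm_layer_le {v : Rn n → ℝ} {i : ℤ} {X : Set (Rn n)} (hX : MeasurableSet X)
    (hXi : X ⊆ layer v i) :
    2 ^ i * volume X ≤ wm v X ∧ wm v X ≤ 2 ^ (i + 1) * volume X := by
  rw [wm_apply v hX, wMeas, ← setLIntegral_const, ← setLIntegral_const]
  exact ⟨setLIntegral_mono' hX fun x hx => (hXi hx).1,
    setLIntegral_mono' hX fun x hx => (hXi hx).2.le⟩

lemma wm_mul_layer_le {u v : Rn n → ℝ} {i : ℤ} {X : Set (Rn n)} (hX : MeasurableSet X)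
    (hXi : X ⊆ layer v i) : wm (fun x => u x * v x) X ≤ 2 ^ (i + 1) * wm u X := by
  rw [wm_apply _ hX, wm_apply _ hX, wMeas, wMeas, ← lintegral_const_mul' _ _ (two_zpow_ne_top _)]
  refine setLIntegral_mono' hX fun x hx => ?_
  have hvx : 0 ≤ v x := by
    by_contra hlt
    have h1 := (hXi hx).1
    rw [ENNReal.ofReal_of_nonpos (not_le.1 hlt).le, nonpos_iff_eq_zero] at h1
    exact two_zpow_ne_zero i h1
  rw [ENNReal.ofReal_mul' hvx, mul_comm]
  gcongr
  exact (hXi hx).2.le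

lemma inv_two_pow_le_of_le {a b s c : ℕ} (h : a + b ≤ s + c) :
    ((2 : ℝ≥0∞) ^ s)⁻¹ ≤ 2 ^ c * ((2 ^ a)⁻¹ * (2 ^ b)⁻¹) := by
  rw [inv_two_pow_eq_zpow, inv_two_pow_eq_zpow, inv_two_pow_eq_zpow, ← zpow_natCast,
    ← two_zpow_add, ← two_zpow_add]
  exact two_zpow_mono (by omega)

lemma exponent_le {j J c K s : ℕ} {l : ℤ} (hK : 1 ≤ K) (h1 : 6 * (j - J) ≤ s)
    (h2 : ((l - j).natAbs - (c + 1)) / K ≤ s) :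
    2 * j + l.natAbs / (2 * K) ≤ s + (3 * J + c + 1) := by
  set t := l.natAbs / (2 * K) with ht
  have h3 : t * (2 * K) ≤ l.natAbs := Nat.div_mul_le_self _ _
  have h4 : (l - j).natAbs - (c + 1) < (s + 1) * K := by
    rw [← Nat.div_lt_iff_lt_mul hK]; omega
  have h5 : l.natAbs ≤ j + c + 1 + (s + 1) * K := by omega
  have h6 : (2 * t) * K ≤ (j + c + 1 + (s + 1)) * K := by nlinarith
  have h7 := Nat.le_of_mul_le_mul_right h6 hK
  omega

lemma Decay.layer_le {u v : Rn n → ℝ} {M N J c j : ℕ} {C : ℝ≥0∞} (hd : Decay (wm u) M)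
    (hM : 1 ≤ M) (hW : PowDom (wm v) N C) (hN : 1 ≤ N) (hc : C ≤ 2 ^ c) {k l : ℤ} {q : Idx n}
    {X : Set (Rn n)} (hX : MeasurableSet X) (hXq : X ⊆ dq q) (hXv : X ⊆ layer v (k + j))
    (hvol : volume X ≤ (2 ^ (M * 6 * (j - J)))⁻¹ * volume (dq q))
    (hl1 : 2 ^ (k + l) * volume (dq q) ≤ wm v (dq q))
    (hl2 : wm v (dq q) ≤ 2 ^ (k + l + 1) * volume (dq q)) :
    wm u X ≤ 2 ^ (3 * J + c + 1) * ((2 ^ (2 * j))⁻¹ * (2 ^ (l.natAbs / (2 * (N * M))))⁻¹) *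
      wm u (dq q) := by
  have h1 := wm_layer_le hX hXv
  have h2 := hW.volume_level_le hN hc hX hXq h1.1 h1.2 hl1 hl2
  rw [add_sub_add_left_eq_sub] at h2
  set s := max (6 * (j - J)) (((l - j).natAbs - (c + 1)) / (N * M)) with hs
  have h3 : wm u X ≤ (2 ^ s)⁻¹ * wm u (dq q) := by
    rcases max_choice (6 * (j - J)) (((l - j).natAbs - (c + 1)) / (N * M)) with h | h
    · rw [hs, h]
      exact hd _ _ _ hX hXq (by rwa [← mul_assoc])
    · rw [hs, h]
      refine hd _ _ _ hX hXq (h2.trans ?_)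
      gcongr
      · norm_num
      · rw [← Nat.div_div_eq_div_mul]
        exact Nat.mul_div_le _ _
  refine h3.trans ?_
  gcongr
  exact inv_two_pow_le_of_le (exponent_le (Nat.mul_pos hN hM) (le_max_left _ _)
    (le_max_right _ _))

lemma tsum_natCast_inv_le : ∑' j : ℕ, (2 : ℝ≥0∞) ^ (j + 1) * (2 ^ (2 * j))⁻¹ ≤ 4 := by
  calc _ = ∑' j : ℕ, 2 * (2 : ℝ≥0∞)⁻¹ ^ j := by
        refine tsum_congr fun j => ?_
        rw [inv_two_pow_eq_zpow, ← zpow_natCast, ← two_zpow_add,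
          show ((j + 1 : ℕ) : ℤ) + -((2 * j : ℕ) : ℤ) = 1 + -(j : ℤ) by push_cast; ring,
          two_zpow_add, zpow_one, ← inv_two_pow_eq_zpow, ENNReal.inv_pow]
    _ ≤ 4 := by
        rw [ENNReal.tsum_mul_left, ENNReal.tsum_geometric, ENNReal.one_sub_inv_two, inv_inv]
        norm_num

theorem exists_mixed_weak_type (hn : 0 < n) {ϱ : ℝ} (hϱ : 2 < ϱ) {u v : Rn n → ℝ} (hv : Measurable v)
    (hv0 : ∀ᵐ x, 0 < v x) {N N' : ℕ} {A C C' : ℝ≥0∞} (hA : A ≠ ∞) (hC : C ≠ ∞) (hC' : C' ≠ ∞)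
    (hN : 1 ≤ N) (hW : PowDom (wm v) N C) (hU : PowDom (wm u) N' C')
    (hUA : ∀ (c : Rn n) (r : ℝ), 0 < r → ∀ᵐ x ∂volume.restrict (cube c r),
      wm u (cube c r) ≤ A * volume (cube c r) * ENNReal.ofReal (u x)) :
    ∃ D : ℝ≥0∞, D ≠ ∞ ∧ ∀ g : Rn n → ℝ, Measurable g → Integrable g → HasCompactSupport g →
      wm (fun x => u x * v x) {x | ENNReal.ofReal (v x) < varHeat n ϱ g x} ≤
        D * ∫⁻ x, ‖g x‖ₑ * ENNReal.ofReal (u x) := by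
  obtain ⟨M, hM, hd⟩ := hU.exists_decay hn hC'
  obtain ⟨M', hM', hd'⟩ := hW.exists_decay hn hC
  obtain ⟨K, hK, hcar⟩ := hW.exists_carleson hC hM' hd'
  obtain ⟨c, hc⟩ := exists_le_two_pow hC
  obtain ⟨J, hJ⟩ := exists_bad_sets hn hϱ (M * 6)
  have hNM : 1 ≤ 2 * (N * M) := by have := Nat.mul_pos hN hM; omega
  set c' := 3 * J + c + 1 with hc'
  set B : ℝ≥0∞ := 2 * (2 * K) * (2 * (A * 3 ^ n)) with hB
  refine ⟨2 ^ c' * 4 * (2 * (2 * (2 * (N * M) : ℕ))) * B, by finiteness,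
    fun g hg hgi hgc => ?_⟩
  rcases eq_or_ne (kap g univ) 0 with h0 | h0
  · have hg0 : g =ᵐ[volume] fun _ => 0 := by
      rw [kap_univ, lintegral_eq_zero_iff hg.enorm] at h0
      filter_upwards [h0] with x hx
      simpa using hx
    have he : {x | ENNReal.ofReal (v x) < varHeat n ϱ g x} = ∅ := by
      ext x
      simp [varHeat_congr_ae hg0, varHeat_zero (show 0 < ϱ by linarith)]
    rw [he, measure_empty]
    exact zero_le
  obtain ⟨S, hS1, hS2, hS3⟩ := hJ g hg hgi hgc h0
  set κ := kap g with hκ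
  set I := ∫⁻ x, ‖g x‖ₑ * ENNReal.ofReal (u x) with hI
  have hlev : ∀ l, ∑' p : lev κ (wm v) l, 2 ^ p.1.1 * wm u (dq p.1.2) ≤ B * I := fun l =>
    tsum_lev_le hA hU.dq_ne_zero hU.dq_ne_top (fun q => hUA _ _ (by have := ell_pos q; linarith))
      hg fun p hp => hcar κ l p hp
  set X : ℕ → ℤ × Idx n → Set (Rn n) := fun j p => S j p.1 p.2 ∩ layer v (p.1 + j) with hX
  have hXm : ∀ j p, MeasurableSet (X j p) := fun j p =>
    (hS1 j p.1 p.2).1.inter (measurableSet_layer hv _)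
  have hcov : {x | ENNReal.ofReal (v x) < varHeat n ϱ g x} ≤ᵐ[wm fun x => u x * v x]
      (⋃ j, ⋃ l, ⋃ p : lev κ (wm v) l, X j p.1 : Set (Rn n)) := by
    refine (withDensity_absolutelyContinuous volume _).ae_le ?_
    filter_upwards [hv0] with x hvx hx
    obtain ⟨m, hm⟩ := ENNReal.exists_mem_Ico_zpow (ENNReal.ofReal_pos.2 hvx).ne' ofReal_ne_top
      one_lt_two ofNat_ne_top
    obtain ⟨j, q, hq, hxq⟩ := hS3 x m (hm.1.trans_lt hx)
    obtain ⟨i, hi1, hi2⟩ := exists_level (hW.dq_ne_zero q) (hW.dq_ne_top q)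
    have e1 : m - j + (i - (m - j)) = i := by ring
    have e2 : m - (j : ℤ) + j = m := by ring
    refine mem_iUnion.2 ⟨j, mem_iUnion.2 ⟨i - (m - j), mem_iUnion.2 ⟨⟨(m - j, q), hq, ?_, ?_⟩,
      hxq, ?_⟩⟩⟩
    · rwa [e1]
    · rwa [e1]
    · rw [e2]; exact hm
  calc _ ≤ wm (fun x => u x * v x) (⋃ j, ⋃ l, ⋃ p : lev κ (wm v) l, X j p.1) :=
        measure_mono_ae hcov
    _ ≤ ∑' j, ∑' l, ∑' p : lev κ (wm v) l, wm (fun x => u x * v x) (X j p.1) := by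
        refine (measure_iUnion_le _).trans (ENNReal.tsum_le_tsum fun j => ?_)
        refine (measure_iUnion_le _).trans (ENNReal.tsum_le_tsum fun l => ?_)
        exact measure_iUnion_le _
    _ ≤ ∑' j : ℕ, ∑' l : ℤ, ∑' p : lev κ (wm v) l, 2 ^ c' * (2 ^ (j + 1) * (2 ^ (2 * j))⁻¹) *
          (2 ^ (l.natAbs / (2 * (N * M))))⁻¹ * (2 ^ p.1.1 * wm u (dq p.1.2)) := by
        refine ENNReal.tsum_le_tsum fun j => ENNReal.tsum_le_tsum fun l =>
          ENNReal.tsum_le_tsum fun p => ?_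
        have hp := p.2
        refine (wm_mul_layer_le (hXm j p.1) inter_subset_right).trans ?_
        have h1 := Decay.layer_le hd hM hW hN hc (hXm j p.1)
          (inter_subset_left.trans (hS1 j p.1.1 p.1.2).2) inter_subset_right
          ((measure_mono inter_subset_left).trans (hS2 j _ _ hp.1)) hp.2.1 hp.2.2
        refine (mul_le_mul_right h1 _).trans (le_of_eq ?_)
        rw [add_assoc, two_zpow_add, show ((j : ℤ) + 1) = ((j + 1 : ℕ) : ℤ) by push_cast; rfl,
          zpow_natCast]
        ring
    _ ≤ ∑' j : ℕ, ∑' l : ℤ, 2 ^ c' * (2 ^ (j + 1) * (2 ^ (2 * j))⁻¹) *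
          (2 ^ (l.natAbs / (2 * (N * M))))⁻¹ * (B * I) := by
        refine ENNReal.tsum_le_tsum fun j => ENNReal.tsum_le_tsum fun l => ?_
        rw [ENNReal.tsum_mul_left]
        exact mul_le_mul_right (hlev l) _
    _ = 2 ^ c' * (∑' j : ℕ, 2 ^ (j + 1) * (2 ^ (2 * j))⁻¹) *
          (∑' l : ℤ, (2 ^ ((l - 0).natAbs / (2 * (N * M))))⁻¹) * (B * I) := by
        simp only [ENNReal.tsum_mul_left, ENNReal.tsum_mul_right, sub_zero]
    _ ≤ 2 ^ c' * 4 * (2 * (2 * (2 * (N * M) : ℕ))) * (B * I) := by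
        gcongr
        · exact tsum_natCast_inv_le
        · exact tsum_int_inv_two_pow_div hNM 0
    _ = _ := by ring

lemma varHeat_dim_zero {ϱ : ℝ} (hϱ : 0 < ϱ) (g : Rn 0 → ℝ) (x : Rn 0) : varHeat 0 ϱ g x = 0 := by
  have h : ∀ t, heatSg 0 t g x = ∫ y, g y := fun t => by
    refine integral_congr_ae (Filter.Eventually.of_forall fun y => ?_)
    simp [Subsingleton.elim x y]
  simp [varHeat, h, Real.zero_rpow hϱ.ne', hϱ]

lemma HasCompactSupport.integrable_mul {f v : Rn n → ℝ} (hf : Measurable f) {M : ℝ}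
    (hM : ∀ x, |f x| ≤ M) (hs : HasCompactSupport f) (hv : LocallyIntegrable v) :
    Integrable fun x => f x * v x := by
  have h1 : IntegrableOn (fun x => f x * v x) (tsupport f) :=
    (hv.integrableOn_isCompact hs).bdd_mul (c := M) hf.aestronglyMeasurable
      (Filter.Eventually.of_forall hM)
  refine (integrableOn_iff_integrable_of_support_subset fun x hx => subset_tsupport f ?_).1 h1
  exact left_ne_zero_of_mul hx

end MixedWeak

/-- Sawyer-type mixed weak type inequality for the variation operator of
the classical heat semigroup, with `μ ∈ A₁` and `ν ∈ A_∞`. -/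
theorem statement8 (n : ℕ) (ϱ : ℝ) (hϱ : 2 < ϱ)
    (μ ν : Rn n → ℝ) (hμw : IsWeight μ) (hνw : IsWeight ν)
    (hμ : IsA1 μ) (hν : IsAinfty ν) :
    ∃ C : ℝ, 0 < C ∧
      ∀ f : Rn n → ℝ, Measurable f → (∃ M : ℝ, ∀ x, |f x| ≤ M) → HasCompactSupport f →
      ∀ l : ℝ, 0 < l →
        ENNReal.ofReal l *
          wMeas (fun x => μ x * ν x)
            {x | ENNReal.ofReal (l * ν x) < varHeat n ϱ (fun y => f y * ν y) x} ≤
          ENNReal.ofReal C * ∫⁻ x, ENNReal.ofReal (|f x| * μ x * ν x) := by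
  have hϱ0 : 0 < ϱ := by linarith
  rcases Nat.eq_zero_or_pos n with rfl | hn
  · refine ⟨1, one_pos, fun f _ _ _ l _ => ?_⟩
    simp [MixedWeak.varHeat_dim_zero hϱ0, wMeas]
  obtain ⟨C', hC', hU⟩ := MixedWeak.IsA1.powDom hμw hμ
  obtain ⟨N, C, hN, hC, hW⟩ := MixedWeak.IsAinfty.powDom hνw hν
  obtain ⟨A, -, hA⟩ := hμ
  set v := hνw.1.aestronglyMeasurable.mk ν with hv
  have hvm : Measurable v := hνw.1.aestronglyMeasurable.stronglyMeasurable_mk.measurable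
  have hve : ν =ᵐ[volume] v := hνw.1.aestronglyMeasurable.ae_eq_mk
  have hWv : MixedWeak.wm ν = MixedWeak.wm v := withDensity_congr_ae (by
    filter_upwards [hve] with x hx
    rw [hx])
  have hv0 : ∀ᵐ x, 0 < v x := by
    filter_upwards [hνw.2, hve] with x h1 h2
    rwa [← h2]
  rw [hWv] at hW
  obtain ⟨D, hD, h⟩ := MixedWeak.exists_mixed_weak_type hn hϱ hvm hv0 (ofReal_ne_top (r := A)) hC
    hC' hN hW hU fun c r hr => MixedWeak.IsA1.average_le hA hr
  refine ⟨D.toReal + 1, by positivity, fun f hf hM hfs l hl => ?_⟩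
  obtain ⟨M, hM⟩ := hM
  set g : Rn n → ℝ := fun x => l⁻¹ * (f x * v x) with hg
  have hfv : (fun x => f x * ν x) =ᵐ[volume] fun x => f x * v x := by
    filter_upwards [hve] with x hx
    rw [hx]
  have hfi : Integrable fun x => f x * v x :=
    (MixedWeak.HasCompactSupport.integrable_mul hf hM hfs hνw.1).congr hfv
  have hgw := h g ((hf.mul hvm).const_mul _) (hfi.const_mul _)
    ((HasCompactSupport.mul_right hfs).mul_left)
  have hV : ∀ x, varHeat n ϱ (fun y => f y * ν y) x = ENNReal.ofReal l * varHeat n ϱ g x := by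
    intro x
    rw [← MixedWeak.varHeat_const_mul hϱ0 hl, MixedWeak.varHeat_congr_ae hfv]
    congr 1
    ext y
    rw [hg]
    field_simp
  have hset : {x | ENNReal.ofReal (l * ν x) < varHeat n ϱ (fun y => f y * ν y) x} =
      {x | ENNReal.ofReal (ν x) < varHeat n ϱ g x} := by
    ext x
    rw [mem_ofPred_eq, mem_ofPred_eq, hV, ENNReal.ofReal_mul hl.le,
      ENNReal.mul_lt_mul_iff_right (ENNReal.ofReal_pos.2 hl).ne' ofReal_ne_top]
  have hle : wMeas (fun x => μ x * ν x) {x | ENNReal.ofReal (ν x) < varHeat n ϱ g x} =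
      MixedWeak.wm (fun x => μ x * v x) {x | ENNReal.ofReal (v x) < varHeat n ϱ g x} := by
    have h1 : MixedWeak.wm (fun x => μ x * v x) = MixedWeak.wm (fun x => μ x * ν x) :=
      withDensity_congr_ae (by
        filter_upwards [hve] with x hx
        rw [hx])
    have h2 : ({x | ENNReal.ofReal (ν x) < varHeat n ϱ g x} : Set (Rn n)) =ᵐ[volume]
        ({x | ENNReal.ofReal (v x) < varHeat n ϱ g x} : Set (Rn n)) :=
      Filter.eventuallyEq_set.2 (by
        filter_upwards [hve] with x hx
        rw [hx])
    rw [h1, MixedWeak.wm, withDensity_apply' _ _, wMeas, Measure.restrict_congr_set h2]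
  have hint : ∫⁻ x, ‖g x‖ₑ * ENNReal.ofReal (μ x) =
      ENNReal.ofReal l⁻¹ * ∫⁻ x, ENNReal.ofReal (|f x| * μ x * ν x) := by
    rw [← lintegral_const_mul' _ _ ofReal_ne_top]
    refine lintegral_congr_ae ?_
    filter_upwards [hve, hv0, hμw.2] with x h1 h2 h3
    rw [h1, hg, ← ofReal_norm, ← ENNReal.ofReal_mul (norm_nonneg _),
      ← ENNReal.ofReal_mul (by positivity), Real.norm_eq_abs, abs_mul, abs_mul,
      abs_of_pos (inv_pos.2 hl), abs_of_pos h2]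
    congr 1
    ring
  rw [hset, hle]
  calc _ ≤ ENNReal.ofReal l * (D * (ENNReal.ofReal l⁻¹ *
        ∫⁻ x, ENNReal.ofReal (|f x| * μ x * ν x))) := by
        rw [← hint]
        gcongr
    _ = ENNReal.ofReal (l * l⁻¹) * (D * ∫⁻ x, ENNReal.ofReal (|f x| * μ x * ν x)) := by
        rw [ENNReal.ofReal_mul hl.le]; ring
    _ ≤ _ := by
        rw [mul_inv_cancel₀ hl.ne', ENNReal.ofReal_one, one_mul]
        gcongr
        exact (ENNReal.ofReal_toReal hD).symm.le.trans (ENNReal.ofReal_le_ofReal (by linarith))
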